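/- arXiv:1203.5244 — 2 statements merged into one kernel-verified Lean document; each statement's English description precedes it below -/
import Mathlib

section
/- Let $q\geq4$, $m\geq2$, $0\leq t\leq m-2$, $2\leq s\leq q-2$. The second weight codewords of $R_q(t(q-1)+s,m)$, i.e., those with $|f|=(q-s+1)(q-1)q^{m-t-2}$, are exactly the codewords whose support $S$ is contained in an affine subspace $G$ of codimension $t$ and, inside $G$, is either (A) the union of $q-s+1$ parallel affine subspaces of codimension $t+1$ minus their intersection with a non-parallel affine subspace of codimension $t+1$, or (B) the union of $q-s+1$ affine subspaces of codimension $t+1$ meeting in a common affine subspace of codimension $t+2$, minus that common intersection. -/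
/-- Membership in the generalized Reed–Muller code `R_q(r,m)`: `f` is represented by a
polynomial of total degree at most `r` (equivalently, its reduced form has degree ≤ r). -/
def RM (F : Type) [Field F] (r m : ℕ) (f : (Fin m → F) → F) : Prop :=
  ∃ P : MvPolynomial (Fin m) F, P.totalDegree ≤ r ∧ ∀ x, MvPolynomial.eval x P = f x

/-- Hamming weight: the size of the support of `f`. -/
def wt {F : Type} [Field F] [Fintype F] [DecidableEq F] {m : ℕ} (f : (Fin m → F) → F) : ℕ :=
  (Finset.univ.filter fun x => f x ≠ 0).card

/-- `Dg n f`: the function `f` is a polynomial function of degree `< n`. -/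
inductive Dg {F : Type} [Field F] {V : Type} [AddCommGroup V] [Module F V] :
    ℕ → (V → F) → Prop
  | zero (n : ℕ) : Dg n (fun _ => 0)
  | const (n : ℕ) (c : F) : Dg (n + 1) (fun _ => c)
  | add {n : ℕ} {f g : V → F} : Dg n f → Dg n g → Dg n (fun x => f x + g x)
  | mul {n : ℕ} {f : V → F} (l : V →ₗ[F] F) : Dg n f → Dg (n + 1) (fun x => l x * f x)

namespace Dg

variable {F : Type} [Field F] {V W : Type} [AddCommGroup V] [Module F V]
  [AddCommGroup W] [Module F W]

theorem mono {n n' : ℕ} {f : V → F} (h : Dg n f) (hn : n ≤ n') : Dg n' f := by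
  induction h generalizing n' with
  | zero n => exact Dg.zero _
  | const n c =>
    obtain ⟨k, rfl⟩ : ∃ k, n' = k + 1 := ⟨n' - 1, by omega⟩
    exact Dg.const _ _
  | add _ _ h1 h2 => exact Dg.add (h1 hn) (h2 hn)
  | mul l _ h1 =>
    obtain ⟨k, rfl⟩ : ∃ k, n' = k + 1 := ⟨n' - 1, by omega⟩
    exact Dg.mul l (h1 (by omega))

theorem smul {n : ℕ} {f : V → F} (c : F) (h : Dg n f) : Dg n (fun x => c * f x) := by
  induction h with
  | zero n => simpa using Dg.zero n
  | const n d => exact Dg.const n (c * d)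
  | add _ _ h1 h2 => simpa [mul_add] using Dg.add h1 h2
  | mul l _ h1 => simpa [mul_left_comm] using Dg.mul l h1

theorem sub {n : ℕ} {f g : V → F} (h : Dg n f) (h' : Dg n g) : Dg n (fun x => f x - g x) := by
  simpa [sub_eq_add_neg] using Dg.add h (h'.smul (-1))

theorem eq_zero_of {n : ℕ} {f : V → F} (h : Dg n f) (hn : n = 0) : ∀ x, f x = 0 := by
  induction h with
  | zero n => simp
  | const n d => omega
  | add _ _ h1 h2 => intro x; simp [h1 hn x, h2 hn x]
  | mul l _ h1 => omega

theorem eq_zero {f : V → F} (h : Dg 0 f) : ∀ x, f x = 0 := h.eq_zero_of rfl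

theorem eq_const_of {n : ℕ} {f : V → F} (h : Dg n f) (hn : n ≤ 1) : ∃ c, ∀ x, f x = c := by
  induction h with
  | zero n => exact ⟨0, fun _ => rfl⟩
  | const n d => exact ⟨d, fun _ => rfl⟩
  | add _ _ h1 h2 =>
    obtain ⟨c, hc⟩ := h1 hn
    obtain ⟨d, hd⟩ := h2 hn
    exact ⟨c + d, fun x => by beta_reduce; rw [hc, hd]⟩
  | @mul n f l hf h1 =>
    obtain rfl : n = 0 := by omega
    exact ⟨0, fun x => by beta_reduce; rw [hf.eq_zero, mul_zero]⟩

theorem eq_affine_of {n : ℕ} {f : V → F} (h : Dg n f) (hn : n ≤ 2) :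
    ∃ (l : V →ₗ[F] F) (c : F), ∀ x, f x = l x + c := by
  induction h with
  | zero n => exact ⟨0, 0, fun _ => by simp⟩
  | const n d => exact ⟨0, d, fun _ => by simp⟩
  | add _ _ h1 h2 =>
    obtain ⟨l, c, hc⟩ := h1 hn
    obtain ⟨l', d, hd⟩ := h2 hn
    exact ⟨l + l', c + d, fun x => by beta_reduce; rw [hc, hd, LinearMap.add_apply]; ring⟩
  | @mul n f l hf h1 =>
    obtain ⟨c, hc⟩ := hf.eq_const_of (by omega)
    exact ⟨c • l, 0, fun x => by beta_reduce; rw [hc]; simp [mul_comm]⟩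

theorem comp {n : ℕ} {f : V → F} (h : Dg n f) (L : W →ₗ[F] V) (p : V) :
    Dg n (fun w => f (L w + p)) := by
  induction h with
  | zero n => exact Dg.zero n
  | const n d => exact Dg.const n d
  | add _ _ h1 h2 => exact Dg.add h1 h2
  | mul l _ h1 =>
    have := Dg.add (Dg.mul (l ∘ₗ L) h1) ((h1.smul (l p)).mono (Nat.le_succ _))
    simpa [add_mul] using this

theorem compl {n : ℕ} {f : V → F} (h : Dg n f) (L : W →ₗ[F] V) :
    Dg n (fun w => f (L w)) := by
  simpa using h.comp L 0

theorem prod {n k : ℕ} {f g : V → F} (h : Dg n f) (h' : Dg (k + 1) g) :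
    Dg (n + k) (fun x => f x * g x) := by
  induction h with
  | zero n => simpa using Dg.zero _
  | const n d => exact (h'.smul d).mono (by omega)
  | add _ _ h1 h2 => simpa [add_mul] using Dg.add h1 h2
  | mul l _ h1 =>
    have := Dg.mul l h1
    simp only [mul_assoc]
    exact this.mono (by omega)

theorem mulAff {n : ℕ} {f : V → F} (h : Dg n f) (l : V →ₗ[F] F) (c : F) :
    Dg (n + 1) (fun x => (l x + c) * f x) := by
  have := Dg.add (Dg.mul l h) ((h.smul c).mono (Nat.le_succ _))
  simpa [add_mul] using this

theorem sum {ι : Type} (s : Finset ι) {n : ℕ} {f : ι → V → F} (h : ∀ i ∈ s, Dg n (f i)) :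
    Dg n (fun x => ∑ i ∈ s, f i x) := by
  classical
  induction s using Finset.induction_on with
  | empty => simpa using Dg.zero n
  | insert a s ha ih =>
    simp only [Finset.sum_insert ha]
    exact Dg.add (h a (by simp)) (ih fun i hi => h i (by simp [hi]))

theorem pow (l : V →ₗ[F] F) (i : ℕ) : Dg (i + 1) (fun x => l x ^ i) := by
  induction i with
  | zero => simpa using Dg.const (V := V) 0 (1 : F)
  | succ i ih => simpa [pow_succ'] using Dg.mul l ih

theorem expand {n : ℕ} {f : F × W → F} (h : Dg n f) :
    ∃ g : ℕ → W → F, (∀ i, Dg (n - i) (g i)) ∧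
      ∀ a w, f (a, w) = ∑ i ∈ Finset.range n, a ^ i * g i w := by
  induction h with
  | zero n => exact ⟨fun _ _ => 0, fun i => Dg.zero _, by simp⟩
  | const n d =>
    refine ⟨fun i _ => if i = 0 then d else 0, fun i => ?_, fun a w => ?_⟩
    · rcases i with _ | i
      · simpa using Dg.const n d
      · simpa using Dg.zero _
    · rw [Finset.sum_range_succ']; simp
  | add _ _ h1 h2 =>
    obtain ⟨g, hg, hg'⟩ := h1
    obtain ⟨k, hk, hk'⟩ := h2
    exact ⟨fun i w => g i w + k i w, fun i => (hg i).add (hk i), fun a w => by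
      beta_reduce; rw [hg', hk', ← Finset.sum_add_distrib]; simp [mul_add]⟩
  | @mul n f l hf h1 =>
    obtain ⟨g, hg, hg'⟩ := h1
    have hgn : ∀ w, g n w = 0 := (hg n).eq_zero_of (by omega)
    refine ⟨fun i w => l (0, w) * g i w + (if i = 0 then 0 else l (1, 0) * g (i - 1) w),
      fun i => Dg.add ?_ ?_, fun a w => ?_⟩
    · by_cases hi : i ≤ n
      · have := Dg.mul (l ∘ₗ LinearMap.inr F F W) (hg i)
        rw [show n + 1 - i = n - i + 1 by omega]
        simpa using this
      · have h0 : ∀ w, g i w = 0 := (hg i).eq_zero_of (by omega)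
        simpa [h0] using Dg.zero _
    · rcases i with _ | i
      · simpa using Dg.zero _
      · have := (hg i).smul (l (1, 0))
        simpa using this
    · have hl : l (a, w) = l (0, w) + a * l (1, 0) := by
        have : ((a, w) : F × W) = (0, w) + a • (1, 0) := by simp
        rw [this, map_add, map_smul]; simp
      beta_reduce; rw [hg', hl]
      simp only [mul_add, Finset.sum_add_distrib]
      rw [Finset.sum_range_succ, Finset.sum_range_succ' (fun i => a ^ i * _)]
      simp only [hgn, add_mul, Finset.mul_sum]
      simp only [mul_zero, add_zero, Nat.add_eq_zero_iff, one_ne_zero, and_false, if_false,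
        if_true, Nat.add_sub_cancel]
      rw [← Finset.sum_add_distrib]
      exact Finset.sum_congr rfl fun i _ => by ring

theorem diff {n : ℕ} {f : F × W → F} (h : Dg n f) (a b : F) :
    Dg (n - 1) (fun w => f (a, w) - f (b, w)) := by
  obtain ⟨g, hg, hg'⟩ := h.expand
  have : (fun w => f (a, w) - f (b, w)) =
      fun w => ∑ i ∈ Finset.range n, (a ^ i - b ^ i) * g i w := by
    funext w
    rw [hg', hg', ← Finset.sum_sub_distrib]
    exact Finset.sum_congr rfl fun i _ => by ring
  rw [this]
  refine Dg.sum _ fun i _ => ?_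
  rcases i with _ | i
  · simpa using Dg.zero _
  · exact ((hg (i + 1)).smul _).mono (by omega)

theorem slice {n : ℕ} {f : F × W → F} (h : Dg n f) (a : F) : Dg n (fun w => f (a, w)) := by
  simpa using h.comp (LinearMap.inr F F W) (a, 0)

/-- factor out a vanishing slice -/
theorem factor {n : ℕ} {f : F × W → F} (h : Dg n f) (c : F) (hc : ∀ w, f (c, w) = 0) :
    ∃ g : F × W → F, Dg (n - 1) g ∧ ∀ x, f x = (x.1 - c) * g x := by
  obtain ⟨g, hg, hg'⟩ := h.expand
  refine ⟨fun x => ∑ i ∈ Finset.range n,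
    g i x.2 * (∑ l ∈ Finset.range i, x.1 ^ l * c ^ (i - 1 - l)), ?_, ?_⟩
  · refine Dg.sum _ fun i hi => ?_
    have hi := Finset.mem_range.1 hi
    rcases i with _ | i
    · simpa using Dg.zero _
    have h1 : Dg (n - (i + 1)) (fun x : F × W => g (i + 1) x.2) := by
      simpa using (hg (i + 1)).compl (LinearMap.snd F F W)
    have h2 : Dg (i + 1) (fun x : F × W =>
        ∑ l ∈ Finset.range (i + 1), x.1 ^ l * c ^ (i + 1 - 1 - l)) := by
      refine Dg.sum _ fun l hl => ?_
      have hl := Finset.mem_range.1 hl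
      have := ((Dg.pow (LinearMap.fst F F W) l).smul (c ^ (i + 1 - 1 - l))).mono
        (show l + 1 ≤ i + 1 by omega)
      simpa [mul_comm] using this
    exact (h1.prod h2).mono (by omega)
  · rintro ⟨a, w⟩
    have h0 := hc w
    rw [hg'] at h0
    rw [hg', ← sub_zero (∑ i ∈ Finset.range n, a ^ i * g i w), ← h0, ← Finset.sum_sub_distrib,
      Finset.mul_sum]
    refine Finset.sum_congr rfl fun i _ => ?_
    have := (Commute.all a c).mul_geom_sum₂ i
    simp only
    rw [mul_left_comm, this]; ring

theorem factorK {n : ℕ} {f : F × W → F} (h : Dg n f) (K : Finset F)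
    (hK : ∀ c ∈ K, ∀ w, f (c, w) = 0) :
    ∃ g : F × W → F, Dg (n - K.card) g ∧ ∀ x, f x = (∏ c ∈ K, (x.1 - c)) * g x := by
  classical
  induction K using Finset.induction_on with
  | empty => exact ⟨f, by simpa using h, by simp⟩
  | insert c K hc ih =>
    obtain ⟨g, hg, hg'⟩ := ih fun c hc => hK c (by simp [hc])
    have : ∀ w, g (c, w) = 0 := by
      intro w
      have := hK c (by simp) w
      rw [hg'] at this
      rcases mul_eq_zero.1 this with h | h
      · obtain ⟨d, hd, hd'⟩ := Finset.prod_eq_zero_iff.1 h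
        have h3 : c = d := sub_eq_zero.1 hd'
        exact absurd (h3 ▸ hd) hc
      · exact h
    obtain ⟨k, hk, hk'⟩ := hg.factor c this
    refine ⟨k, by rw [Finset.card_insert_of_notMem hc]; exact hk.mono (by omega), fun x => ?_⟩
    rw [hg', hk', Finset.prod_insert hc]; ring

theorem sliceK {n : ℕ} {f : F × W → F} (h : Dg n f) (K : Finset F)
    (hK : ∀ c ∈ K, ∀ w, f (c, w) = 0) (a : F) : Dg (n - K.card) (fun w => f (a, w)) := by
  obtain ⟨g, hg, hg'⟩ := h.factorK K hK
  simp only [hg']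
  exact (hg.slice a).smul _

theorem push [Fintype F] {n : ℕ} {f : F × W → F} (h : Dg n f) (j : ℕ) :
    Dg (n + j - (Fintype.card F - 1)) (fun w => ∑ a : F, a ^ j * f (a, w)) := by
  obtain ⟨g, hg, hg'⟩ := h.expand
  have : (fun w => ∑ a : F, a ^ j * f (a, w)) =
      fun w => ∑ i ∈ Finset.range n, (∑ a : F, a ^ (i + j)) * g i w := by
    funext w
    simp only [hg', Finset.mul_sum, Finset.sum_mul]
    rw [Finset.sum_comm]
    exact Finset.sum_congr rfl fun i _ => Finset.sum_congr rfl fun a _ => by ring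
  rw [this]
  refine Dg.sum _ fun i hi => ?_
  by_cases hij : i + j < Fintype.card F - 1
  · rw [FiniteField.sum_pow_lt_card_sub_one F _ hij]
    simpa using Dg.zero _
  · exact ((hg i).smul _).mono (by omega)

end Dg

section basics

variable {F : Type} [Field F]

/-- Number of points of the support. -/
noncomputable def NW {X : Type} (f : X → F) : ℕ := Set.ncard {x | f x ≠ 0}

theorem NW_mono {X : Type} [Finite X] {f g : X → F} (h : ∀ x, f x ≠ 0 → g x ≠ 0) :
    NW f ≤ NW g := Set.ncard_le_ncard h (Set.toFinite _)

theorem NW_congr {X : Type} {f g : X → F} (h : ∀ x, f x ≠ 0 ↔ g x ≠ 0) :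
    NW f = NW g := by
  unfold NW; congr 1; ext x; exact h x

theorem NW_equiv {X Y : Type} (e : X ≃ Y) (f : Y → F) : NW (fun x => f (e x)) = NW f := by
  unfold NW
  have : {x | f (e x) ≠ 0} = e ⁻¹' {y | f y ≠ 0} := rfl
  rw [this]
  exact Set.ncard_preimage_of_injective_subset_range e.injective (by simp [e.surjective.range_eq])

theorem NW_pos {X : Type} [Finite X] {f : X → F} {x : X} (h : f x ≠ 0) : 1 ≤ NW f :=
  (Set.ncard_pos (Set.toFinite _)).2 ⟨x, h⟩

theorem NW_eq_zero {X : Type} [Finite X] {f : X → F} : NW f = 0 ↔ ∀ x, f x = 0 := by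
  unfold NW
  rw [Set.ncard_eq_zero (Set.toFinite _), Set.eq_empty_iff_forall_notMem]
  simp

theorem NW_zero_of {X : Type} {f : X → F} (h : ∀ x, f x = 0) : NW f = 0 := by
  unfold NW; simp [h]

theorem NW_le_card {X : Type} [Finite X] (f : X → F) : NW f ≤ Nat.card X := by
  unfold NW
  rw [← Set.ncard_univ]
  exact Set.ncard_le_ncard (Set.subset_univ _) (Set.toFinite _)

open Classical in
theorem NW_split {X : Type} [Finite X] (f : X → F) (p : X → Prop) :
    NW f = NW (fun x => if p x then f x else 0) + NW (fun x => if p x then 0 else f x) := by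
  unfold NW
  rw [← Set.ncard_union_eq _ (Set.toFinite _) (Set.toFinite _)]
  · congr 1; ext x; by_cases h : p x <;> simp [h]
  · rw [Set.disjoint_left]; intro x; by_cases h : p x <;> simp [h]

theorem NW_sum {X : Type} [Fintype X] {Y : Type} [Finite Y] (f : X × Y → F) :
    NW f = ∑ a : X, NW (fun y => f (a, y)) := by
  classical
  have := Fintype.ofFinite Y
  unfold NW
  simp only [Set.ncard_eq_toFinset_card', Set.toFinset_ofPred]
  simp only [Finset.card_filter, Fintype.sum_prod_type]

theorem NW_swap {X Y : Type} (f : X × Y → F) : NW f = NW (fun p : Y × X => f (p.2, p.1)) :=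
  (NW_equiv (Equiv.prodComm Y X) f).symm

theorem NW_lines {X Y : Type} [Finite X] [Finite Y] (f : X × Y → F) (h : Y → F) (c : ℕ)
    (hc : ∀ w, h w ≠ 0 → c ≤ NW (fun a => f (a, w))) : c * NW h ≤ NW f := by
  classical
  have := Fintype.ofFinite Y
  rw [NW_swap, NW_sum]
  have : NW h = ∑ w : Y, if h w ≠ 0 then 1 else 0 := by
    unfold NW
    simp only [Set.ncard_eq_toFinset_card', Set.toFinset_ofPred]
    simp only [Finset.card_filter]
  rw [this, Finset.mul_sum]
  refine Finset.sum_le_sum fun w _ => ?_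
  by_cases hw : h w = 0
  · simp [hw]
  · simpa [hw] using hc w hw

open Classical in
theorem NW_lines_add {X Y : Type} [Finite X] [Finite Y] (f : X × Y → F) (h : Y → F) (c : ℕ)
    (hc : ∀ w, h w ≠ 0 → c ≤ NW (fun a => f (a, w))) :
    c * NW h + NW (fun x => if h x.2 = 0 then f x else 0) ≤ NW f := by
  rw [NW_split f (fun x => h x.2 = 0), add_comm]
  refine Nat.add_le_add_left (NW_lines _ h c fun w hw => ?_) _
  simpa [hw] using hc w hw

open Classical in
/-- the set of vanishing slices -/
noncomputable def Kz [Fintype F] {W : Type} (f : F × W → F) : Finset F :=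
  Finset.univ.filter fun a => ∀ w, f (a, w) = 0

theorem mem_Kz [Fintype F] {W : Type} {f : F × W → F} {a : F} :
    a ∈ Kz f ↔ ∀ w, f (a, w) = 0 := by simp [Kz]

theorem Kz_lt [Fintype F] {W : Type} {f : F × W → F} (h : ∃ x, f x ≠ 0) :
    (Kz f).card + 1 ≤ Fintype.card F := by
  by_contra hc
  have : (Kz f).card = Fintype.card F := le_antisymm (Finset.card_le_univ _) (by omega)
  rw [Finset.card_eq_iff_eq_univ] at this
  obtain ⟨⟨a, w⟩, hx⟩ := h
  exact hx (mem_Kz.1 (this ▸ Finset.mem_univ a) w)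

theorem NW_sumK [Fintype F] {W : Type} [Finite W] (f : F × W → F) [DecidableEq F] :
    NW f = ∑ a ∈ (Kz f)ᶜ, NW (fun y => f (a, y)) := by
  rw [NW_sum, ← Finset.sum_add_sum_compl (Kz f), Finset.sum_eq_zero, zero_add]
  exact fun a ha => NW_zero_of (mem_Kz.1 ha)

theorem sl_le [Fintype F] {W : Type} [Finite W] (f : F × W → F) (m : ℕ)
    (h : ∀ a, a ∉ Kz f → m ≤ NW (fun y => f (a, y))) :
    (Fintype.card F - (Kz f).card) * m ≤ NW f := by
  classical
  rw [NW_sumK, ← Finset.card_compl, ← smul_eq_mul]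
  exact Finset.card_nsmul_le_sum _ _ _ fun a ha => h a (Finset.mem_compl.1 ha)

theorem sl_eq [Fintype F] {W : Type} [Finite W] (f : F × W → F) (m : ℕ)
    (h : ∀ a, a ∉ Kz f → m ≤ NW (fun y => f (a, y)))
    (hf : NW f ≤ (Fintype.card F - (Kz f).card) * m) :
    ∀ a, a ∉ Kz f → NW (fun y => f (a, y)) = m := by
  classical
  have h1 : ∑ a ∈ (Kz f)ᶜ, m = ∑ a ∈ (Kz f)ᶜ, NW (fun y => f (a, y)) := by
    apply le_antisymm
    · exact Finset.sum_le_sum fun a ha => h a (Finset.mem_compl.1 ha)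
    · rw [← NW_sumK, Finset.sum_const, Finset.card_compl, smul_eq_mul]; exact hf
  rw [Finset.sum_eq_sum_iff_of_le fun a ha => h a (Finset.mem_compl.1 ha)] at h1
  exact fun a ha => (h1 a (Finset.mem_compl.2 ha)).symm

/-- line lemma -/
theorem VD [Fintype F] {u : F → F} {c : ℕ} (h : ∀ i < c, ∑ a : F, a ^ i * u a = 0)
    (hu : ∃ a, u a ≠ 0) : c + 1 ≤ NW u := by
  classical
  obtain ⟨a0, ha0⟩ := hu
  by_contra hc
  set T : Finset F := (Finset.univ.filter fun a => u a ≠ 0).erase a0 with hT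
  have hcard : NW u = (Finset.univ.filter fun a => u a ≠ 0).card := by
    unfold NW
    simp only [Set.ncard_eq_toFinset_card', Set.toFinset_ofPred]
  have hTc : T.card < c := by
    rw [hT, Finset.card_erase_of_mem (by simp [ha0]), ← hcard]
    have := NW_pos ha0
    omega
  let p : Polynomial F := ∏ b ∈ T, (Polynomial.X - Polynomial.C b)
  have hdeg : p.natDegree = T.card := Polynomial.natDegree_finsetProd_X_sub_C_eq_card T _
  have h1 : ∑ a : F, p.eval a * u a = 0 := by
    simp only [Polynomial.eval_eq_sum_range, Finset.sum_mul]
    rw [Finset.sum_comm]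
    refine Finset.sum_eq_zero fun i hi => ?_
    have := h i (by have := Finset.mem_range.1 hi; omega)
    simp only [mul_assoc, ← Finset.mul_sum, this, mul_zero]
  rw [Finset.sum_eq_single a0] at h1
  · rcases mul_eq_zero.1 h1 with h2 | h2
    · simp only [p, Polynomial.eval_prod, Finset.prod_eq_zero_iff] at h2
      obtain ⟨b, hb, hb'⟩ := h2
      have : a0 = b := sub_eq_zero.1 (by simpa using hb')
      subst this
      simp [hT] at hb
    · exact ha0 h2
  · intro b _ hb
    by_cases hub : u b = 0
    · simp [hub]
    · have : p.eval b = 0 := by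
        simp only [p, Polynomial.eval_prod, Finset.prod_eq_zero_iff]
        exact ⟨b, by simp [hT, hb, hub], by simp⟩
      simp [this]
  · simp

theorem NW_F_le [Fintype F] (u : F → F) : NW u ≤ Fintype.card F := by
  simpa using NW_le_card u

theorem exists_push [Fintype F] {W : Type} (f : F × W → F) (hf : ∃ x, f x ≠ 0) :
    ∃ j, j + 1 ≤ Fintype.card F ∧ (∃ w, ∑ a : F, a ^ j * f (a, w) ≠ 0) ∧
      (∀ w, ∑ a : F, a ^ j * f (a, w) ≠ 0 → j + 1 ≤ NW (fun a => f (a, w))) ∧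
      (j + 1 = Fintype.card F → ∀ w, ∑ a : F, a ^ j * f (a, w) = 0 → ∀ a, f (a, w) = 0) := by
  classical
  have hex : ∃ j, ∃ w, ∑ a : F, a ^ j * f (a, w) ≠ 0 := by
    by_contra hcon
    push Not at hcon
    obtain ⟨⟨a, w⟩, hx⟩ := hf
    have := VD (u := fun a => f (a, w)) (c := Fintype.card F) (fun i _ => hcon i w) ⟨a, hx⟩
    have := NW_F_le (fun a => f (a, w))
    omega
  have hmin : ∀ i < Nat.find hex, ∀ w, ∑ a : F, a ^ i * f (a, w) = 0 := by
    intro i hi w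
    have := Nat.find_min hex hi
    push Not at this
    exact this w
  have key : ∀ w, (∃ a, f (a, w) ≠ 0) → Nat.find hex + 1 ≤ NW (fun a => f (a, w)) := fun w hw =>
    VD (fun i hi => hmin i hi w) hw
  have nz : ∀ w j, ∑ a : F, a ^ j * f (a, w) ≠ 0 → ∃ a, f (a, w) ≠ 0 := by
    intro w j hw
    by_contra hcon
    push Not at hcon
    simp [hcon] at hw
  refine ⟨Nat.find hex, ?_, Nat.find_spec hex, fun w hw => key w (nz w _ hw), ?_⟩
  · obtain ⟨w, hw⟩ := Nat.find_spec hex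
    exact (key w (nz w _ hw)).trans (NW_F_le _)
  · intro hj w hw
    by_contra hcon
    push Not at hcon
    have := VD (u := fun a => f (a, w)) (c := Fintype.card F) (fun i hi => by
      rcases Nat.lt_or_ge i (Nat.find hex) with h | h
      · exact hmin i h w
      · rw [show i = Nat.find hex by omega]; exact hw) hcon
    have := NW_F_le (fun a => f (a, w))
    omega

end basics

section spl

variable {F : Type} [Field F] {V : Type} [AddCommGroup V] [Module F V]

theorem split_ex (φ : V →ₗ[F] F) (d : V) (hd : φ d = 1) :
    ∃ e : V ≃ₗ[F] F × LinearMap.ker φ, (∀ x, (e x).1 = φ x) ∧ e d = (1, 0) := by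
  let e : V ≃ₗ[F] F × LinearMap.ker φ :=
    { toFun := fun x => (φ x, ⟨x - φ x • d, by simp [hd]⟩)
      map_add' := fun x y => by
        ext
        · simp
        · simp [add_smul]; abel
      map_smul' := fun c x => by
        ext
        · simp
        · simp [smul_sub, mul_smul]
      invFun := fun p => p.1 • d + p.2
      left_inv := fun x => by simp
      right_inv := fun p => by
        have := p.2.2
        rw [LinearMap.mem_ker] at this
        ext
        · simp [hd]
        · simp [hd] }
  refine ⟨e, fun x => rfl, ?_⟩
  ext
  · exact hd
  · simp [e, hd]

theorem split_of (φ : V →ₗ[F] F) (hφ : φ ≠ 0) :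
    ∃ e : V ≃ₗ[F] F × LinearMap.ker φ, (∀ x, (e x).1 = φ x) := by
  obtain ⟨x, hx⟩ : ∃ x, φ x ≠ 0 := by
    by_contra h; push Not at h; exact hφ (LinearMap.ext h)
  obtain ⟨e, he, _⟩ := split_ex φ ((φ x)⁻¹ • x) (by simp [hx])
  exact ⟨e, he⟩

theorem split_at (d : V) (hd : d ≠ 0) :
    ∃ (φ : V →ₗ[F] F) (e : V ≃ₗ[F] F × LinearMap.ker φ), (∀ x, (e x).1 = φ x) ∧ e d = (1, 0) := by
  obtain ⟨φ, hφ⟩ := Module.Projective.exists_dual_eq_one F hd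
  obtain ⟨e, he⟩ := split_ex φ d hφ
  exact ⟨φ, e, he⟩

theorem split_any [Finite V] (h : 1 ≤ Module.finrank F V) :
    ∃ (φ : V →ₗ[F] F) (e : V ≃ₗ[F] F × LinearMap.ker φ), φ ≠ 0 ∧ (∀ x, (e x).1 = φ x) := by
  have : Nontrivial V := Module.nontrivial_of_finrank_pos (R := F) (by omega)
  obtain ⟨d, hd⟩ := exists_ne (0 : V)
  obtain ⟨φ, hφ⟩ := Module.Projective.exists_dual_eq_one F hd
  obtain ⟨e, he⟩ := split_ex φ d hφ
  exact ⟨φ, e, fun h => by simp [h] at hφ, he.1⟩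

theorem finrank_ker_of [Finite V] (φ : V →ₗ[F] F) (e : V ≃ₗ[F] F × LinearMap.ker φ) :
    Module.finrank F V = Module.finrank F (LinearMap.ker φ) + 1 := by
  rw [e.finrank_eq, Module.finrank_prod, Module.finrank_self, add_comm]

theorem NW_e {F : Type} [Field F] {V W : Type} [AddCommGroup V] [Module F V] [AddCommGroup W]
    [Module F W] (e : V ≃ₗ[F] W) (f : V → F) : NW (fun w => f (e.symm w)) = NW f :=
  NW_equiv e.symm.toEquiv f

theorem Dg_e {F : Type} [Field F] {V W : Type} [AddCommGroup V] [Module F V] [AddCommGroup W]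
    [Module F W] (e : V ≃ₗ[F] W) {n : ℕ} {f : V → F} (h : Dg n f) :
    Dg n (fun w => f (e.symm w)) := h.compl e.symm.toLinearMap

end spl

section md

variable {F : Type} [Field F] [Fintype F]

theorem ar1 {q s k : ℕ} (hs : s ≤ q) (hk : k ≤ s) : q * (q - s) ≤ (q - k) * (q - s + k) := by
  obtain ⟨b, rfl⟩ := Nat.exists_eq_add_of_le hk
  obtain ⟨v, rfl⟩ := Nat.exists_eq_add_of_le hs
  have h1 : k + b + v - (k + b) = v := by omega
  have h2 : k + b + v - k = b + v := by omega
  rw [h1, h2]; nlinarith [Nat.zero_le (k * b)]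

theorem ar2 {q s k : ℕ} (hk : s < k) (hq : k + 1 ≤ q) : q - s ≤ (q - k) * (k - s + 1) := by
  obtain ⟨b, rfl⟩ := Nat.exists_eq_add_of_lt hk
  obtain ⟨v, rfl⟩ := Nat.exists_eq_add_of_le hq
  have h1 : s + b + 1 + 1 + v - s = b + 2 + v := by omega
  have h2 : s + b + 1 + 1 + v - (s + b + 1) = 1 + v := by omega
  have h3 : s + b + 1 - s + 1 = b + 2 := by omega
  rw [h1, h2, h3]; nlinarith [Nat.zero_le (v * b)]

/-- Minimum distance, all sizes. -/
theorem MD_aux (q : ℕ) (hq : Fintype.card F = q) (d : ℕ) : ∀ (V : Type) [AddCommGroup V]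
    [Module F V] [Finite V] (t s n : ℕ) (f : V → F), t + n = d → Module.finrank F V = t + n + 1 →
    s + 1 ≤ q → Dg (t * (q - 1) + s + 1) f → (∃ x, f x ≠ 0) → (q - s) * q ^ n ≤ NW f := by
  induction d with
  | zero =>
    intro V _ _ _ t s n f hd hr hs hD ⟨x, hx⟩
    obtain ⟨rfl, rfl⟩ : t = 0 ∧ n = 0 := by omega
    obtain ⟨φ, e, hφ, he⟩ := split_any (F := F) (V := V) (by omega)
    have hr' := finrank_ker_of φ e
    rw [← NW_e e f]
    have hD' := Dg_e e hD
    set g : F × LinearMap.ker φ → F := fun w => f (e.symm w) with hg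
    have hg0 : ∃ y, g y ≠ 0 := ⟨e x, by simpa [hg] using hx⟩
    have hK := Kz_lt hg0
    have hsl := fun a => hD'.sliceK (Kz g) (fun c hc => mem_Kz.1 hc) a
    have hks : (Kz g).card ≤ s := by
      by_contra hcon
      obtain ⟨⟨a, w⟩, hy⟩ := hg0
      exact hy ((hsl a).eq_zero_of (by omega) w)
    have h1 := sl_le g 1 (fun a ha => by
      rw [mem_Kz] at ha; push Not at ha; obtain ⟨w, hw⟩ := ha
      exact NW_pos (f := fun w => g (a, w)) hw)
    rw [hq] at h1
    simp only [pow_zero, mul_one] at h1 ⊢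
    omega
  | succ d ih =>
    intro V _ _ _ t s n f hd hr hs hD ⟨x, hx⟩
    obtain ⟨φ, e, hφ, he⟩ := split_any (F := F) (V := V) (by omega)
    have hr' := finrank_ker_of φ e
    rw [← NW_e e f]
    have hD' := Dg_e e hD
    set g : F × LinearMap.ker φ → F := fun w => f (e.symm w) with hg
    have hg0 : ∃ y, g y ≠ 0 := ⟨e x, by simpa [hg] using hx⟩
    have hK := Kz_lt hg0
    rw [hq] at hK
    have hsl := fun a => hD'.sliceK (Kz g) (fun c hc => mem_Kz.1 hc) a
    have hnz : ∀ a, a ∉ Kz g → ∃ w, g (a, w) ≠ 0 := by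
      intro a ha; rw [mem_Kz] at ha; push Not at ha; exact ha
    by_cases hks : (Kz g).card ≤ s
    · rcases n with _ | n
      · have h1 := sl_le g 1 (fun a ha => by
          obtain ⟨w, hw⟩ := hnz a ha
          exact NW_pos (f := fun w => g (a, w)) hw)
        rw [hq] at h1
        simp only [pow_zero, mul_one] at h1 ⊢
        omega
      · have h1 := sl_le g ((q - (s - (Kz g).card)) * q ^ n) (fun a ha =>
          ih _ t (s - (Kz g).card) n _ (by omega) (by omega) (by omega)
            ((hsl a).mono (by omega)) (hnz a ha))
        rw [hq] at h1
        refine le_trans ?_ h1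
        have := ar1 (q := q) (by omega) hks
        calc (q - s) * q ^ (n + 1) = (q * (q - s)) * q ^ n := by ring
          _ ≤ ((q - (Kz g).card) * (q - s + (Kz g).card)) * q ^ n := Nat.mul_le_mul_right _ this
          _ = _ := by rw [show q - (s - (Kz g).card) = q - s + (Kz g).card by omega]; ring
    · push Not at hks
      rcases t with _ | t
      · obtain ⟨⟨a, w⟩, hy⟩ := hg0
        exact absurd ((hsl a).eq_zero_of (by omega) w) hy
      · have h1 := sl_le g ((q - (s + q - 1 - (Kz g).card)) * q ^ n) (fun a ha =>
          ih _ t (s + q - 1 - (Kz g).card) n _ (by omega) (by omega) (by omega)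
            ((hsl a).mono (by rw [Nat.add_mul]; omega)) (hnz a ha))
        rw [hq] at h1
        refine le_trans ?_ h1
        have := ar2 hks hK
        rw [show q - (s + q - 1 - (Kz g).card) = (Kz g).card - s + 1 by omega, ← mul_assoc]
        exact Nat.mul_le_mul_right _ this

variable {V : Type} [AddCommGroup V] [Module F V] [Finite V]

theorem MD {q t s n : ℕ} (hq : Fintype.card F = q) {f : V → F}
    (hr : Module.finrank F V = t + n + 1) (hs : s + 1 ≤ q) (hD : Dg (t * (q - 1) + s + 1) f)
    (hf : ∃ x, f x ≠ 0) : (q - s) * q ^ n ≤ NW f :=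
  MD_aux q hq _ V t s n f rfl hr hs hD hf

variable {W : Type} [AddCommGroup W] [Module F W] [Finite W]

theorem Kz_nz {g : F × W → F} {a : F} (ha : a ∉ Kz g) : ∃ w, g (a, w) ≠ 0 := by
  rw [mem_Kz] at ha; push Not at ha; exact ha

theorem SBs1 {q t s n : ℕ} (hq : Fintype.card F = q) {f : F × W → F}
    (hr : Module.finrank F W = t + n + 1) (hs : s + 1 ≤ q) (hD : Dg (t * (q - 1) + s + 1) f)
    (hk : (Kz f).card ≤ s) (a : F) (ha : a ∉ Kz f) :
    (q - s + (Kz f).card) * q ^ n ≤ NW (fun w => f (a, w)) := by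
  have hsl := hD.sliceK (Kz f) (fun c hc => mem_Kz.1 hc) a
  have := MD (s := s - (Kz f).card) hq hr (by omega) (hsl.mono (by omega)) (Kz_nz ha)
  rwa [show q - (s - (Kz f).card) = q - s + (Kz f).card by omega] at this

theorem SBt {q t s : ℕ} {f : F × W → F}
    (hD : Dg (t * (q - 1) + s + 1) f) (hf : ∃ x, f x ≠ 0)
    (hk : s < (Kz f).card) : 1 ≤ t := by
  rcases t with _ | t
  · obtain ⟨⟨a, w⟩, hy⟩ := hf
    have hsl := hD.sliceK (Kz f) (fun c hc => mem_Kz.1 hc) a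
    exact absurd (hsl.eq_zero_of (by omega) w) hy
  · omega

theorem SBs2 {q t s n : ℕ} (hq : Fintype.card F = q) {f : F × W → F}
    (hr : Module.finrank F W = t + n) (hs : s + 1 ≤ q) (ht : 1 ≤ t)
    (hD : Dg (t * (q - 1) + s + 1) f)
    (hk : s < (Kz f).card) (a : F) (ha : a ∉ Kz f) :
    ((Kz f).card - s + 1) * q ^ n ≤ NW (fun w => f (a, w)) := by
  have hsl := hD.sliceK (Kz f) (fun c hc => mem_Kz.1 hc) a
  have hK := Kz_lt (f := f) (by obtain ⟨w, hw⟩ := Kz_nz ha; exact ⟨_, hw⟩)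
  obtain ⟨t, rfl⟩ : ∃ t', t = t' + 1 := ⟨t - 1, by omega⟩
  have := MD (s := s + q - 1 - (Kz f).card) (t := t) (n := n) hq (by omega) (by omega)
    (hsl.mono (by rw [Nat.add_mul]; omega)) (Kz_nz ha)
  rwa [show q - (s + q - 1 - (Kz f).card) = (Kz f).card - s + 1 by omega] at this

theorem SB1 {q t s n : ℕ} (hq : Fintype.card F = q) {f : F × W → F}
    (hr : Module.finrank F W = t + n + 1) (hs : s + 1 ≤ q) (hD : Dg (t * (q - 1) + s + 1) f)
    (hk : (Kz f).card ≤ s) :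
    (q - (Kz f).card) * ((q - s + (Kz f).card) * q ^ n) ≤ NW f :=
  by simpa only [hq] using sl_le f _ (SBs1 hq hr hs hD hk)

theorem SB2 {q t s n : ℕ} (hq : Fintype.card F = q) {f : F × W → F}
    (hr : Module.finrank F W = t + n) (hs : s + 1 ≤ q) (hD : Dg (t * (q - 1) + s + 1) f)
    (hf : ∃ x, f x ≠ 0) (hk : s < (Kz f).card) :
    (q - (Kz f).card) * (((Kz f).card - s + 1) * q ^ n) ≤ NW f :=
  by simpa only [hq] using sl_le f _ (SBs2 hq hr hs (SBt hD hf hk) hD hk)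

end md

section br
open Polynomial

variable {F : Type} [Field F] [Fintype F]

theorem Dg_sum_zero {n : ℕ} {g : F → F} (h : Dg n g) (hn : n ≤ Fintype.card F - 1) :
    ∑ c : F, g c = 0 := by
  have h1 : Dg n (fun x : F × Unit => g x.1) := by
    simpa using h.compl (LinearMap.fst F F Unit)
  have h2 := (h1.push 0).eq_zero_of (by omega) ()
  simpa using h2

theorem br_coeff (B : List (F × F)) (i : ℕ) :
    Dg (B.length + 1 - i)
      (fun c : F => ((B.map fun p => C (1 + p.1 * c) + C p.2 * X).prod : F[X]).coeff i) := by
  induction B generalizing i with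
  | nil =>
    rcases i with _ | i
    · simpa using Dg.const (V := F) 0 (1 : F)
    · simpa [coeff_one] using Dg.zero _
  | cons p B ih =>
    have h1 : Dg (B.length + 2 - i)
        (fun c : F => (p.1 * c + 1) *
          ((B.map fun p => C (1 + p.1 * c) + C p.2 * X).prod : F[X]).coeff i) := by
      by_cases hi : i ≤ B.length + 1
      · have := (ih i).mulAff (p.1 • LinearMap.id) 1
        rw [show B.length + 2 - i = B.length + 1 - i + 1 by omega]
        simpa using this
      · have h0 := (ih i).eq_zero_of (by omega)
        simp only [h0, mul_zero]
        exact Dg.zero _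
    rcases i with _ | i
    · have e : ∀ c : F, (((p :: B).map fun p => C (1 + p.1 * c) + C p.2 * X).prod : F[X]).coeff
          0 = (p.1 * c + 1) *
          ((B.map fun p => C (1 + p.1 * c) + C p.2 * X).prod : F[X]).coeff 0 := by
        intro c
        rw [List.map_cons, List.prod_cons, mul_coeff_zero]
        congr 1; simp; ring
      simp only [e]
      exact h1
    · have := Dg.add h1 (((ih i).smul p.2).mono (show _ ≤ B.length + 2 - (i + 1) by omega))
      have e : ∀ c : F, (((p :: B).map fun p => C (1 + p.1 * c) + C p.2 * X).prod : F[X]).coeff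
          (i + 1) = (p.1 * c + 1) *
          ((B.map fun p => C (1 + p.1 * c) + C p.2 * X).prod : F[X]).coeff (i + 1) + p.2 *
          ((B.map fun p => C (1 + p.1 * c) + C p.2 * X).prod : F[X]).coeff i := by
        intro c
        rw [List.map_cons, List.prod_cons, add_mul, coeff_add, coeff_C_mul, mul_assoc, coeff_C_mul,
          coeff_X_mul]
        ring
      simp only [e]
      exact this

theorem br_div (B : Finset (F × F)) [DecidableEq F] (k : ℕ) (c v : F)
    (h : k ≤ (B.filter fun p => 1 + p.1 * c + p.2 * v = 0).card) :
    (X - C v) ^ k ∣ ∏ p ∈ B, (C (1 + p.1 * c) + C p.2 * X : F[X]) := by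
  have h1 : (∏ p ∈ B.filter (fun p => 1 + p.1 * c + p.2 * v = 0),
      (C (1 + p.1 * c) + C p.2 * X : F[X])) ∣ ∏ p ∈ B, (C (1 + p.1 * c) + C p.2 * X : F[X]) :=
    Finset.prod_dvd_prod_of_subset _ _ _ (Finset.filter_subset _ _)
  refine dvd_trans ?_ h1
  refine (pow_dvd_pow _ h).trans ?_
  rw [← Finset.prod_const]
  refine Finset.prod_dvd_prod_of_dvd _ _ fun p hp => ?_
  rw [dvd_iff_isRoot]
  simpa using (Finset.mem_filter.1 hp).2

theorem br_main (B : Finset (F × F)) [DecidableEq F] (k : ℕ) (hk : 1 ≤ k)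
    (h : ∀ c v : F, (c ≠ 0 ∨ v ≠ 0) → k ≤ (B.filter fun p => 1 + p.1 * c + p.2 * v = 0).card) :
    (k + 1) * (Fintype.card F - 1) ≤ B.card := by
  by_contra hcon
  push Not at hcon
  set q := Fintype.card F with hq
  have hq2 : 2 ≤ q := Fintype.one_lt_card
  let P : F → F[X] := fun c => ∏ p ∈ B, (C (1 + p.1 * c) + C p.2 * X : F[X])
  let M1 : F[X] := X ^ (q - 1) - 1
  have hM1m : M1.Monic := by
    have := monic_X_pow_sub_C (1 : F) (show q - 1 ≠ 0 by omega)
    simpa [M1] using this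
  have hXM : X * M1 = ∏ v : F, (X - C v) := by
    have h1 : X * M1 = X ^ q - X := by
      simp only [M1]
      rw [mul_sub, ← pow_succ', mul_one, show q - 1 + 1 = q by omega]
    rw [h1]
    have h2 := prod_multiset_X_sub_C_of_monic_of_roots_card_eq (p := (X ^ q - X : F[X])) (by
      rw [← h1]; exact monic_X.mul hM1m) (by
      rw [hq, FiniteField.roots_X_pow_card_sub_X,
        FiniteField.X_pow_card_sub_X_natDegree_eq _ Fintype.one_lt_card]; rfl)
    rw [hq, FiniteField.roots_X_pow_card_sub_X] at h2
    rw [hq, ← h2]; rfl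
  have hM1p : M1 = ∏ v ∈ Finset.univ.erase (0 : F), (X - C v) := by
    have h1 := Finset.mul_prod_erase Finset.univ (fun v : F => (X - C v : F[X])) (Finset.mem_univ 0)
    rw [← hXM] at h1
    simp only [map_zero, sub_zero] at h1
    exact (mul_left_cancel₀ X_ne_zero h1).symm
  have hcop : ∀ S : Finset F, (S : Set F).Pairwise
      (Function.onFun IsCoprime fun v => (X - C v : F[X]) ^ k) := fun S v _ w _ hvw =>
    (isCoprime_X_sub_C_of_isUnit_sub (sub_ne_zero.2 hvw).isUnit).pow
  have hdiv0 : M1 ^ k ∣ P 0 := by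
    rw [hM1p, ← Finset.prod_pow]
    refine Finset.prod_dvd_of_coprime (hcop _) fun v hv => br_div B k 0 v (h 0 v ?_)
    exact Or.inr (by simpa using hv)
  have hdivc : ∀ c, c ≠ 0 → (X * M1) ^ k ∣ P c := by
    intro c hc
    rw [hXM, ← Finset.prod_pow]
    exact Finset.prod_dvd_of_coprime (hcop _) fun v hv => br_div B k c v (h c v (Or.inl hc))
  let M := M1 ^ k
  have hM : M.Monic := hM1m.pow k
  have hMd : M.natDegree = k * (q - 1) := by
    simp only [M]
    rw [hM1m.natDegree_pow]
    congr 1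
    exact natDegree_X_pow_sub_C
  let Λ : F[X] → F := fun p => (p /ₘ M).eval 0
  have hΛadd : ∀ p r, Λ (p + r) = Λ p + Λ r := by
    intro p r; simp only [Λ]
    rw [(div_modByMonic_unique (f := p + r) (p /ₘ M + r /ₘ M) (p %ₘ M + r %ₘ M) hM ⟨?_, ?_⟩).1,
      eval_add]
    · conv_rhs => rw [← modByMonic_add_div p M, ← modByMonic_add_div r M]
      ring
    · exact (degree_add_le _ _).trans_lt (max_lt (degree_modByMonic_lt _ hM)
        (degree_modByMonic_lt _ hM))
  have hΛsmul : ∀ (a : F) p, Λ (C a * p) = a * Λ p := by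
    intro a p; simp only [Λ]
    rw [(div_modByMonic_unique (f := C a * p) (C a * (p /ₘ M)) (C a * (p %ₘ M)) hM ⟨?_, ?_⟩).1,
      eval_mul, eval_C]
    · conv_rhs => rw [← modByMonic_add_div p M]
      ring
    · refine lt_of_le_of_lt ?_ (degree_modByMonic_lt p hM)
      rw [← smul_eq_C_mul]; exact degree_smul_le _ _
  have hΛsum : ∀ (n : ℕ) (p : ℕ → F[X]), Λ (∑ i ∈ Finset.range n, p i)
      = ∑ i ∈ Finset.range n, Λ (p i) := by
    intro n p
    induction n with
    | zero => simp [Λ]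
    | succ n ih => rw [Finset.sum_range_succ, Finset.sum_range_succ, hΛadd, ih]
  have hΛmul : ∀ p, Λ (M * p) = p.eval 0 := by
    intro p; simp only [Λ]; rw [mul_divByMonic_cancel_left _ hM]
  have hΛlow : ∀ i, i < k * (q - 1) → Λ (X ^ i) = 0 := by
    intro i hi
    simp only [Λ]
    rw [(divByMonic_eq_zero_iff hM).2, eval_zero]
    rw [degree_X_pow, degree_eq_natDegree hM.ne_zero, hMd]
    exact_mod_cast hi
  have hP0 : Λ (P 0) ≠ 0 := by
    obtain ⟨R, hR⟩ := hdiv0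
    rw [hR, hΛmul]
    intro h0
    have : (P 0).eval 0 = 1 := by simp [P, eval_prod]
    rw [hR, eval_mul, h0, mul_zero] at this
    exact zero_ne_one this
  have hPc : ∀ c, c ≠ 0 → Λ (P c) = 0 := by
    intro c hc
    obtain ⟨R, hR⟩ := hdivc c hc
    rw [hR, mul_pow, mul_comm (X ^ k), mul_assoc, hΛmul]
    simp [show k ≠ 0 by omega]
  have hsum : ∑ c : F, Λ (P c) = Λ (P 0) := by
    rw [Finset.sum_eq_single 0]
    · exact fun c _ hc => hPc c hc
    · simp
  have hdeg : ∀ i, Dg (B.card + 1 - i) (fun c : F => (P c).coeff i) := by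
    intro i
    have := br_coeff B.toList i
    simpa [P, Finset.length_toList, ← Finset.prod_map_toList] using this
  have hexp : ∀ c, P c = ∑ i ∈ Finset.range (B.card + 1), C ((P c).coeff i) * X ^ i := by
    intro c
    apply as_sum_range_C_mul_X_pow'
    apply Nat.lt_succ_of_le
    refine (natDegree_prod_le _ _).trans ?_
    refine (Finset.sum_le_card_nsmul _ _ 1 fun p _ => ?_).trans (by simp)
    refine (natDegree_add_le _ _).trans ?_
    simp only [natDegree_C]
    exact max_le (by omega) ((natDegree_C_mul_le _ _).trans natDegree_X_le)
  apply hP0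
  rw [← hsum]
  have : ∀ c, Λ (P c) = ∑ i ∈ Finset.range (B.card + 1), (P c).coeff i * Λ (X ^ i) := by
    intro c
    conv_lhs => rw [hexp c]
    rw [hΛsum]
    exact Finset.sum_congr rfl fun i _ => hΛsmul _ _
  simp only [this]
  rw [Finset.sum_comm]
  refine Finset.sum_eq_zero fun i _ => ?_
  rw [← Finset.sum_mul]
  by_cases hi : i < k * (q - 1)
  · rw [hΛlow i hi, mul_zero]
  · rw [Dg_sum_zero (hdeg i), zero_mul]
    rw [Nat.add_mul] at hcon
    omega

theorem BR (S : Finset (F × F)) [DecidableEq F] (k : ℕ) (hk : 1 ≤ k)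
    (h : ∀ α β γ : F, (α ≠ 0 ∨ β ≠ 0) → k ≤ (S.filter fun p => α * p.1 + β * p.2 = γ).card) :
    (k + 1) * (Fintype.card F - 1) + 1 ≤ S.card := by
  obtain ⟨p0, hp0⟩ : S.Nonempty := by
    have := h 1 0 0 (by simp)
    have := Finset.card_pos.1 (lt_of_lt_of_le hk this)
    exact this.mono (Finset.filter_subset _ _)
  set B := (S.erase p0).image (fun p => p - p0) with hB
  have hBc : B.card + 1 = S.card := by
    rw [hB, Finset.card_image_of_injective _ (sub_left_injective), Finset.card_erase_add_one hp0]
  have := br_main B k hk (fun c v hcv => by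
    refine (h c v (c * p0.1 + v * p0.2 - 1) hcv).trans ?_
    rw [← Finset.card_image_of_injective _ (sub_left_injective (b := p0))]
    refine Finset.card_le_card fun x hx => ?_
    obtain ⟨p, hp, rfl⟩ := Finset.mem_image.1 hx
    obtain ⟨hpS, hpe⟩ := Finset.mem_filter.1 hp
    refine Finset.mem_filter.2 ⟨Finset.mem_image.2 ⟨p, Finset.mem_erase.2 ⟨?_, hpS⟩, rfl⟩, ?_⟩
    · rintro rfl
      have h0 : (1 : F) = 0 := by linear_combination hpe
      exact one_ne_zero h0
    · simp only [Prod.fst_sub, Prod.snd_sub]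
      linear_combination hpe)
  omega

end br

section pp

/-- `f` vanishes on some affine hyperplane -/
def Van {F : Type} [Field F] {V : Type} [AddCommGroup V] [Module F V] (f : V → F) : Prop :=
  ∃ φ : V →ₗ[F] F, φ ≠ 0 ∧ ∃ a, ∀ x, φ x = a → f x = 0

variable {F : Type} [Field F]

theorem Van_e {V W : Type} [AddCommGroup V] [Module F V] [AddCommGroup W] [Module F W]
    (e : V ≃ₗ[F] W) {f : V → F} (h : Van (fun w => f (e.symm w))) : Van f := by
  obtain ⟨φ, hφ, a, ha⟩ := h
  refine ⟨φ ∘ₗ e.toLinearMap, fun h0 => hφ ?_, a, fun x hx => ?_⟩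
  · ext w
    have := LinearMap.congr_fun h0 (e.symm w)
    simpa using this
  · have := ha (e x) (by simpa using hx)
    simpa using this

theorem Van_slice {W : Type} [AddCommGroup W] [Module F W] {f : F × W → F} {a : F}
    (h : ∀ w, f (a, w) = 0) : Van f := by
  refine ⟨LinearMap.fst F F W, fun h0 => ?_, a, ?_⟩
  · have := LinearMap.congr_fun h0 (1, 0); simp at this
  · rintro ⟨b, w⟩ rfl; exact h w

theorem Van_snd {W : Type} [AddCommGroup W] [Module F W] {f : F × W → F} (φ : W →ₗ[F] F)
    (hφ : φ ≠ 0) (a : F) (h : ∀ b w, φ w = a → f (b, w) = 0) : Van f := by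
  refine ⟨φ ∘ₗ LinearMap.snd F F W, fun h0 => hφ ?_, a, ?_⟩
  · ext w; have := LinearMap.congr_fun h0 (0, w); simpa using this
  · rintro ⟨b, w⟩ hw; exact h b w hw

variable [Fintype F]

def PP (F : Type) [Field F] (q d : ℕ) : Prop := ∀ (V : Type) [AddCommGroup V]
    [Module F V] [Finite V] (t s n : ℕ) (f : V → F), t + n = d → Module.finrank F V = t + n + 1 →
    1 ≤ s → s + 1 ≤ q → Dg (t * (q - 1) + s + 1) f → q * NW f ≤ (q - s + 1) * (q - 1) * q ^ n →
    Van f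

theorem ar3 {q s : ℕ} (hs : 1 ≤ s) (hq : s + 1 ≤ q) :
    (q - s + 1) * (q - 1) = q * (q - s) + (s - 1) := by
  obtain ⟨v, rfl⟩ := Nat.exists_eq_add_of_le hq
  obtain ⟨u, rfl⟩ := Nat.exists_eq_add_of_le hs
  have h1 : 1 + u + 1 + v - (1 + u) = v + 1 := by omega
  have h2 : 1 + u + 1 + v - 1 = u + v + 1 := by omega
  have h3 : 1 + u - 1 = u := by omega
  rw [h1, h2, h3]; ring

open Classical in
theorem NW_restrict {W : Type} [AddCommGroup W] [Module F W] [Finite W] (φ : W →ₗ[F] F)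
    (e : W ≃ₗ[F] F × LinearMap.ker φ) (f : F × W → F) (h : W → F) (m : ℕ)
    (hm : ∀ a ∈ Kz (fun x => h (e.symm x)),
      m ≤ NW (fun x : F × LinearMap.ker φ => f (x.1, e.symm (a, x.2)))) :
    (Kz (fun x => h (e.symm x))).card * m ≤ NW (fun x => if h x.2 = 0 then f x else 0) := by
  let E : F × (F × LinearMap.ker φ) ≃ F × W :=
    { toFun := fun x => (x.2.1, e.symm (x.1, x.2.2))
      invFun := fun y => ((e y.2).1, (y.1, (e y.2).2))
      left_inv := fun x => by simp
      right_inv := fun y => by simp }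
  rw [← NW_equiv E, NW_sum, ← smul_eq_mul]
  refine (Finset.card_nsmul_le_sum _ _ m fun a ha => ?_).trans
    (Finset.sum_le_sum_of_subset (Finset.subset_univ (Kz (fun x => h (e.symm x)))))
  refine (hm a ha).trans (NW_mono fun x hx => ?_)
  have := mem_Kz.1 ha x.2
  simp only [E, Equiv.coe_fn_mk, this, if_true]
  exact hx

theorem ar4 {q k : ℕ} (h1 : 1 ≤ k) (h2 : k + 1 ≤ q) : q - 1 ≤ k * (q - k) := by
  obtain ⟨v, rfl⟩ := Nat.exists_eq_add_of_le h2
  obtain ⟨u, rfl⟩ := Nat.exists_eq_add_of_le h1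
  have h1 : 1 + u + 1 + v - 1 = u + v + 1 := by omega
  have h2 : 1 + u + 1 + v - (1 + u) = v + 1 := by omega
  rw [h1, h2]; nlinarith [Nat.zero_le (u * v)]

theorem nl1 {c e b : ℕ} (h5 : (c + e + 1) * (e + b) ≤ (c + e + 1 + b) * e + (b + c)) :
    b * c ≤ c := by nlinarith

theorem nl2 (q x y Q : ℕ) : q * (x * Q) ≤ (q * x + y) * Q := by
  nlinarith [Nat.zero_le (y * Q)]

theorem nl3 {q j c x : ℕ} (h3 : (j + 1) * (c + 1) * q ≤ q * (j + c + 1) + x) :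
    q * (j * c) ≤ x := by nlinarith

theorem nl4 (s j : ℕ) : (1 + s + j + 1 + 0) * (j + 0 + 1) + s ≤ (j + 1) * (2 * (s + j + 1)) := by
  nlinarith [Nat.zero_le (s * j), Nat.zero_le (j*j)]

theorem nl5 {j A k v H Q : ℕ} (h : A * Q ≤ H) :
    ((j + 1) * A + k * v) * Q ≤ (j + 1) * H + k * (v * Q) := by
  have := Nat.mul_le_mul_left (j + 1) h
  nlinarith

theorem nl6 {k z c x : ℕ} (h1 : (0 + 1) * ((z + c + 1) * (c + 1 + k)) + k * (c + 1) ≤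
    (k + 1 + (z + c)) * (c + 1) + x) : k * (z + c + 1) ≤ x := by nlinarith

theorem nl7 {k u j x : ℕ} (h1 : (j + 1) * ((u + 1) * (1 + k)) + k * (j + 1) ≤
    (k + 1 + u) * (j + 1) + x) : (j + 1) * (k * (u + 1)) ≤ x := by nlinarith

theorem nl8 {v q Q H k : ℕ} (h : v * (Q * q) ≤ H) :
    (v * q + k * v) * Q ≤ (0 + 1) * H + k * (v * Q) := by nlinarith

set_option maxHeartbeats 2000000 in
theorem STEP {q d : ℕ} (hq : Fintype.card F = q) (IH : PP F q d) {W : Type} [AddCommGroup W]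
    [Module F W] [Finite W] (t s n : ℕ) (f : F × W → F) (hd : t + n = d)
    (hr : Module.finrank F W = t + n + 1) (hs : 1 ≤ s) (hs' : s + 1 ≤ q)
    (hD : Dg (t * (q - 1) + s + 1) f)
    (hN : NW f ≤ (q * (q - s) + (s - 1)) * q ^ n) (hf : ∃ x, f x ≠ 0)
    (hc : ∀ j, (∃ w, ∑ a : F, a ^ j * f (a, w) ≠ 0) → 1 ≤ t ∨ q ≤ j + s) : Van f := by
  classical
  obtain ⟨j, hj1, hj2, hj3, hj4⟩ := exists_push f hf
  have hcj := hc j hj2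
  have hDh := hD.push j
  rw [hq] at hDh hj1 hj4
  set h : W → F := fun w => ∑ a : F, a ^ j * f (a, w) with hh
  have hQ : 0 < q ^ n := Nat.pow_pos (by omega)
  have hlin := NW_lines_add f h (j + 1) hj3
  have hle : (j + 1) * NW h ≤ NW f := le_trans (Nat.le_add_right _ _) hlin
  by_cases hA : q ≤ j + s
  · obtain ⟨b, hb⟩ : ∃ b, q = j + 1 + b := Nat.exists_eq_add_of_le hj1
    obtain ⟨c, hcs⟩ : ∃ c, s = b + 1 + c := Nat.exists_eq_add_of_le (by omega)
    have hDh' : Dg (t * (q - 1) + (c + 1) + 1) h := hDh.mono (by omega)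
    have hmd := MD hq hr (by omega) hDh' hj2
    rcases Nat.eq_zero_or_pos b with hb0 | hb0
    · subst hb0
      have hq' : q * NW h ≤ (q - s + 1) * (q - 1) * q ^ n := by
        rw [ar3 hs hs']
        calc q * NW h = (j + 1) * NW h := by rw [hb]
          _ ≤ _ := hle.trans hN
      obtain ⟨φ, hφ, a, ha⟩ := IH W t s n h hd hr hs hs' (hDh.mono (by omega)) hq'
      exact Van_snd φ hφ a fun b w hw => hj4 (by omega) w (ha w hw) b
    · -- exact equality
      have hqs : q - s = j - c := by omega
      have hqc : q - (c + 1) = j + b - c := by omega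
      obtain ⟨e, he⟩ : ∃ e, j = c + e := Nat.exists_eq_add_of_le (by omega)
      rw [hqc] at hmd
      rw [hqs] at hN
      have e1 : j - c = e := by omega
      have e2 : j + b - c = e + b := by omega
      have e3 : s - 1 = b + c := by omega
      rw [e2] at hmd
      rw [e1, e3] at hN
      have hup : (j + 1) * NW h ≤ (q * e + (b + c)) * q ^ n := hle.trans hN
      have hlow : (j + 1) * ((e + b) * q ^ n) ≤ (j + 1) * NW h := Nat.mul_le_mul_left _ hmd
      have h5 : (j + 1) * (e + b) ≤ q * e + (b + c) := by
        have := hlow.trans hup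
        rw [← mul_assoc] at this
        exact Nat.le_of_mul_le_mul_right this hQ
      have h6 : b * c ≤ c := by
        rw [hb, he] at h5; exact nl1 h5
      have h7 : b * c = c := le_antisymm h6 (Nat.le_mul_of_pos_left _ hb0)
      have h8 : (j + 1) * (e + b) = q * e + (b + c) := by
        rw [hb, he]; linear_combination h7
      rw [← h8, mul_assoc] at hup
      have h9 : NW h = (e + b) * q ^ n :=
        le_antisymm (Nat.le_of_mul_le_mul_left hup (by omega)) hmd
      obtain ⟨φ, hφ, a, ha⟩ := IH W t (c + 1) n h hd hr (by omega) (by omega) hDh' (by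
        rw [ar3 (by omega) (by omega), h9, hqc, e2]
        exact nl2 _ _ _ _)
      rw [← h8] at hN
      rw [h9] at hlin
      have h10 : NW (fun x => if h x.2 = 0 then f x else 0) = 0 := by
        rw [mul_assoc] at hN; omega
      rw [NW_eq_zero] at h10
      refine Van_snd φ hφ a fun b w hw => ?_
      have := h10 (b, w)
      simpa [ha w hw] using this
  · push Not at hA
    obtain ⟨t, rfl⟩ : ∃ t', t = t' + 1 := ⟨t - 1, by omega⟩
    have hDh' : Dg (t * (q - 1) + (s + j) + 1) h := hDh.mono (by rw [Nat.add_mul]; omega)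
    obtain ⟨c, hcq⟩ : ∃ c, q = s + j + 1 + c := Nat.exists_eq_add_of_le (by omega)
    have hmd := MD (n := n + 1) hq (by omega) (by omega) hDh' hj2
    have e1 : q - (s + j) = c + 1 := by omega
    have e2 : q - s = j + c + 1 := by omega
    have hjc : j = 0 ∨ c = 0 := by
      by_contra hcon
      rw [e1] at hmd
      rw [e2] at hN
      have h1 : (j + 1) * ((c + 1) * q ^ (n + 1)) ≤ (q * (j + c + 1) + (s - 1)) * q ^ n :=
        (Nat.mul_le_mul_left _ hmd).trans (hle.trans hN)
      have h2 : ((j + 1) * (c + 1) * q) * q ^ n ≤ (q * (j + c + 1) + (s - 1)) * q ^ n := by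
        refine le_trans (le_of_eq ?_) h1; ring
      have h3 := Nat.le_of_mul_le_mul_right h2 hQ
      have h4 : 1 ≤ j * c := Nat.mul_pos (by omega) (by omega)
      have h5 : q * 1 ≤ q * (j * c) := Nat.mul_le_mul_left _ h4
      have h6 : q * (j * c) ≤ s - 1 := nl3 h3
      omega
    have hVan : Van h := by
      refine IH W t (s + j) (n + 1) h (by omega) (by omega) (by omega) (by omega) hDh' ?_
      rcases hjc with rfl | rfl
      · have hle' : NW h ≤ NW f := by
          rw [zero_add, one_mul] at hle; exact hle
        rw [add_zero, ar3 hs hs']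
        calc q * NW h ≤ q * ((q * (q - s) + (s - 1)) * q ^ n) :=
              Nat.mul_le_mul_left _ (hle'.trans hN)
          _ = _ := by ring
      · rw [show q - (s + j) + 1 = 2 by omega]
        have h1 : (j + 1) * NW h ≤ (j + 1) * (2 * (q - 1) * q ^ n) := by
          refine (hle.trans hN).trans ?_
          rw [← mul_assoc]
          refine Nat.mul_le_mul_right _ ?_
          rw [e2, hcq]
          obtain ⟨s, rfl⟩ := Nat.exists_eq_add_of_le hs
          have a1 : 1 + s + j + 1 + 0 - 1 = s + j + 1 := by omega
          have a2 : 1 + s - 1 = s := by omega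
          rw [a1, a2]
          exact nl4 s j
        have h2 := Nat.le_of_mul_le_mul_left h1 (by omega)
        calc q * NW h ≤ q * (2 * (q - 1) * q ^ n) := Nat.mul_le_mul_left _ h2
          _ = _ := by ring
    obtain ⟨φ, hφ, a, ha⟩ := hVan
    obtain ⟨e, he⟩ := split_of φ hφ
    have hrk := finrank_ker_of φ e
    set hK := Kz (fun x => h (e.symm x)) with hKd
    have hmem : ∀ c ∈ hK, ∀ w, φ w = c → h w = 0 := by
      intro c hc w hw
      have := mem_Kz.1 hc (e w).2
      rw [← hw, ← he w] at this
      simpa using this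
    have hamem : a ∈ hK := by
      refine mem_Kz.2 fun w => ha _ ?_
      rw [← he]; simp
    by_cases hv : ∃ c ∈ hK, ∀ x : F × LinearMap.ker φ, f (x.1, e.symm (c, x.2)) = 0
    · obtain ⟨c, _, hcv⟩ := hv
      refine Van_snd φ hφ c fun b w hw => ?_
      have := hcv (b, (e w).2)
      rw [← hw, ← he w] at this
      simpa using this
    · exfalso
      push Not at hv
      have hre := NW_restrict φ e f h ((q - s) * q ^ n) (fun c hc => by
        refine MD (t := t + 1) hq ?_ hs' ?_ (hv c hc)
        · rw [Module.finrank_prod, Module.finrank_self]; omega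
        · have := hD.comp ((LinearMap.fst F F (LinearMap.ker φ)).prod
            (e.symm.toLinearMap ∘ₗ LinearMap.inr F F _ ∘ₗ LinearMap.snd F F _)) (0, e.symm (c, 0))
          convert this using 2 with x
          congr 1
          ext
          · simp
          · simp [← map_add])
      rw [← hKd] at hre
      have hfin : (j + 1) * NW h + hK.card * ((q - s) * q ^ n) ≤
        (q * (q - s) + (s - 1)) * q ^ n := by omega
      have hk1 : 1 ≤ hK.card := Finset.card_pos.2 ⟨a, hamem⟩
      have hnz : ∃ x, h (e.symm x) ≠ 0 := by
        obtain ⟨w, hw⟩ := hj2; exact ⟨e w, by simpa using hw⟩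
      have hkq : hK.card + 1 ≤ q := hq ▸ Kz_lt hnz
      have hDe := Dg_e e hDh'
      have h44 := ar4 hk1 hkq
      obtain ⟨u, hu⟩ := Nat.exists_eq_add_of_le hkq
      set k := hK.card with hkk
      by_cases hks : k ≤ s + j
      · have hsb := SB1 (n := n) hq (by omega) (by omega) hDe hks
        rw [NW_e e h, ← hKd, ← hkk] at hsb
        rw [← mul_assoc] at hsb
        have h1 : (j + 1) * ((q - k) * (q - (s + j) + k)) + k * (q - s) ≤
            q * (q - s) + (s - 1) := by
          refine Nat.le_of_mul_le_mul_right (le_trans ?_ hfin) hQ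
          exact nl5 hsb
        rcases hjc with rfl | rfl
        · obtain ⟨z, hz⟩ := Nat.exists_eq_add_of_le hks
          have a1 : q - k = u + 1 := by omega
          have a2 : q - (s + 0) = c + 1 := by omega
          have a3 : q - s = c + 1 := by omega
          rw [a1] at h44
          rw [a1, a2, a3] at h1
          have a4 : u = z + c := by omega
          rw [hu] at h1 h44
          have : k + 1 + u - 1 ≤ s - 1 := by
            refine h44.trans ?_
            subst a4
            exact nl6 h1
          omega
        · have a1 : q - k = u + 1 := by omega
          have a2 : q - (s + j) = 1 := by omega
          have a3 : q - s = j + 1 := by omega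
          rw [a1] at h44
          rw [a1, a2, a3] at h1
          have : (j + 1) * (k * (u + 1)) ≤ s - 1 := by
            rw [hu] at h1; exact nl7 h1
          have : k * (u + 1) ≤ s - 1 := le_trans (Nat.le_mul_of_pos_left _ (by omega)) this
          omega
      · push Not at hks
        have hj0 : j = 0 := by omega
        subst hj0
        have hsb := SB2 (n := n + 1) hq (by omega) (by omega) hDe hnz hks
        rw [NW_e e h, ← hKd, ← hkk] at hsb
        have h2 := ar2 hks hkq
        have h1 : (q - s) * q + k * (q - s) ≤ q * (q - s) + (s - 1) := by
          refine Nat.le_of_mul_le_mul_right (le_trans ?_ hfin) hQ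
          have h3 : (q - s) * q ^ (n + 1) ≤ NW h := by
            refine le_trans ?_ hsb
            rw [← mul_assoc]
            exact Nat.mul_le_mul_right _ h2
          rw [pow_succ] at h3
          exact nl8 h3
        have h5 : k ≤ k * (q - s) := Nat.le_mul_of_pos_right _ (by omega)
        rw [mul_comm q (q - s)] at h1
        omega

end pp

section pthm
variable {F : Type} [Field F] [Fintype F]

theorem Van_zero {V : Type} [AddCommGroup V] [Module F V] [Finite V]
    (hr : 1 ≤ Module.finrank F V) {f : V → F} (h : ∀ x, f x = 0) : Van f := by
  obtain ⟨φ, e, hφ, _⟩ := split_any (F := F) (V := V) hr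
  exact ⟨φ, hφ, 0, fun x _ => h x⟩

theorem P_n0 {q : ℕ} (hq : Fintype.card F = q) {V : Type} [AddCommGroup V] [Module F V] [Finite V]
    {s : ℕ} {f : V → F} (hr : 1 ≤ Module.finrank F V) (hs : 1 ≤ s) (hs' : s + 1 ≤ q)
    (hN : q * NW f ≤ (q - s + 1) * (q - 1)) : Van f := by
  obtain ⟨φ, e, hφ, he⟩ := split_any (F := F) (V := V) hr
  apply Van_e e
  by_contra hcon
  have h1 := sl_le (fun w => f (e.symm w)) 1 (fun a ha => by
    obtain ⟨w, hw⟩ := Kz_nz ha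
    exact NW_pos (f := fun w => f (e.symm (a, w))) hw)
  have hK : Kz (fun w => f (e.symm w)) = ∅ := by
    rw [Finset.eq_empty_iff_forall_notMem]
    exact fun a ha => hcon (Van_slice (mem_Kz.1 ha))
  rw [hK, hq, NW_e e f] at h1
  simp only [Finset.card_empty, mul_one, Nat.sub_zero] at h1
  rw [ar3 hs hs'] at hN
  have h2 : q * q ≤ q * (q - s) + (s - 1) := (Nat.mul_le_mul_left _ h1).trans hN
  have h3 : q * (q - s) + q * s = q * q := by rw [← mul_add]; congr 1; omega
  have h4 : 1 * s ≤ q * s := Nat.mul_le_mul_right _ (by omega)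
  omega

theorem P_plane {q : ℕ} (hq : Fintype.card F = q) {s : ℕ} {f : F × F → F}
    (hs : 1 ≤ s) (hs' : s + 1 ≤ q) (hD : Dg (s + 1) f)
    (hN : NW f ≤ (q - s + 1) * (q - 1)) : Van f := by
  classical
  by_contra hcon
  have h1 := BR (Finset.univ.filter fun p : F × F => f p ≠ 0) (q - s) (by omega) (by
    intro α β γ hab
    obtain ⟨p, hp⟩ : ∃ p : F × F, α * p.1 + β * p.2 = γ := by
      rcases hab with h | h
      · exact ⟨(α⁻¹ * γ, 0), by field_simp; simp⟩
      · exact ⟨(0, β⁻¹ * γ), by field_simp; simp⟩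
    let L : F →ₗ[F] F × F := LinearMap.toSpanSingleton F (F × F) (-β, α)
    have hL : Function.Injective (fun u => L u + p) := by
      intro u v huv
      have huv : L u = L v := by simpa using huv
      simp only [L, LinearMap.toSpanSingleton_apply, Prod.smul_mk, smul_eq_mul, Prod.mk.injEq] at huv
      rcases hab with h | h
      · exact mul_right_cancel₀ h huv.2
      · exact mul_right_cancel₀ (neg_ne_zero.2 h) huv.1
    have hDl := hD.comp L p
    have hnz : ∃ u, f (L u + p) ≠ 0 := by
      by_contra hz
      push Not at hz
      apply hcon
      refine ⟨α • LinearMap.fst F F F + β • LinearMap.snd F F F, fun h0 => ?_, γ, fun x hx => ?_⟩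
      · have a1 := LinearMap.congr_fun h0 (1, 0)
        have a2 := LinearMap.congr_fun h0 (0, 1)
        simp at a1 a2
        simp [a1, a2] at hab
      · have hx : α * x.1 + β * x.2 = γ := by simpa using hx
        have : ∃ u, L u + p = x := by
          rcases hab with h | h
          · refine ⟨(x.2 - p.2) / α, ?_⟩
            ext
            · simp [L]; field_simp; linear_combination hp - hx
            · simp [L]; field_simp; ring
          · refine ⟨(p.1 - x.1) / β, ?_⟩
            ext
            · simp [L]; field_simp; ring
            · simp [L]; field_simp; linear_combination hp - hx
        obtain ⟨u, rfl⟩ := this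
        exact hz u
    have hmd := MD (t := 0) (n := 0) hq (by simp) hs' (hDl.mono (by omega)) hnz
    simp only [pow_zero, mul_one] at hmd
    refine hmd.trans ?_
    unfold NW
    simp only [Set.ncard_eq_toFinset_card', Set.toFinset_ofPred]
    rw [← Finset.card_image_of_injective _ hL]
    refine Finset.card_le_card fun x hx => ?_
    obtain ⟨u, hu, rfl⟩ := Finset.mem_image.1 hx
    simp only [Finset.mem_filter, Finset.mem_univ, true_and] at hu ⊢
    refine ⟨hu, ?_⟩
    simp [L]
    linear_combination hp)
  have h2 : NW f = (Finset.univ.filter fun p : F × F => f p ≠ 0).card := by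
    unfold NW
    simp only [Set.ncard_eq_toFinset_card', Set.toFinset_ofPred]
  rw [← h2, hq] at h1
  omega

theorem exists_min_slice {W : Type} [Finite W] (f : F × W → F) :
    ∃ a, Fintype.card F * NW (fun w => f (a, w)) ≤ NW f := by
  obtain ⟨a, _, ha⟩ := Finset.exists_min_image (Finset.univ : Finset F)
    (fun a => NW (fun w => f (a, w))) ⟨0, by simp⟩
  refine ⟨a, ?_⟩
  rw [NW_sum, ← smul_eq_mul]
  exact Finset.card_nsmul_le_sum _ _ _ fun b hb => ha b hb

theorem P_all (q : ℕ) (hq : Fintype.card F = q) (d : ℕ) : PP F q d := by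
  induction d with
  | zero =>
    intro V _ _ _ t s n f hd hr hs hs' hD hN
    obtain rfl : n = 0 := by omega
    exact P_n0 hq (by omega) hs hs' (by simpa using hN)
  | succ d IH =>
    intro V _ _ _ t s n f hd hr hs hs' hD hN
    by_cases hf : ∀ x, f x = 0
    · exact Van_zero (by omega) hf
    push Not at hf
    rcases n with _ | n
    · exact P_n0 hq (by omega) hs hs' (by simpa using hN)
    have hN' : NW f ≤ (q * (q - s) + (s - 1)) * q ^ n := by
      rw [ar3 hs hs'] at hN
      refine Nat.le_of_mul_le_mul_left (hN.trans (le_of_eq ?_)) (show 0 < q by omega)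
      ring
    have hnz : ∀ {W : Type} [AddCommGroup W] [Module F W] (e : V ≃ₗ[F] W),
        ∃ y, f (e.symm y) ≠ 0 := by
      intro W _ _ e
      obtain ⟨x, hx⟩ := hf
      exact ⟨e x, by simpa using hx⟩
    by_cases ht : 1 ≤ t
    · obtain ⟨φ, e, hφ, he⟩ := split_any (F := F) (V := V) (by omega)
      have hrk := finrank_ker_of φ e
      exact Van_e e (STEP hq IH t s n _ (by omega) (by omega) hs hs' (Dg_e e hD)
        (by rw [NW_e e f]; exact hN') (hnz e) (fun _ _ => Or.inl ht))
    obtain rfl : t = 0 := by omega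
    rcases d with _ | d
    · obtain rfl : n = 0 := by omega
      let e : V ≃ₗ[F] F × F := LinearEquiv.ofFinrankEq _ _ (by
        rw [hr, Module.finrank_prod, Module.finrank_self])
      refine Van_e e (P_plane hq hs hs' ((Dg_e e hD).mono (by omega)) ?_)
      rw [NW_e e f, ar3 hs hs']
      simpa using hN'
    · obtain rfl : n = d + 1 := by omega
      obtain ⟨φ, e, hφ, he⟩ := split_any (F := F) (V := V) (by omega)
      have hrk := finrank_ker_of φ e
      obtain ⟨a, ha⟩ := exists_min_slice (fun w => f (e.symm w))
      rw [hq, NW_e e f] at ha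
      obtain ⟨ψ, hψ, c, hc⟩ := IH (LinearMap.ker φ) 0 s (d + 1) (fun w => f (e.symm (a, w)))
        (by omega) (by omega) hs hs' ((Dg_e e hD).slice a)
        (by rw [ar3 hs hs']; exact ha.trans hN')
      obtain ⟨e2, he2⟩ := split_of ψ hψ
      have hrk2 := finrank_ker_of ψ e2
      have : Nontrivial (LinearMap.ker ψ) :=
        Module.nontrivial_of_finrank_pos (R := F) (by omega)
      obtain ⟨u, hu⟩ := exists_ne (0 : LinearMap.ker ψ)
      set w0 := e2.symm (c, 0) with hw0
      have hψ0 : ψ w0 = c := by rw [← he2]; simp [hw0]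
      have hd0 : e.symm (0, (u : LinearMap.ker φ)) ≠ 0 := by
        intro h0
        rw [LinearEquiv.map_eq_zero_iff] at h0
        apply hu
        have := congrArg Prod.snd h0
        simpa using this
      obtain ⟨φ', e', he', hed⟩ := split_at (F := F) (e.symm (0, (u : LinearMap.ker φ))) hd0
      have hrk' := finrank_ker_of φ' e'
      set p := e.symm (a, w0) with hp
      have hline : ∀ b, f (e'.symm (b, (e' p).2)) = 0 := by
        intro b
        have h1 : e'.symm (b, (e' p).2) = p + (b - (e' p).1) • e.symm (0, (u : LinearMap.ker φ)) := by
          rw [LinearEquiv.symm_apply_eq, map_add, map_smul, hed]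
          ext <;> simp
        have h2 : p + (b - (e' p).1) • e.symm (0, (u : LinearMap.ker φ)) =
            e.symm (a, w0 + (b - (e' p).1) • (u : LinearMap.ker φ)) := by
          rw [hp, ← map_smul, ← map_add]; simp
        rw [h1, h2]
        apply hc
        rw [map_add, map_smul, hψ0]
        have := u.2
        rw [LinearMap.mem_ker] at this
        simp [this]
      refine Van_e e' (STEP hq IH 0 s (d + 1) _ (by omega) (by omega) hs hs' (Dg_e e' hD)
        (by rw [NW_e e' f]; exact hN') (hnz e') (fun j hj => ?_))
      right
      by_contra hcon
      obtain ⟨w, hw⟩ := hj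
      have h1 := (Dg_e e' hD).push j
      obtain ⟨k, hk⟩ := h1.eq_const_of (by rw [hq]; omega)
      apply hw
      rw [hk w, ← hk (e' p).2]
      simp [hline]

theorem PTHM {q t s n : ℕ} (hq : Fintype.card F = q) {V : Type} [AddCommGroup V]
    [Module F V] [Finite V] {f : V → F} (hr : Module.finrank F V = t + n + 1)
    (hs : 1 ≤ s) (hs' : s + 1 ≤ q) (hD : Dg (t * (q - 1) + s + 1) f)
    (hN : q * NW f ≤ (q - s + 1) * (q - 1) * q ^ n) : Van f :=
  P_all q hq _ V t s n f rfl hr hs hs' hD hN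

/-- convenient form: a split with at least one vanishing slice -/
theorem PSPL {q t s n : ℕ} (hq : Fintype.card F = q) {V : Type} [AddCommGroup V]
    [Module F V] [Finite V] {f : V → F} (hr : Module.finrank F V = t + n + 1)
    (hs : 1 ≤ s) (hs' : s + 1 ≤ q) (hD : Dg (t * (q - 1) + s + 1) f)
    (hN : q * NW f ≤ (q - s + 1) * (q - 1) * q ^ n) :
    ∃ (φ : V →ₗ[F] F) (e : V ≃ₗ[F] F × LinearMap.ker φ), φ ≠ 0 ∧ (∀ x, (e x).1 = φ x) ∧
      1 ≤ (Kz (fun w => f (e.symm w))).card := by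
  obtain ⟨φ, hφ, a, ha⟩ := PTHM hq hr hs hs' hD hN
  obtain ⟨e, he⟩ := split_of φ hφ
  refine ⟨φ, e, hφ, he, Finset.card_pos.2 ⟨a, mem_Kz.2 fun w => ha _ ?_⟩⟩
  rw [← he]; simp

end pthm

section gl
variable {F : Type} [Field F] [Fintype F]

theorem NW_const {V : Type} [AddCommGroup V] [Module F V] [Finite V] {q : ℕ}
    (hq : Fintype.card F = q) {f : V → F} (h : ∀ x, f x ≠ 0) : NW f = q ^ Module.finrank F V := by
  unfold NW
  have : {x | f x ≠ 0} = Set.univ := by ext x; simp [h x]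
  rw [this, Set.ncard_univ, Module.natCard_eq_pow_finrank (K := F), Nat.card_eq_fintype_card, hq]

theorem one_slice {q : ℕ} (hq : Fintype.card F = q) {W : Type} [Finite W] {f : F × W → F}
    (hk : (Kz f).card + 1 = q) :
    ∃ a, (∀ b w, f (b, w) ≠ 0 → b = a) ∧ NW f = NW (fun w => f (a, w)) := by
  classical
  have h1 : (Kz f)ᶜ.card = 1 := by rw [Finset.card_compl, hq]; omega
  obtain ⟨a, ha⟩ := Finset.card_eq_one.1 h1
  refine ⟨a, fun b w hb => ?_, ?_⟩
  · have : b ∈ (Kz f)ᶜ := Finset.mem_compl.2 fun h => hb (mem_Kz.1 h w)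
    rw [ha] at this
    simpa using this
  · rw [NW_sumK, ha]; simp

theorem GapL (q : ℕ) (hq : Fintype.card F = q) (n t : ℕ) : ∀ (V : Type) [AddCommGroup V]
    [Module F V] [Finite V] (f : V → F), Module.finrank F V = t + n + 1 →
    Dg (t * (q - 1) + 1) f → (∃ x, f x ≠ 0) → NW f < 2 * (q - 1) * q ^ n →
    NW f = q ^ (n + 1) := by
  have hq2 : 2 ≤ q := hq ▸ Fintype.one_lt_card
  induction t with
  | zero =>
    intro V _ _ _ f hr hD ⟨x, hx⟩ _
    obtain ⟨c, hc⟩ := hD.eq_const_of (by omega)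
    rw [NW_const hq (fun y => by rw [hc y, ← hc x]; exact hx), hr]; congr 1; omega
  | succ t ih =>
    intro V _ _ _ f hr hD ⟨x, hx⟩ hN
    have hD1 : Dg (t * (q - 1) + (q - 1) + 1) f := hD.mono (by rw [Nat.add_mul]; omega)
    obtain ⟨φ, e, hφ, he, hk⟩ := PSPL (n := n + 1) hq (by omega) (by omega) (by omega) hD1 (by
      rw [show q - (q - 1) + 1 = 2 by omega, pow_succ]
      nlinarith [Nat.mul_le_mul_left q hN.le])
    have hrk := finrank_ker_of φ e
    rw [← NW_e e f] at hN ⊢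
    have hD' := Dg_e e hD1
    set g : F × LinearMap.ker φ → F := fun w => f (e.symm w) with hg
    have hg0 : ∃ y, g y ≠ 0 := ⟨e x, by simpa [hg] using hx⟩
    have hK := Kz_lt hg0
    rw [hq] at hK
    have hsb := SB1 (n := n) hq (by omega) (by omega) hD' (by omega)
    have hkq : (Kz g).card + 1 = q := by
      by_contra hcon
      obtain ⟨u, hu⟩ := Nat.exists_eq_add_of_le (show (Kz g).card + 2 ≤ q by omega)
      obtain ⟨v, hv⟩ := Nat.exists_eq_add_of_le hk
      rw [show q - (q - 1) = 1 by omega, ← mul_assoc] at hsb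
      have h1 := Nat.lt_of_mul_lt_mul_right (hsb.trans_lt hN)
      rw [show q - (Kz g).card = u + 2 by omega, show q - 1 = u + v + 2 by omega, hv] at h1
      nlinarith [Nat.zero_le (u * v)]
    obtain ⟨a, ha, haN⟩ := one_slice hq hkq
    rw [haN] at hN ⊢
    refine ih _ _ (by omega) ((hD'.sliceK (Kz g) (fun c hc => mem_Kz.1 hc) a).mono (by omega)) ?_ hN
    obtain ⟨⟨b, w⟩, hy⟩ := hg0
    have := ha b w hy
    subst this
    exact ⟨w, hy⟩

/-- support contained in a hyperplane -/
def Flat {F : Type} [Field F] {V : Type} [AddCommGroup V] [Module F V] (f : V → F) : Prop :=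
  ∃ φ : V →ₗ[F] F, φ ≠ 0 ∧ ∃ a, ∀ x, f x ≠ 0 → φ x = a

theorem Flat_e {V W : Type} [AddCommGroup V] [Module F V] [AddCommGroup W] [Module F W]
    (e : V ≃ₗ[F] W) {f : V → F} (h : Flat (fun w => f (e.symm w))) : Flat f := by
  obtain ⟨φ, hφ, a, ha⟩ := h
  refine ⟨φ ∘ₗ e.toLinearMap, fun h0 => hφ ?_, a, fun x hx => ?_⟩
  · ext w
    have := LinearMap.congr_fun h0 (e.symm w)
    simpa using this
  · have := ha (e x) (by simpa using hx)
    simpa using this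

theorem Flat_one {W : Type} [AddCommGroup W] [Module F W] {f : F × W → F} {a : F}
    (h : ∀ b w, f (b, w) ≠ 0 → b = a) : Flat f := by
  refine ⟨LinearMap.fst F F W, fun h0 => ?_, a, ?_⟩
  · have := LinearMap.congr_fun h0 (1, 0); simp at this
  · rintro ⟨b, w⟩ hw; exact h b w hw

theorem GLUE {W : Type} [AddCommGroup W] [Module F W] [Finite W] {f : F × W → F} {r w : ℕ}
    (hD : Dg (r + 1) f)
    (h1 : ∀ g : W → F, Dg (r + 1 - (Kz f).card) g → (∃ x, g x ≠ 0) → w ≤ NW g)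
    (h2 : ∀ g : W → F, Dg (r - (Kz f).card) g → (∃ x, g x ≠ 0) → w < NW g)
    (hw : ∀ a, a ∉ Kz f → NW (fun y => f (a, y)) = w) (a1 : F) (ha1 : a1 ∉ Kz f)
    (hψ : Flat (fun y => f (a1, y))) : Flat f := by
  classical
  obtain ⟨ψ, hψ0, c, hc⟩ := hψ
  let ℓ : F → F → (F × W →ₗ[F] F) := fun a2 c2 =>
    ψ ∘ₗ LinearMap.snd F F W - ((c2 - c) / (a2 - a1)) • LinearMap.fst F F W
  let ℓc : F → F → F := fun a2 c2 => -c + ((c2 - c) / (a2 - a1)) * a1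
  have hℓ : ∀ a2 c2 a y, ℓ a2 c2 (a, y) + ℓc a2 c2 =
      ψ y - c - (c2 - c) / (a2 - a1) * (a - a1) := by
    intro a2 c2 a y; simp [ℓ, ℓc]; ring
  have hℓ2 : ∀ a2 c2 y, a2 ≠ a1 → ℓ a2 c2 (a2, y) + ℓc a2 c2 = ψ y - c2 := by
    intro a2 c2 y h
    rw [hℓ, div_mul_cancel₀ _ (sub_ne_zero.2 h)]; ring
  have hL : ∀ a2 c2, Dg (r + 2) (fun x => (ℓ a2 c2 x + ℓc a2 c2) * f x) := fun a2 c2 =>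
    hD.mulAff _ _
  have van1 : ∀ a2 c2 y, (ℓ a2 c2 (a1, y) + ℓc a2 c2) * f (a1, y) = 0 := by
    intro a2 c2 y
    by_cases hy : f (a1, y) = 0
    · simp [hy]
    · rw [hℓ, hc y hy]; simp
  have vanK : ∀ a2 c2, ∀ b ∈ Kz f, ∀ y, (ℓ a2 c2 (b, y) + ℓc a2 c2) * f (b, y) = 0 := by
    intro a2 c2 b hb y
    rw [mem_Kz.1 hb y, mul_zero]
  by_cases hb : ∀ b, b ∉ Kz f → b = a1
  · exact Flat_one (a := a1) fun b w hbw => hb b (fun h => hbw (mem_Kz.1 h w))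
  push Not at hb
  obtain ⟨a2, ha2, ha21⟩ := hb
  have step1 : ∀ a2, a2 ∉ Kz f → a2 ≠ a1 → ∃ c2, ∀ y, f (a2, y) ≠ 0 → ψ y = c2 := by
    intro a2 ha2 ha21
    obtain ⟨y0, hy0⟩ := Kz_nz ha2
    refine ⟨ψ y0, ?_⟩
    have hs := (hL a2 (ψ y0)).sliceK (insert a1 (Kz f)) (by
      intro b hb
      rcases Finset.mem_insert.1 hb with rfl | hb
      · exact van1 _ _
      · exact vanK _ _ b hb) a2
    rw [Finset.card_insert_of_notMem ha1] at hs
    by_contra hcon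
    push Not at hcon
    obtain ⟨y1, hy1, hy1'⟩ := hcon
    simp only [hℓ2 a2 (ψ y0) _ ha21] at hs
    have h3 := h1 _ (hs.mono (by omega)) ⟨y1, mul_ne_zero (sub_ne_zero.2 hy1') hy1⟩
    rw [← hw a2 ha2] at h3
    have h4 : NW (fun y => (ψ y - ψ y0) * f (a2, y)) < NW (fun y => f (a2, y)) := by
      refine Set.ncard_lt_ncard ?_ (Set.toFinite _)
      refine ⟨fun y hy => right_ne_zero_of_mul hy, fun hsub => ?_⟩
      have := hsub hy0
      simp at this
    omega
  obtain ⟨c2, hc2⟩ := step1 a2 ha2 ha21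
  have van2 : ∀ y, (ℓ a2 c2 (a2, y) + ℓc a2 c2) * f (a2, y) = 0 := by
    intro y
    by_cases hy : f (a2, y) = 0
    · simp [hy]
    · rw [hℓ2 _ _ _ ha21, hc2 y hy]; simp
  refine ⟨ℓ a2 c2, fun h0 => hψ0 ?_, -ℓc a2 c2, ?_⟩
  · ext y
    have := LinearMap.congr_fun h0 (0, y)
    simpa [ℓ] using this
  · rintro ⟨a3, y⟩ hy
    rw [← add_eq_zero_iff_eq_neg]
    have key : (ℓ a2 c2 (a3, y) + ℓc a2 c2) * f (a3, y) = 0 := by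
      by_cases h31 : a3 = a1
      · subst h31; exact van1 _ _ y
      by_cases h32 : a3 = a2
      · subst h32; exact van2 y
      have hK3 : a3 ∉ Kz f := fun h => hy (mem_Kz.1 h y)
      obtain ⟨c3, hc3⟩ := step1 a3 hK3 h31
      have hs := (hL a2 c2).sliceK (insert a2 (insert a1 (Kz f))) (by
        intro b hb
        rcases Finset.mem_insert.1 hb with rfl | hb
        · exact van2
        rcases Finset.mem_insert.1 hb with rfl | hb
        · exact van1 _ _
        · exact vanK _ _ b hb) a3
      rw [Finset.card_insert_of_notMem (by simp [ha21, ha2]), Finset.card_insert_of_notMem ha1] at hs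
      by_contra hcon
      have h3 := h2 _ (hs.mono (by omega)) ⟨y, hcon⟩
      have h4 := NW_mono (f := fun y => (ℓ a2 c2 (a3, y) + ℓc a2 c2) * f (a3, y))
        (g := fun y => f (a3, y)) (fun y hy => right_ne_zero_of_mul hy)
      rw [hw a3 hK3] at h4
      omega
    exact (mul_eq_zero.1 key).resolve_right hy

end gl

theorem ms1 {q s k n : ℕ} (hk : 1 ≤ k) (hks : k ≤ s) (hs : s + 1 ≤ q)
    (h : (q - k) * ((q - s + k) * q ^ n) ≤ (q - s) * q ^ (n + 1)) : k = s := by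
  have hq : 0 < q ^ n := pow_pos (by omega) n
  rw [← mul_assoc, pow_succ', ← mul_assoc] at h
  have h1 := Nat.le_of_mul_le_mul_right h hq
  obtain ⟨u, rfl⟩ := Nat.exists_eq_add_of_le hks
  obtain ⟨v, rfl⟩ := Nat.exists_eq_add_of_le hs
  rw [show k + u + 1 + v - k = u + 1 + v by omega,
    show k + u + 1 + v - (k + u) = v + 1 by omega] at h1
  have : u * k ≤ 0 := by nlinarith
  rcases Nat.mul_eq_zero.1 (Nat.le_zero.1 this) with h | h <;> omega

theorem ms2 {q s k n : ℕ} (hks : s < k) (hk : k + 1 ≤ q)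
    (h : (q - k) * ((k - s + 1) * q ^ n) ≤ (q - s) * q ^ n) : k + 1 = q := by
  have hq : 0 < q ^ n := pow_pos (by omega) n
  rw [← mul_assoc] at h
  have h1 := Nat.le_of_mul_le_mul_right h hq
  obtain ⟨u, rfl⟩ := Nat.exists_eq_add_of_le hks
  obtain ⟨v, rfl⟩ := Nat.exists_eq_add_of_le hk
  rw [show s.succ + u + 1 + v - (s.succ + u) = v + 1 by omega,
    show s.succ + u - s + 1 = u + 2 by omega,
    show s.succ + u + 1 + v - s = u + v + 2 by omega] at h1
  have : v * (u + 1) ≤ 0 := by nlinarith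
  rcases Nat.mul_eq_zero.1 (Nat.le_zero.1 this) with h | h <;> omega

theorem ms3 {q n N : ℕ} (h : N ≤ 2 * (q - 1) * q ^ n) :
    q * N ≤ 2 * (q - 1) * q ^ (n + 1) := by
  rw [pow_succ]
  nlinarith [Nat.mul_le_mul_left q h]

section hyp
variable {F : Type} [Field F] [Fintype F]

theorem Flat_k {q : ℕ} (hq : Fintype.card F = q) {V W : Type} [AddCommGroup V] [Module F V]
    [AddCommGroup W] [Module F W] [Finite W] (e : V ≃ₗ[F] F × W) {f : V → F}
    (hk : (Kz (fun w => f (e.symm w))).card + 1 = q) : Flat f := by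
  obtain ⟨a, ha, _⟩ := one_slice hq hk
  exact Flat_e e (Flat_one ha)

theorem MS0 {q t n : ℕ} (hq : Fintype.card F = q) (hq3 : 3 ≤ q) {V : Type} [AddCommGroup V]
    [Module F V] [Finite V] {f : V → F} (hr : Module.finrank F V = t + 1 + n + 1)
    (hD : Dg ((t + 1) * (q - 1) + 1) f) (hN : NW f = q ^ (n + 1)) : Flat f := by
  have hD1 : Dg (t * (q - 1) + (q - 1) + 1) f := hD.mono (by rw [Nat.add_mul]; omega)
  have hqn : 0 < q ^ n := pow_pos (by omega) n
  have hN2 : NW f < 2 * (q - 1) * q ^ n := by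
    rw [hN, pow_succ']; exact Nat.mul_lt_mul_of_pos_right (by omega) hqn
  obtain ⟨φ, e, hφ, he, hk⟩ := PSPL (n := n + 1) hq (by omega) (by omega) (by omega) hD1 (by
    rw [show q - (q - 1) + 1 = 2 by omega]
    exact ms3 hN2.le)
  have hrk := finrank_ker_of φ e
  rw [← NW_e e f] at hN
  have hD' := Dg_e e hD1
  have hg0 : ∃ y, f (e.symm y) ≠ 0 := by
    by_contra hcon
    push Not at hcon
    rw [NW_zero_of hcon] at hN
    have := pow_pos (show 0 < q by omega) (n + 1)
    omega
  have hK := Kz_lt hg0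
  rw [hq] at hK
  refine Flat_k hq e ?_
  have hsb := SB1 (n := n) hq (by omega) (by omega) hD' (by omega)
  rw [hN] at hsb
  have := ms1 (q := q) (s := q - 1) (n := n) hk (by omega) (by omega) (by
    rw [show q - (q - 1) = 1 by omega] at *
    simpa using hsb)
  omega

theorem MS {q t s n : ℕ} (hq : Fintype.card F = q) (hq3 : 3 ≤ q) {V : Type} [AddCommGroup V]
    [Module F V] [Finite V] {f : V → F} (hr : Module.finrank F V = t + 1 + n + 1) (hs : s + 2 ≤ q)
    (hD : Dg ((t + 1) * (q - 1) + s + 1) f) (hN : NW f = (q - s) * q ^ n) : Flat f := by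
  rcases Nat.eq_zero_or_pos s with rfl | hs1
  · exact MS0 hq hq3 hr hD (by rw [hN, pow_succ']; simp)
  have hpos : 0 < NW f := by
    rw [hN]; exact Nat.mul_pos (by omega) (pow_pos (by omega) n)
  have hf0 : ∃ x, f x ≠ 0 := by
    by_contra hcon
    push Not at hcon
    rw [NW_zero_of hcon] at hpos
    omega
  obtain ⟨x0, hx0⟩ := hf0
  have hsub : (t + 1) * (q - 1) = t * (q - 1) + (q - 1) := by ring
  rcases n with _ | n
  · obtain ⟨φ, e, hφ, he⟩ := split_any (F := F) (V := V) (by omega)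
    have hrk := finrank_ker_of φ e
    rw [← NW_e e f] at hN
    have hD' := Dg_e e hD
    by_contra hcon
    have hck := mt (Flat_k (f := f) hq e) hcon
    apply hcon
    apply Flat_e e
    clear hcon
    set g : F × LinearMap.ker φ → F := fun w => f (e.symm w) with hg
    have hg0 : ∃ y, g y ≠ 0 := ⟨e x0, by simpa [hg] using hx0⟩
    have hK := Kz_lt hg0
    rw [hq] at hK
    have hle : (Kz g).card ≤ s := by
      by_contra h
      have hsb := SB2 (n := 0) hq (by omega) (by omega) hD' hg0 (by omega)
      rw [hN] at hsb
      exact hck (ms2 (by omega) (by omega) hsb)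
    have h1 : ∀ a, a ∉ Kz g → 1 ≤ NW (fun y => g (a, y)) := fun a ha => by
      obtain ⟨w, hw⟩ := Kz_nz ha
      exact NW_pos (f := fun y => g (a, y)) hw
    have h2 := sl_le g 1 h1
    rw [hN, hq] at h2
    simp only [pow_zero, mul_one] at h2 hN
    have hks : (Kz g).card = s := by omega
    have heq := sl_eq g 1 h1 (by rw [hN, hq, hks]; omega)
    obtain ⟨⟨a, w⟩, hw⟩ := hg0
    have ha : a ∉ Kz g := fun h => hw (mem_Kz.1 h w)
    refine GLUE (r := (t + 1) * (q - 1) + s) (w := 1) hD' (fun u _ ⟨x, hx⟩ => NW_pos hx) ?_ heq a ha ?_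
    · intro u hu hu0
      have := MD (t := t) (n := 0) (s := q - 2) hq (by omega) (by omega) (hu.mono (by omega)) hu0
      simp only [pow_zero, mul_one] at this
      omega
    · obtain ⟨ψ, _, hψ, _⟩ := split_any (F := F) (V := LinearMap.ker φ) (by omega)
      refine ⟨ψ, hψ, ψ w, fun y hy => ?_⟩
      have h5 := heq a ha
      obtain ⟨z, hz⟩ := Set.ncard_eq_one.1 h5
      have e1 : y ∈ ({z} : Set _) := hz ▸ hy
      have e2 : w ∈ ({z} : Set _) := hz ▸ hw
      rw [Set.mem_singleton_iff.1 e1, Set.mem_singleton_iff.1 e2]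
  · obtain ⟨φ, e, hφ, he, hk⟩ := PSPL (n := n + 1) hq (by omega) (by omega) (by omega) hD (by
      rw [hN, ar3 (by omega) (by omega), ← mul_assoc]
      exact Nat.mul_le_mul_right _ (by omega))
    have hrk := finrank_ker_of φ e
    rw [← NW_e e f] at hN
    have hD' := Dg_e e hD
    by_contra hcon
    have hck := mt (Flat_k (f := f) hq e) hcon
    apply hcon
    apply Flat_e e
    clear hcon
    set g : F × LinearMap.ker φ → F := fun w => f (e.symm w) with hg
    have hg0 : ∃ y, g y ≠ 0 := ⟨e x0, by simpa [hg] using hx0⟩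
    have hK := Kz_lt hg0
    rw [hq] at hK
    have hle : (Kz g).card ≤ s := by
      by_contra h
      have hsb := SB2 (n := n + 1) hq (by omega) (by omega) hD' hg0 (by omega)
      rw [hN] at hsb
      exact hck (ms2 (by omega) (by omega) hsb)
    have hks : (Kz g).card = s := by
      have hsb := SB1 (n := n) hq (by omega) (by omega) hD' hle
      rw [hN] at hsb
      exact ms1 hk hle (by omega) hsb
    have h1 := SBs1 (n := n) hq (by omega) (by omega) hD' hle
    rw [show q - s + (Kz g).card = q by omega, ← pow_succ'] at h1
    have heq := sl_eq g _ h1 (by rw [hN, hq, hks])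
    obtain ⟨⟨a, w⟩, hw⟩ := hg0
    have ha : a ∉ Kz g := fun h => hw (mem_Kz.1 h w)
    refine GLUE (r := (t + 1) * (q - 1) + s) (w := q ^ (n + 1)) hD' ?_ ?_ heq a ha ?_
    · intro u hu hu0
      have := MD (t := t + 1) (n := n) (s := 0) hq (by omega) (by omega) (hu.mono (by omega)) hu0
      rw [pow_succ']; simpa using this
    · intro u hu hu0
      have := MD (t := t) (n := n + 1) (s := q - 2) hq (by omega) (by omega) (hu.mono (by omega)) hu0
      rw [show q - (q - 2) = 2 by omega] at this
      have := pow_pos (show 0 < q by omega) (n + 1)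
      omega
    · refine MS0 (t := t) (n := n) hq hq3 (by omega) ?_ (heq a ha)
      exact (hD'.sliceK (Kz g) (fun c hc => mem_Kz.1 hc) a).mono (by omega)

end hyp

theorem hy1 {q s k n : ℕ} (hk : 1 ≤ k) (hks : k < s) (hs : s + 1 ≤ q)
    (h : (q - k) * ((q - s + k) * q ^ n) ≤ (q - s + 1) * (q - 1) * q ^ n) :
    (k = 1 ∨ k + 1 = s) ∧ (q - k) * ((q - s + k) * q ^ n) = (q - s + 1) * (q - 1) * q ^ n := by
  have hq : 0 < q ^ n := pow_pos (by omega) n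
  rw [← mul_assoc] at h ⊢
  have h1 := Nat.le_of_mul_le_mul_right h hq
  have : k = 1 ∨ k + 1 = s := by
    obtain ⟨u, rfl⟩ := Nat.exists_eq_add_of_le hks
    obtain ⟨v, rfl⟩ := Nat.exists_eq_add_of_le hs
    obtain ⟨w, rfl⟩ := Nat.exists_eq_add_of_le hk
    rw [show (1 + w).succ + u + 1 + v - (1 + w) = u + 2 + v by omega,
      show (1 + w).succ + u + 1 + v - ((1 + w).succ + u) = v + 1 by omega,
      show (1 + w).succ + u + 1 + v - 1 = w + u + v + 2 by omega] at h1
    have : w * u ≤ 0 := by nlinarith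
    rcases Nat.mul_eq_zero.1 (Nat.le_zero.1 this) with h | h <;> omega
  refine ⟨this, ?_⟩
  congr 1
  rcases this with rfl | rfl
  · exact mul_comm _ _
  · rw [show q - (k + 1) + 1 = q - k by omega, show q - (k + 1) + k = q - 1 by omega]

theorem hy2 {q s k n : ℕ} (hks : s < k) (hk : k + 1 ≤ q) (hs : 1 ≤ s)
    (h : (q - k) * ((k - s + 1) * q ^ (n + 1)) ≤ (q - s + 1) * (q - 1) * q ^ n) : k + 1 = q := by
  have hq : 0 < q ^ n := pow_pos (by omega) n
  refine ms2 (n := 0) hks hk ?_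
  rw [pow_succ', ar3 hs (by omega), ← mul_assoc, ← mul_assoc] at h
  have h1 := Nat.le_of_mul_le_mul_right h hq
  have h2 : q * ((q - k) * (k - s + 1)) < q * (q - s + 1) := by
    rw [mul_comm q ((q - k) * _)]
    refine h1.trans_lt ?_
    rw [Nat.mul_add q]; omega
  have h3 := Nat.lt_of_mul_lt_mul_left h2
  simp only [pow_zero, mul_one]
  omega

theorem hy3 {q s n N : ℕ} (hs : 2 ≤ s) (hs2 : s + 2 ≤ q)
    (h : N + (q - s - 1) * q ^ (n + 1) ≤ (q - s + 1) * (q - 1) * q ^ n) :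
    N < 2 * (q - 1) * q ^ n := by
  have hq : 0 < q ^ n := pow_pos (by omega) n
  obtain ⟨u, rfl⟩ := Nat.exists_eq_add_of_le hs2
  rw [ar3 (by omega) (by omega), show s + 2 + u - s - 1 = u + 1 by omega,
    show s + 2 + u - s = u + 2 by omega, pow_succ'] at h
  rw [show s + 2 + u - 1 = s + u + 1 by omega]
  obtain ⟨v, rfl⟩ := Nat.exists_eq_add_of_le hs
  rw [show 2 + v - 1 = v + 1 by omega] at h
  generalize (2 + v + 2 + u) ^ n = Q at *
  nlinarith

section hyp2
variable {F : Type} [Field F] [Fintype F]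

theorem CASES {q t s n : ℕ} (hq : Fintype.card F = q) (hs : 2 ≤ s) (hs2 : s + 2 ≤ q)
    {W : Type} [AddCommGroup W] [Module F W] [Finite W] {g : F × W → F}
    (hr : Module.finrank F W = t + n + 1) (hD : Dg (t * (q - 1) + s + 1) g)
    (hN : NW g = (q - s + 1) * (q - 1) * q ^ n) (hk : 1 ≤ (Kz g).card) :
    (Kz g).card + 1 = q ∨ ((Kz g).card < s ∧ ((Kz g).card = 1 ∨ (Kz g).card + 1 = s) ∧
      ∀ a, a ∉ Kz g → NW (fun y => g (a, y)) = (q - s + (Kz g).card) * q ^ n) := by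
  classical
  have hg0 : ∃ y, g y ≠ 0 := by
    by_contra hcon
    push Not at hcon
    rw [NW_zero_of hcon] at hN
    have : 0 < (q - s + 1) * (q - 1) * q ^ n :=
      Nat.mul_pos (Nat.mul_pos (by omega) (by omega)) (pow_pos (by omega) n)
    omega
  have hK := Kz_lt hg0
  rw [hq] at hK
  rcases lt_trichotomy (Kz g).card s with h | h | h
  · right
    have hsb := SB1 (n := n) hq hr (by omega) hD h.le
    rw [hN] at hsb
    obtain ⟨h1, h2⟩ := hy1 hk h (by omega) hsb
    refine ⟨h, h1, ?_⟩
    exact sl_eq g _ (SBs1 (n := n) hq hr (by omega) hD h.le) (by rw [hN, hq, h2])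
  · exfalso
    have hsl := SBs1 (n := n) hq hr (by omega) hD h.le
    rw [h, show q - s + s = q by omega, ← pow_succ'] at hsl
    have hall : ∀ a, a ∉ Kz g → NW (fun y => g (a, y)) = q ^ (n + 1) := by
      intro a ha
      refine GapL q hq n t _ _ (by omega)
        ((hD.sliceK (Kz g) (fun c hc => mem_Kz.1 hc) a).mono (by omega)) (Kz_nz ha) ?_
      apply hy3 hs hs2
      rw [← hN, NW_sumK, ← Finset.add_sum_erase _ _ (Finset.mem_compl.2 ha)]
      refine Nat.add_le_add_left ?_ _
      have hc : ((Kz g)ᶜ.erase a).card = q - s - 1 := by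
        rw [Finset.card_erase_of_mem (Finset.mem_compl.2 ha), Finset.card_compl, hq, h]
      rw [← hc, ← smul_eq_mul]
      exact Finset.card_nsmul_le_sum _ _ _ fun b hb =>
        hsl b (Finset.mem_compl.1 (Finset.mem_of_mem_erase hb))
    have : NW g = (q - s) * q ^ (n + 1) := by
      rw [NW_sumK, Finset.sum_congr rfl fun a ha => hall a (Finset.mem_compl.1 ha),
        Finset.sum_const, Finset.card_compl, hq, h, smul_eq_mul]
    rw [hN, ar3 (by omega) (by omega), pow_succ', ← mul_assoc] at this
    have := Nat.eq_of_mul_eq_mul_right (pow_pos (by omega) n) this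
    rw [mul_comm] at this
    omega
  · left
    have hsb := SB2 (n := n + 1) hq (by omega) (by omega) hD hg0 h
    rw [hN] at hsb
    exact hy2 h hK (by omega) hsb

theorem HYP {q t s n : ℕ} (hq : Fintype.card F = q) (hs : 2 ≤ s) (hs2 : s + 2 ≤ q)
    {V : Type} [AddCommGroup V] [Module F V] [Finite V] {f : V → F}
    (hr : Module.finrank F V = t + 1 + n + 2) (hD : Dg ((t + 1) * (q - 1) + s + 1) f)
    (hN : NW f = (q - s + 1) * (q - 1) * q ^ n) : Flat f := by
  obtain ⟨φ, e, hφ, he, hk⟩ := PSPL (n := n + 1) hq (by omega) (by omega) (by omega) hD (by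
    rw [hN, pow_succ']; exact (Nat.mul_left_comm _ _ _).le)
  have hrk := finrank_ker_of φ e
  rw [← NW_e e f] at hN
  have hD' := Dg_e e hD
  rcases CASES (n := n) hq hs hs2 (by omega) hD' hN hk with h | ⟨h1, h2, h3⟩
  · exact Flat_k hq e h
  apply Flat_e e
  set g : F × LinearMap.ker φ → F := fun w => f (e.symm w) with hg
  obtain ⟨a, ha⟩ : ∃ a, a ∉ Kz g := by
    by_contra hcon
    push Not at hcon
    have := Finset.eq_univ_of_forall hcon
    have h4 := Finset.card_univ (α := F)
    rw [← this] at h4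
    omega
  have hsub : (t + 1) * (q - 1) = t * (q - 1) + (q - 1) := by ring
  refine GLUE (r := (t + 1) * (q - 1) + s) (w := (q - s + (Kz g).card) * q ^ n) hD' ?_ ?_ h3 a ha ?_
  · intro u hu hu0
    have := MD (t := t + 1) (n := n) (s := s - (Kz g).card) hq (by omega) (by omega)
      (hu.mono (by omega)) hu0
    rwa [show q - (s - (Kz g).card) = q - s + (Kz g).card by omega] at this
  · intro u hu hu0
    have := MD (t := t + 1) (n := n) (s := s - (Kz g).card - 1) hq (by omega) (by omega)
      (hu.mono (by omega)) hu0
    refine lt_of_lt_of_le ?_ this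
    exact Nat.mul_lt_mul_of_pos_right (by omega) (pow_pos (by omega) n)
  · refine MS (t := t) (n := n) (s := s - (Kz g).card) hq (by omega) (by omega) (by omega)
      ((hD'.sliceK (Kz g) (fun c hc => mem_Kz.1 hc) a).mono (by omega)) ?_
    rw [h3 a ha, show q - (s - (Kz g).card) = q - s + (Kz g).card by omega]

theorem RED {q s n : ℕ} (hq : Fintype.card F = q) (hs : 2 ≤ s) (hs2 : s + 2 ≤ q) (t : ℕ) :
    ∀ (V : Type) [AddCommGroup V] [Module F V] [Finite V] (f : V → F),
    Module.finrank F V = t + n + 2 → Dg (t * (q - 1) + s + 1) f →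
    NW f = (q - s + 1) * (q - 1) * q ^ n →
    ∃ (E : Submodule F V) (p : V), Module.finrank F E = n + 2 ∧ (∀ x, f x ≠ 0 → x - p ∈ E) ∧
      Dg (s + 1) (fun w : E => f (w + p)) := by
  classical
  induction t with
  | zero =>
    intro V _ _ _ f hr hD hN
    refine ⟨⊤, 0, ?_, by simp, ?_⟩
    · rw [finrank_top]; omega
    · have := hD.comp (Submodule.subtype (⊤ : Submodule F V)) 0
      exact this.mono (by omega)
  | succ t ih =>
    intro V _ _ _ f hr hD hN
    obtain ⟨φ, hφ, c, hc⟩ := HYP (t := t) (n := n) hq hs hs2 (by omega) hD hN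
    obtain ⟨e, he⟩ := split_of φ hφ
    have hrk := finrank_ker_of φ e
    have hD' := Dg_e e hD
    rw [← NW_e e f] at hN
    have hc' : ∀ b w, f (e.symm (b, w)) ≠ 0 → b = c := by
      intro b w hb
      have := hc _ hb
      rw [← he] at this
      simpa using this
    have hsub : (t + 1) * (q - 1) = t * (q - 1) + (q - 1) := by ring
    have hDc := hD'.sliceK (Finset.univ.erase c) (fun b hb w => by
      by_contra hcon
      exact Finset.ne_of_mem_erase hb (hc' b w hcon)) c
    rw [Finset.card_erase_of_mem (Finset.mem_univ c), Finset.card_univ, hq] at hDc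
    have hNc : NW (fun w => f (e.symm (c, w))) = (q - s + 1) * (q - 1) * q ^ n := by
      rw [← hN, NW_sum, Finset.sum_eq_single c]
      · intro b _ hb
        exact NW_zero_of fun w => by
          by_contra hcon
          exact hb (hc' b w hcon)
      · simp
    obtain ⟨E, p, hE, hp, hDE⟩ := ih _ _ (by omega) (hDc.mono (by omega)) hNc
    let L : LinearMap.ker φ →ₗ[F] V := e.symm.toLinearMap ∘ₗ LinearMap.inr F F (LinearMap.ker φ)
    have hL : Function.Injective L := by
      intro x y hxy
      have := e.symm.injective hxy
      simpa using this
    have hsplit : ∀ x y, e.symm (c, x + y) = L x + e.symm (c, y) := by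
      intro x y
      simp only [L, LinearMap.comp_apply]
      erw [← map_add]
      simp
    refine ⟨E.map L, e.symm (c, p), ?_, ?_, ?_⟩
    · rw [← hE]
      exact (Submodule.equivMapOfInjective L hL E).finrank_eq.symm
    · intro x hx
      obtain ⟨⟨b, w⟩, rfl⟩ := e.symm.surjective x
      have := hc' b w hx
      subst this
      refine ⟨w - p, hp w hx, ?_⟩
      have := hsplit (w - p) p
      rw [sub_add_cancel] at this
      rw [this, add_sub_cancel_right]
    · let e2 := Submodule.equivMapOfInjective L hL E
      have := hDE.compl e2.symm.toLinearMap
      convert this using 2 with w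
      obtain ⟨v, rfl⟩ := e2.surjective w
      simp only [LinearEquiv.coe_coe, LinearEquiv.symm_apply_apply]
      rw [hsplit]
      rfl

end hyp2

section plane
variable {F : Type} [Field F] [Fintype F]

/-- zero set -/
noncomputable def Zs (u : F → F) : Finset F := by
  classical exact Finset.univ.filter fun y => u y = 0

theorem mem_Zs {u : F → F} {y : F} : y ∈ Zs u ↔ u y = 0 := by simp [Zs]

theorem Zs_NW (u : F → F) : (Zs u).card + NW u = Fintype.card F := by
  classical
  have h : NW u = ((Zs u)ᶜ).card := by
    unfold NW
    rw [← Set.ncard_coe_finset]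
    congr 1; ext y; simp [mem_Zs]
  rw [h, Finset.card_compl]
  have := Finset.card_le_univ (Zs u)
  omega

theorem Zs_le {u : F → F} {e : ℕ} (h : Dg (e + 1) u) (he : e + 1 ≤ Fintype.card F)
    (hu : ∃ y, u y ≠ 0) : (Zs u).card ≤ e := by
  have := MD (q := Fintype.card F) (t := 0) (s := e) (n := 0) rfl
    (by simp) he (h.mono (by omega)) hu
  have h2 := Zs_NW u
  simp only [pow_zero, mul_one] at this
  omega

/-- `TypeAB k Z`: off `a = 0`, `Z` is the union of `k` lines, parallel or concurrent on `a = 0`. -/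
def TypeAB (k : ℕ) (Z : F → F → Prop) : Prop :=
  ∃ M : Finset F, M.card = k ∧
    ((∃ μ, ∀ a y, a ≠ 0 → (Z a y ↔ y - μ * a ∈ M)) ∨
     (∃ ν, ∀ a y, a ≠ 0 → (Z a y ↔ ∃ μ ∈ M, y = μ * a + ν)))

theorem TypeAB_congr {k : ℕ} {Z Z' : F → F → Prop} (h : TypeAB k Z)
    (hZ : ∀ a y, a ≠ 0 → (Z' a y ↔ Z a y)) : TypeAB k Z' := by
  obtain ⟨M, hM, ⟨μ, h⟩ | ⟨μ, h⟩⟩ := h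
  · exact ⟨M, hM, Or.inl ⟨μ, fun a y ha => (hZ a y ha).trans (h a y ha)⟩⟩
  · exact ⟨M, hM, Or.inr ⟨μ, fun a y ha => (hZ a y ha).trans (h a y ha)⟩⟩

theorem TypeAB_compl {k : ℕ} {Z : F → F → Prop} (h : TypeAB k Z) :
    TypeAB (Fintype.card F - k) (fun a y => ¬ Z a y) := by
  classical
  obtain ⟨M, hM, h⟩ := h
  refine ⟨Mᶜ, by rw [Finset.card_compl, hM], ?_⟩
  rcases h with ⟨μ, h⟩ | ⟨ν, h⟩
  · left; exact ⟨μ, fun a y ha => by simp [h a y ha]⟩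
  · right
    refine ⟨ν, fun a y ha => ?_⟩
    show ¬ Z a y ↔ _
    rw [h a y ha]
    constructor
    · intro hn
      refine ⟨(y - ν) / a, ?_, by field_simp; ring⟩
      rw [Finset.mem_compl]
      intro hm
      exact hn ⟨_, hm, by field_simp; ring⟩
    · rintro ⟨μ, hμ, rfl⟩ ⟨μ', hμ', hh⟩
      have : μ = μ' := mul_right_cancel₀ ha (add_right_cancel hh)
      subst this
      exact (Finset.mem_compl.1 hμ) hμ'

theorem FINISH {e : ℕ} {Z : F → F → Prop} (Λ : Finset (F × F)) (hΛ : Λ.card = e)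
    (hZ : ∀ a y, a ≠ 0 → (Z a y ↔ ∃ p ∈ Λ, y = p.1 * a + p.2))
    (hd : ∀ a, a ≠ 0 → ∀ p ∈ Λ, ∀ r ∈ Λ, p.1 * a + p.2 = r.1 * a + r.2 → p = r) :
    TypeAB e Z := by
  classical
  have pair : ∀ p ∈ Λ, ∀ r ∈ Λ, p.1 = r.1 ∨ p.2 = r.2 := by
    intro p hp r hr
    by_contra hcon
    push Not at hcon
    obtain ⟨h1, h2⟩ := hcon
    have h3 : p.1 - r.1 ≠ 0 := sub_ne_zero.2 h1
    have := hd ((r.2 - p.2) / (p.1 - r.1)) (div_ne_zero (sub_ne_zero.2 (Ne.symm h2)) h3) p hp r hr (by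
      field_simp; ring)
    exact h1 (by rw [this])
  by_cases hμ : ∃ μ, ∀ p ∈ Λ, p.1 = μ
  · obtain ⟨μ, hμ⟩ := hμ
    refine ⟨Λ.image Prod.snd, ?_, Or.inl ⟨μ, fun a y ha => ?_⟩⟩
    · rw [Finset.card_image_of_injOn, hΛ]
      intro p hp r hr h
      exact Prod.ext ((hμ p hp).trans (hμ r hr).symm) h
    · rw [hZ a y ha, Finset.mem_image]
      constructor
      · rintro ⟨p, hp, rfl⟩; exact ⟨p, hp, by rw [hμ p hp]; ring⟩
      · rintro ⟨p, hp, h⟩; exact ⟨p, hp, by rw [hμ p hp, h]; ring⟩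
  · push Not at hμ
    obtain ⟨p, hp, -⟩ := hμ 0
    obtain ⟨p', hp', hpp⟩ := hμ p.1
    have h2 : p'.2 = p.2 := (pair _ hp' _ hp).resolve_left hpp
    have hν : ∀ r ∈ Λ, r.2 = p.2 := by
      intro r hr
      by_contra h
      have h3 := (pair r hr p hp).resolve_right h
      have h4 := (pair r hr p' hp').resolve_right (by rw [h2]; exact h)
      exact hpp (h4.symm.trans h3)
    refine ⟨Λ.image Prod.fst, ?_, Or.inr ⟨p.2, fun a y ha => ?_⟩⟩
    · rw [Finset.card_image_of_injOn, hΛ]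
      intro r hr r' hr' h
      exact Prod.ext h ((hν r hr).trans (hν r' hr').symm)
    · rw [hZ a y ha]
      constructor
      · rintro ⟨r, hr, rfl⟩
        exact ⟨r.1, Finset.mem_image_of_mem _ hr, by rw [hν r hr]⟩
      · rintro ⟨μ, hm, rfl⟩
        obtain ⟨r, hr, rfl⟩ := Finset.mem_image.1 hm
        exact ⟨r, hr, by rw [hν r hr]⟩

theorem Dg_line {n : ℕ} {G : F × F → F} (h : Dg n G) (μ ν : F) :
    Dg n (fun a : F => G (a, μ * a + ν)) := by
  have := h.comp ((LinearMap.id : F →ₗ[F] F).prod (μ • LinearMap.id)) (0, ν)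
  simpa using this

open Classical in
/-- counting zeros on lines through a zero -/
theorem CNT {e : ℕ} {G : F × F → F} (hD : Dg (e + 1) G) (he : e + 1 ≤ Fintype.card F)
    (hZ : ∀ a, a ≠ 0 → (Zs fun y => G (a, y)).card = e) {a0 y0 : F} (ha0 : a0 ≠ 0)
    (hP : G (a0, y0) = 0) (hno : ∀ μ ν, ∃ a, G (a, μ * a + ν) ≠ 0) :
    Fintype.card F ≤ 2 * e ∧ (2 * e = Fintype.card F →
      ∀ μ ν, y0 = μ * a0 + ν → ((Zs fun a => G (a, μ * a + ν)).filter (· ≠ 0)).card = e) := by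
  classical
  set q := Fintype.card F with hq
  have hq2 : 2 ≤ q := Fintype.one_lt_card
  let N : F → Finset F := fun μ => (Zs fun a => G (a, μ * a + (y0 - μ * a0))).filter
    (fun a => a ≠ 0 ∧ a ≠ a0)
  have hmem : ∀ μ, a0 ∈ Zs fun a => G (a, μ * a + (y0 - μ * a0)) := by
    intro μ; rw [mem_Zs]; simpa using hP
  have hsub : ∀ μ, N μ ⊆ (Zs fun a => G (a, μ * a + (y0 - μ * a0))).erase a0 := by
    intro μ a ha
    simp only [N, Finset.mem_filter] at ha
    exact Finset.mem_erase.2 ⟨ha.2.2, ha.1⟩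
  have hN : ∀ μ, (N μ).card ≤ e - 1 := by
    intro μ
    refine (Finset.card_le_card (hsub μ)).trans ?_
    rw [Finset.card_erase_of_mem (hmem μ)]
    have := Zs_le (Dg_line hD μ (y0 - μ * a0)) he (hno _ _)
    omega
  have he1 : 1 ≤ e := by
    have := Zs_le (Dg_line hD 0 (y0 - 0 * a0)) he (hno _ _)
    have h2 := Finset.card_pos.2 ⟨a0, hmem 0⟩
    omega
  have hsum : ∑ μ : F, (N μ).card = (q - 2) * e := by
    have h1 : ∑ μ : F, (N μ).card = ∑ a ∈ (Finset.univ.erase (0 : F)).erase a0, e := by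
      simp only [N, Finset.card_eq_sum_ones, Finset.sum_filter, Zs]
      rw [Finset.sum_comm]
      rw [← Finset.sum_subset (Finset.subset_univ ((Finset.univ.erase (0 : F)).erase a0))]
      · refine Finset.sum_congr rfl fun a ha => ?_
        simp only [Finset.mem_erase, Finset.mem_univ, and_true] at ha
        rw [← hZ a ha.2]
        have hne : a - a0 ≠ 0 := sub_ne_zero.2 ha.1
        simp only [Zs, Finset.card_filter, ha.1, ha.2, ne_eq, not_false_eq_true, and_self, if_true]
        refine Fintype.sum_bijective (fun μ => μ * a + (y0 - μ * a0)) ?_ _ _ (fun μ => rfl)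
        refine (Finite.injective_iff_bijective).1 ?_
        intro μ μ' h
        have : (μ - μ') * (a - a0) = 0 := by linear_combination h
        exact sub_eq_zero.1 ((mul_eq_zero.1 this).resolve_right hne)
      · intro a _ ha
        simp only [Finset.mem_erase, Finset.mem_univ, and_true, not_and_or, not_not] at ha
        refine Finset.sum_eq_zero fun μ _ => ?_
        have : ¬ (a ≠ 0 ∧ a ≠ a0) := by tauto
        simp [this]
    rw [h1, Finset.sum_const, Finset.card_erase_of_mem (by simp [ha0]),
      Finset.card_erase_of_mem (Finset.mem_univ _), Finset.card_univ, smul_eq_mul]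
    rfl
  have hle : ∑ μ : F, (N μ).card ≤ ∑ μ : F, (e - 1) := Finset.sum_le_sum fun μ _ => hN μ
  have hc : ∑ μ : F, (e - 1) = q * (e - 1) := by simp [hq]
  have key : (q - 2) * e + 2 * e = q * (e - 1) + q := by
    obtain ⟨u, hu⟩ := Nat.exists_eq_add_of_le hq2
    obtain ⟨w, rfl⟩ := Nat.exists_eq_add_of_le he1
    rw [hu]; simp only [Nat.add_sub_cancel_left]; ring
  refine ⟨by omega, fun h2 μ ν hμ => ?_⟩
  have heq : ∑ μ : F, (N μ).card = ∑ μ : F, (e - 1) := by omega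
  have h3 := (Finset.sum_eq_sum_iff_of_le fun μ _ => hN μ).1 heq μ (Finset.mem_univ _)
  have hν : ν = y0 - μ * a0 := by rw [hμ]; ring
  subst hν
  have h4 : ((Zs fun a => G (a, μ * a + (y0 - μ * a0))).filter (· ≠ 0)) = insert a0 (N μ) := by
    ext a
    simp only [N, Finset.mem_filter, Finset.mem_insert]
    constructor
    · rintro ⟨h1, h2⟩
      by_cases h : a = a0
      · exact Or.inl h
      · exact Or.inr ⟨h1, h2, h⟩
    · rintro (rfl | ⟨h1, h2, h3⟩)
      · exact ⟨hmem μ, ha0⟩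
      · exact ⟨h1, h2⟩
  rw [h4, Finset.card_insert_of_notMem (by simp [N]), h3]
  omega

theorem STRIP {e : ℕ} {G : F × F → F} (hD : Dg (e + 2) G) (he : e + 2 ≤ Fintype.card F)
    (hZ : ∀ a, a ≠ 0 → (Zs fun y => G (a, y)).card = e + 1) {μ ν : F}
    (hl : ∀ a, G (a, μ * a + ν) = 0) :
    ∃ G2 : F × F → F, Dg (e + 1) G2 ∧ (∀ a y, G (a, y) = (y - μ * a - ν) * G2 (a, y)) ∧
      ∀ a, a ≠ 0 → (Zs fun y => G2 (a, y)).card = e := by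
  classical
  have h1 := hD.compl ((LinearMap.snd F F F).prod (LinearMap.fst F F F + μ • LinearMap.snd F F F))
  obtain ⟨g, hg, hg'⟩ := h1.factor ν (fun w => by
    have := hl w
    rw [add_comm] at this
    simpa using this)
  let G2 : F × F → F := fun x => g (x.2 - μ * x.1, x.1)
  have hG2 : ∀ a y, G (a, y) = (y - μ * a - ν) * G2 (a, y) := by
    intro a y
    have := hg' (y - μ * a, a)
    simpa [G2] using this
  have hD2 : Dg (e + 1) G2 := by
    have := hg.compl ((LinearMap.snd F F F - μ • LinearMap.fst F F F).prod (LinearMap.fst F F F))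
    refine Dg.mono ?_ (show e + 2 - 1 ≤ e + 1 by omega)
    simpa [G2] using this
  refine ⟨G2, hD2, hG2, fun a ha => ?_⟩
  have hne : ∃ y, G2 (a, y) ≠ 0 := by
    by_contra hcon
    push Not at hcon
    have : (Zs fun y => G (a, y)) = Finset.univ := by
      ext y; simp [mem_Zs, hG2, hcon]
    have h2 := hZ a ha
    rw [this, Finset.card_univ] at h2
    omega
  have hle := Zs_le (hD2.slice a) (by omega) hne
  have hsub : (Zs fun y => G (a, y)).erase (μ * a + ν) ⊆ Zs fun y => G2 (a, y) := by
    intro y hy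
    rw [Finset.mem_erase, mem_Zs, hG2] at hy
    rw [mem_Zs]
    refine (mul_eq_zero.1 hy.2).resolve_left fun h => hy.1 ?_
    linear_combination h
  have h3 := Finset.card_le_card hsub
  rw [Finset.card_erase_of_mem (mem_Zs.2 (hl a)), hZ a ha] at h3
  omega

theorem LINES (e : ℕ) : ∀ {G : F × F → F}, Dg (e + 1) G → e + 1 ≤ Fintype.card F → 2 * e ≤ Fintype.card F →
    (2 * e < Fintype.card F ∨ ∃ μ ν, ∀ a, G (a, μ * a + ν) = 0) →
    (∀ a, a ≠ 0 → (Zs fun y => G (a, y)).card = e) →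
    ∃ Λ : Finset (F × F), Λ.card ≤ e ∧
      ∀ a y, a ≠ 0 → (G (a, y) = 0 ↔ ∃ p ∈ Λ, y = p.1 * a + p.2) := by
  classical
  induction e with
  | zero =>
    intro G hD _ _ _ hZ
    refine ⟨∅, by simp, fun a y ha => ?_⟩
    have := Finset.card_eq_zero.1 (hZ a ha)
    have h2 : y ∉ (Zs fun y => G (a, y)) := by rw [this]; simp
    rw [mem_Zs] at h2
    simpa using h2
  | succ e ih =>
    intro G hD he hle hor hZ
    have hl : ∃ μ ν, ∀ a, G (a, μ * a + ν) = 0 := by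
      by_contra hcon
      have h2 := hor.resolve_right hcon
      push Not at hcon
      obtain ⟨y0, hy0⟩ := Finset.card_pos.1 (show 0 < (Zs fun y => G (1, y)).card by
        rw [hZ 1 one_ne_zero]; omega)
      have := (CNT hD he hZ one_ne_zero (mem_Zs.1 hy0) hcon).1
      omega
    obtain ⟨μ, ν, hl⟩ := hl
    obtain ⟨G2, hD2, hG2, hZ2⟩ := STRIP hD he hZ hl
    · obtain ⟨Λ, hΛ, hh⟩ := ih hD2 (by omega) (by omega) (Or.inl (by omega)) hZ2
      refine ⟨insert (μ, ν) Λ, (Finset.card_insert_le _ _).trans (by omega), fun a y ha => ?_⟩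
      rw [hG2, mul_eq_zero, hh a y ha]
      simp only [Finset.mem_insert, exists_eq_or_imp]
      rw [sub_sub, sub_eq_zero]

end plane

section plane2
variable {F : Type} [Field F] [Fintype F]

theorem LTy {e : ℕ} {G : F × F → F} (hD : Dg (e + 1) G) (he : e + 1 ≤ Fintype.card F)
    (hle : 2 * e ≤ Fintype.card F)
    (hor : 2 * e < Fintype.card F ∨ ∃ μ ν, ∀ a, G (a, μ * a + ν) = 0)
    (hZ : ∀ a, a ≠ 0 → (Zs fun y => G (a, y)).card = e) :
    TypeAB e (fun a y => G (a, y) = 0) := by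
  classical
  obtain ⟨Λ, hΛ, h⟩ := LINES e hD he hle hor hZ
  have him : ∀ a, a ≠ 0 → Λ.image (fun p => p.1 * a + p.2) = Zs fun y => G (a, y) := by
    intro a ha
    ext y
    rw [mem_Zs, h a y ha, Finset.mem_image]
    exact ⟨fun ⟨p, hp, hh⟩ => ⟨p, hp, hh.symm⟩, fun ⟨p, hp, hh⟩ => ⟨p, hp, hh.symm⟩⟩
  have hcard : Λ.card = e := by
    have h1 := hZ 1 one_ne_zero
    rw [← him 1 one_ne_zero] at h1
    have := Finset.card_image_le (s := Λ) (f := fun p : F × F => p.1 * 1 + p.2)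
    omega
  refine FINISH Λ hcard h fun a ha => ?_
  have h1 := hZ a ha
  rw [← him a ha, ← hcard] at h1
  intro p hp r hr hpr
  exact Finset.card_image_iff.1 h1 hp hr hpr

theorem DIV {s : ℕ} {G : F × F → F} {g : ℕ → F → F} (hg : ∀ i, Dg (s + 1 + 1 - i) (g i))
    (hG : ∀ a y, G (a, y) = y ^ (s + 1) + ∑ i ∈ Finset.range (s + 1), y ^ i * g i a) (l : ℕ) :
    ∃ (Q : F × F → F) (r : ℕ → F → F), Dg (l + 1) Q ∧
      (∀ i, i < s + 1 → Dg (s + 1 + l + 1 - i) (r i)) ∧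
      (∀ a, ∃ P : Polynomial F, P.Monic ∧ P.natDegree = l ∧ ∀ y, Q (a, y) = P.eval y) ∧
      ∀ a y, y ^ (s + 1 + l) = G (a, y) * Q (a, y) + ∑ i ∈ Finset.range (s + 1), y ^ i * r i a := by
  induction l with
  | zero =>
    refine ⟨fun _ => 1, fun i a => - g i a, Dg.const 0 1, fun i _ => ?_, fun a => ?_, fun a y => ?_⟩
    · have := (hg i).smul (-1)
      simpa using this
    · exact ⟨1, Polynomial.monic_one, by simp, by simp⟩
    · rw [hG]; simp
  | succ l ih =>
    obtain ⟨Q, r, hQ, hr, hP, hh⟩ := ih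
    refine ⟨fun x => x.2 * Q x + r s x.1,
      fun i a => (if i = 0 then 0 else r (i - 1) a) - r s a * g i a, ?_, ?_, ?_, ?_⟩
    · have h1 := Dg.mul (LinearMap.snd F F F) hQ
      have h2 := (hr s (by omega)).compl (LinearMap.fst F F F)
      exact Dg.add h1 (h2.mono (by omega))
    · intro i hi
      have h2 := hg i
      rw [show s + 1 + 1 - i = (s + 1 - i) + 1 by omega] at h2
      have h1 := (hr s (by omega)).prod h2
      refine Dg.sub ?_ (h1.mono (by omega))
      by_cases h0 : i = 0
      · simp only [h0, if_true]; exact Dg.zero _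
      · simp only [h0, if_false]; exact (hr (i - 1) (by omega)).mono (by omega)
    · intro a
      obtain ⟨P, hm, hd, hP⟩ := hP a
      have hX : (Polynomial.X * P).Monic := Polynomial.monic_X.mul hm
      have hXd : (Polynomial.X * P).natDegree = l + 1 := by
        rw [Polynomial.monic_X.natDegree_mul hm, Polynomial.natDegree_X, hd, add_comm]
      have hlt : (Polynomial.C (r s a)).degree < (Polynomial.X * P).degree := by
        refine lt_of_le_of_lt Polynomial.degree_C_le ?_
        rw [Polynomial.degree_eq_natDegree hX.ne_zero, hXd]
        exact_mod_cast Nat.succ_pos l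
      refine ⟨Polynomial.X * P + Polynomial.C (r s a), hX.add_of_left hlt, ?_, fun y => ?_⟩
      · rw [Polynomial.natDegree_add_eq_left_of_degree_lt hlt, hXd]
      · simp [hP y]
    · intro a y
      have h1 := hh a y
      have e1 : y ^ (s + 1) = G (a, y) - ∑ i ∈ Finset.range (s + 1), y ^ i * g i a := by
        rw [hG]; ring
      have e2 : ∑ i ∈ Finset.range (s + 1), y ^ i * ((if i = 0 then 0 else r (i - 1) a)
          - r s a * g i a) = (∑ i ∈ Finset.range s, y ^ (i + 1) * r i a) -
          r s a * ∑ i ∈ Finset.range (s + 1), y ^ i * g i a := by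
        simp only [mul_sub, Finset.sum_sub_distrib]
        rw [Finset.sum_range_succ']
        simp only [Nat.add_eq_zero_iff, one_ne_zero, and_false, if_false, Nat.add_sub_cancel,
          if_true, mul_zero, add_zero]
        rw [Finset.mul_sum]
        congr 1
        exact Finset.sum_congr rfl fun i _ => by ring
      have e3 : ∑ i ∈ Finset.range s, y ^ (i + 1) * r i a =
          y * ∑ i ∈ Finset.range s, y ^ i * r i a := by
        rw [Finset.mul_sum]; exact Finset.sum_congr rfl fun i _ => by ring
      rw [e2, e3, ← add_assoc, pow_succ, h1, Finset.sum_range_succ]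
      linear_combination r s a * e1

theorem HC {s : ℕ} {G : F × F → F} (hs : 1 ≤ s) (hD : Dg (s + 1 + 1) G)
    (he : s + 1 + 1 ≤ Fintype.card F)
    (hZ : ∀ a, a ≠ 0 → (Zs fun y => G (a, y)).card = s + 1) :
    ∃ H : F × F → F, Dg (Fintype.card F - (s + 1) + 1) H ∧
      ∀ a y, a ≠ 0 → (H (a, y) = 0 ↔ G (a, y) ≠ 0) := by
  classical
  have hsw := hD.compl ((LinearMap.snd F F F).prod (LinearMap.fst F F F))
  obtain ⟨g, hg, hg'⟩ := hsw.expand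
  replace hg' : ∀ y a, G (a, y) = ∑ i ∈ Finset.range (s + 1 + 1), y ^ i * g i a := hg'
  have hnz : ∀ a, a ≠ 0 → ∃ y, G (a, y) ≠ 0 := by
    intro a ha
    by_contra hcon
    push Not at hcon
    have : (Zs fun y => G (a, y)) = Finset.univ := by ext y; simp [mem_Zs, hcon]
    have h2 := hZ a ha
    rw [this, Finset.card_univ] at h2
    omega
  have hsumD : ∀ (c : ℕ → F) (k : ℕ), Dg k (fun y : F => ∑ i ∈ Finset.range k, y ^ i * c i) := by
    intro c k
    refine Dg.sum _ fun i hi => ?_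
    have := ((Dg.pow (LinearMap.id : F →ₗ[F] F) i).smul (c i)).mono
      (show i + 1 ≤ k by simpa using hi)
    simpa [mul_comm] using this
  obtain ⟨κ, hκ⟩ := (hg (s + 1)).eq_const_of (by omega)
  have hκ0 : κ ≠ 0 := by
    rintro rfl
    have h1 : Dg (s + 1) (fun y => G (1, y)) := by
      have : (fun y => G (1, y)) = fun y => ∑ i ∈ Finset.range (s + 1), y ^ i * g i 1 := by
        ext y; rw [hg' y 1, Finset.sum_range_succ, hκ]; simp
      rw [this]; exact hsumD _ _
    have := Zs_le h1 (by omega) (hnz 1 one_ne_zero)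
    rw [hZ 1 one_ne_zero] at this
    omega
  obtain ⟨Q, r, hQ, hr, hP, hh⟩ := DIV (s := s) (G := fun x => κ⁻¹ * G x)
    (g := fun i a => κ⁻¹ * g i a)
    (fun i => (hg i).smul _) (fun a y => by
      show κ⁻¹ * G (a, y) = _
      rw [hg' y a, Finset.sum_range_succ, hκ, mul_add, add_comm, Finset.mul_sum]
      congr 1
      · field_simp
      · exact Finset.sum_congr rfl fun i _ => by ring) (Fintype.card F - (s + 1))
  refine ⟨Q, hQ, ?_⟩
  have hGQ : ∀ a y, a ≠ 0 → G (a, y) * Q (a, y) = 0 := by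
    intro a y ha
    have hRD : Dg (s + 1) (fun y => (∑ i ∈ Finset.range (s + 1), y ^ i * r i a) - y) := by
      refine Dg.sub (hsumD _ _) ?_
      have := (Dg.pow (LinearMap.id : F →ₗ[F] F) 1).mono (show 1 + 1 ≤ s + 1 by omega)
      simpa using this
    have hyy : ∀ y : F, y = κ⁻¹ * G (a, y) * Q (a, y) + ∑ i ∈ Finset.range (s + 1), y ^ i * r i a := by
      intro y
      rw [← hh a y, show s + 1 + (Fintype.card F - (s + 1)) = Fintype.card F by omega,
        FiniteField.pow_card]
    have hzero : ∀ y, (∑ i ∈ Finset.range (s + 1), y ^ i * r i a) - y = 0 := by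
      by_contra hcon
      push Not at hcon
      have h1 := Zs_le hRD (by omega) hcon
      have h2 : (Zs fun y => G (a, y)) ⊆
          Zs fun y => (∑ i ∈ Finset.range (s + 1), y ^ i * r i a) - y := by
        intro y hy
        rw [mem_Zs] at hy ⊢
        have := hyy y
        rw [hy] at this
        linear_combination -this
      have := Finset.card_le_card h2
      rw [hZ a ha] at this
      omega
    have h3 := hyy y
    have h4 := hzero y
    have h5 : κ⁻¹ * (G (a, y) * Q (a, y)) = 0 := by linear_combination -h3 - h4
    exact (mul_eq_zero.1 h5).resolve_left (inv_ne_zero hκ0)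
  intro a y ha
  have hsub : (Zs fun y => G (a, y))ᶜ ⊆ Zs fun y => Q (a, y) := by
    intro z hz
    rw [Finset.mem_compl, mem_Zs] at hz
    rw [mem_Zs]
    exact (mul_eq_zero.1 (hGQ a z ha)).resolve_left hz
  have hQc : (Zs fun y => Q (a, y)).card ≤ Fintype.card F - (s + 1) := by
    obtain ⟨P, hm, hd, hP⟩ := hP a
    rw [← hd]
    refine le_trans ?_ (Polynomial.card_roots' P)
    refine (Finset.card_le_card (t := P.roots.toFinset) ?_).trans (Multiset.toFinset_card_le _)
    intro z hz
    rw [mem_Zs] at hz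
    rw [Multiset.mem_toFinset, Polynomial.mem_roots hm.ne_zero, Polynomial.IsRoot, ← hP]
    exact hz
  have heq := Finset.eq_of_subset_of_card_le hsub (by
    rw [Finset.card_compl, hZ a ha]; exact hQc)
  have h6 : y ∈ (Zs fun y => G (a, y))ᶜ ↔ y ∈ Zs fun y => Q (a, y) := by rw [heq]
  rw [Finset.mem_compl, mem_Zs, mem_Zs] at h6
  exact h6.symm

theorem PL {s : ℕ} {G : F × F → F} (hs : 2 ≤ s) (hD : Dg (s + 1) G)
    (he : s + 1 ≤ Fintype.card F)
    (hZ : ∀ a, a ≠ 0 → (Zs fun y => G (a, y)).card = s) :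
    TypeAB (Fintype.card F - s) (fun a y => G (a, y) ≠ 0) := by
  classical
  obtain ⟨H, hHD, hH⟩ : ∃ H : F × F → F, Dg (Fintype.card F - s + 1) H ∧
      ∀ a y, a ≠ 0 → (H (a, y) = 0 ↔ G (a, y) ≠ 0) := by
    obtain ⟨s, rfl⟩ : ∃ s', s = s' + 1 := ⟨s - 1, by omega⟩
    exact HC (by omega) hD he hZ
  have hZH : ∀ a, a ≠ 0 → (Zs fun y => H (a, y)).card = Fintype.card F - s := by
    intro a ha
    have : (Zs fun y => H (a, y)) = (Zs fun y => G (a, y))ᶜ := by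
      ext y; rw [Finset.mem_compl, mem_Zs, mem_Zs]; exact hH a y ha
    rw [this, Finset.card_compl, hZ a ha]
  by_cases h1 : 2 * s ≤ Fintype.card F ∧
      (2 * s < Fintype.card F ∨ ∃ μ ν, ∀ a, G (a, μ * a + ν) = 0)
  · exact TypeAB_compl (LTy hD he h1.1 h1.2 hZ)
  by_cases h2 : 2 * (Fintype.card F - s) ≤ Fintype.card F ∧
      (2 * (Fintype.card F - s) < Fintype.card F ∨ ∃ μ ν, ∀ a, H (a, μ * a + ν) = 0)
  · exact TypeAB_congr (LTy hHD (by omega) h2.1 h2.2 hZH) fun a y ha => (hH a y ha).symm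
  exfalso
  have hq : 2 * s = Fintype.card F := by
    by_contra hne
    rcases lt_or_gt_of_ne hne with h | h
    · exact h1 ⟨by omega, Or.inl h⟩
    · exact h2 ⟨by omega, Or.inl (by omega)⟩
  have hn1 : ∀ μ ν, ∃ a, G (a, μ * a + ν) ≠ 0 := by
    by_contra hcon; push Not at hcon; exact h1 ⟨by omega, Or.inr hcon⟩
  have hn2 : ∀ μ ν, ∃ a, H (a, μ * a + ν) ≠ 0 := by
    by_contra hcon; push Not at hcon; exact h2 ⟨by omega, Or.inr hcon⟩
  obtain ⟨a2, ha2, ha21⟩ : ∃ a2 : F, a2 ≠ 0 ∧ a2 ≠ 1 := by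
    by_contra hcon
    push Not at hcon
    have : (Finset.univ : Finset F) ⊆ {0, 1} := by
      intro x _
      by_cases h : x = 0
      · simp [h]
      · simp [hcon x h]
    have h3 := Finset.card_le_card this
    have h4 := Finset.card_le_two (a := (0 : F)) (b := 1)
    rw [Finset.card_univ] at h3
    omega
  obtain ⟨y1, hy1⟩ := Finset.card_pos.1 (show 0 < (Zs fun y => G (1, y)).card by
    rw [hZ 1 one_ne_zero]; omega)
  obtain ⟨y2, hy2⟩ := Finset.card_pos.1 (show 0 < (Zs fun y => H (a2, y)).card by
    rw [hZH a2 ha2]; omega)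
  have hne : a2 - 1 ≠ 0 := sub_ne_zero.2 ha21
  have c1 := (CNT hD he hZ one_ne_zero (mem_Zs.1 hy1) hn1).2 hq ((y2 - y1) / (a2 - 1))
    (y1 - (y2 - y1) / (a2 - 1)) (by ring)
  have c2 := (CNT hHD (by omega) hZH ha2 (mem_Zs.1 hy2) hn2).2 (by omega) ((y2 - y1) / (a2 - 1))
    (y1 - (y2 - y1) / (a2 - 1)) (by field_simp; ring)
  generalize (y2 - y1) / (a2 - 1) = μ at c1 c2
  generalize y1 - μ = ν at c1 c2
  have hdis : Disjoint ((Zs fun a => G (a, μ * a + ν)).filter (· ≠ 0))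
      ((Zs fun a => H (a, μ * a + ν)).filter (· ≠ 0)) := by
    rw [Finset.disjoint_left]
    intro a h3 h4
    rw [Finset.mem_filter, mem_Zs] at h3 h4
    exact (hH a _ h3.2).1 h4.1 h3.1
  have hc := Finset.card_union_of_disjoint hdis
  have hsub : (((Zs fun a => G (a, μ * a + ν)).filter (· ≠ 0)) ∪
      ((Zs fun a => H (a, μ * a + ν)).filter (· ≠ 0))) ⊆ Finset.univ.erase 0 := by
    intro a ha
    rw [Finset.mem_union, Finset.mem_filter, Finset.mem_filter] at ha
    simp only [Finset.mem_erase, Finset.mem_univ, and_true]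
    tauto
  have := Finset.card_le_card hsub
  rw [Finset.card_erase_of_mem (Finset.mem_univ _), Finset.card_univ] at this
  omega

end plane2

section cl
variable {F : Type} [Field F] [Fintype F]

theorem MW0 {q s n : ℕ} (hq : Fintype.card F = q) (hs : 1 ≤ s) (hs2 : s + 1 ≤ q)
    {V : Type} [AddCommGroup V] [Module F V] [Finite V] {f : V → F}
    (hr : Module.finrank F V = n + 1) (hD : Dg (s + 1) f)
    (hN : NW f = (q - s) * q ^ n) :
    ∃ (ψ : V →ₗ[F] F) (M : Finset F), ψ ≠ 0 ∧ M.card = q - s ∧ ∀ y, f y ≠ 0 ↔ ψ y ∈ M := by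
  classical
  have hD0 : Dg (0 * (q - 1) + s + 1) f := hD.mono (by omega)
  obtain ⟨φ, e, hφ, he, hk⟩ := PSPL (n := n) hq (by omega) (by omega) (by omega) hD0 (by
    rw [hN, ar3 (by omega) (by omega), ← mul_assoc]
    exact Nat.mul_le_mul_right _ (by omega))
  have hrk := finrank_ker_of φ e
  have hD' := Dg_e e hD0
  rw [← NW_e e f] at hN
  have hpos : 0 < (q - s) * q ^ n := Nat.mul_pos (by omega) (pow_pos (by omega) n)
  have hg0 : ∃ y, f (e.symm y) ≠ 0 := by
    by_contra hcon
    push Not at hcon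
    rw [NW_zero_of hcon] at hN
    omega
  set g : F × LinearMap.ker φ → F := fun w => f (e.symm w) with hg
  have hle : (Kz g).card ≤ s := by
    by_contra h
    have := SBt hD' hg0 (by omega)
    omega
  have hks : (Kz g).card = s := by
    rcases n with _ | n
    · have := sl_le g 1 (fun a ha => by
        obtain ⟨w, hw⟩ := Kz_nz ha
        exact NW_pos (f := fun y => g (a, y)) hw)
      rw [hN, hq] at this
      simp only [pow_zero, mul_one] at this
      omega
    · have hsb := SB1 (n := n) hq (by omega) (by omega) hD' hle
      rw [hN] at hsb
      exact ms1 hk hle (by omega) hsb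
  refine ⟨φ, (Kz g)ᶜ, hφ, by rw [Finset.card_compl, hq, hks], fun y => ?_⟩
  have hy : f y = g (φ y, (e y).2) := by
    rw [hg, ← he]; simp
  rw [hy, Finset.mem_compl]
  constructor
  · intro h hm
    exact h (mem_Kz.1 hm _)
  · intro h
    obtain ⟨w, hw⟩ := Kz_nz h
    obtain ⟨c, hc⟩ := (hD'.sliceK (Kz g) (fun c hc => mem_Kz.1 hc) (φ y)).eq_const_of (by omega)
    have h1 := hc w
    have h2 := hc (e y).2
    rw [h2, ← h1]
    exact hw

/-- the planar configuration in general position -/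
def Conf {F : Type} [Field F] {V : Type} [AddCommGroup V] [Module F V] (k : ℕ) (f : V → F) : Prop :=
  ∃ (φ ψ : V →ₗ[F] F) (c e : F) (M : Finset F), M.card = k ∧ (∀ a b, ∃ x, φ x = a ∧ ψ x = b) ∧
    ((∀ x, f x ≠ 0 ↔ φ x ≠ c ∧ ψ x + e ∈ M) ∨
     (∀ x, f x ≠ 0 ↔ φ x ≠ c ∧ ∃ μ ∈ M, ψ x = μ * (φ x - c) + e))

theorem Conf_e {V W : Type} [AddCommGroup V] [Module F V] [AddCommGroup W] [Module F W]
    (e : V ≃ₗ[F] W) {k : ℕ} {f : V → F} (h : Conf k (fun w => f (e.symm w))) : Conf k f := by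
  obtain ⟨φ, ψ, c, d, M, hM, hs, h⟩ := h
  refine ⟨φ ∘ₗ e.toLinearMap, ψ ∘ₗ e.toLinearMap, c, d, M, hM, fun a b => ?_, ?_⟩
  · obtain ⟨x, h1, h2⟩ := hs a b
    exact ⟨e.symm x, by simpa using h1, by simpa using h2⟩
  · rcases h with h | h
    · left; intro x; have := h (e x); simpa using this
    · right; intro x; have := h (e x); simpa using this

theorem Zs_pre {V : Type} [AddCommGroup V] [Module F V] {f : V → F} {ψ : V →ₗ[F] F}
    {M : Finset F} (h : ∀ y, f y ≠ 0 ↔ ψ y ∈ M) (y0 d : V) (hd : ψ d ≠ 0) :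
    (Zs fun l : F => f (l • d + y0)).card = Fintype.card F - M.card := by
  classical
  rw [← Finset.card_compl]
  refine Finset.card_bij (fun l _ => l * ψ d + ψ y0) ?_ ?_ ?_
  · intro l hl
    rw [mem_Zs] at hl
    rw [Finset.mem_compl]
    intro hm
    have := (h (l • d + y0)).2 (by simpa using hm)
    exact this hl
  · intro l _ l' _ hh
    exact mul_right_cancel₀ hd (add_right_cancel hh)
  · intro b hb
    refine ⟨(b - ψ y0) / ψ d, ?_, by field_simp; ring⟩
    rw [mem_Zs]
    by_contra hcon
    have := (h _).1 hcon
    rw [map_add, map_smul, smul_eq_mul, div_mul_cancel₀ _ hd, sub_add_cancel] at this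
    exact (Finset.mem_compl.1 hb) this

theorem CL1 {q s n : ℕ} (hq : Fintype.card F = q) (hs : 3 ≤ s) (hs2 : s + 2 ≤ q)
    {W : Type} [AddCommGroup W] [Module F W] [Finite W] {g : F × W → F}
    (hr : Module.finrank F W = n + 1) (hD : Dg (s + 1) g) (hk : (Kz g).card = 1)
    (hsl : ∀ a, a ∉ Kz g → NW (fun y => g (a, y)) = (q - s + 1) * q ^ n) :
    Conf (q - s + 1) g := by
  classical
  obtain ⟨c, hc⟩ := Finset.card_eq_one.1 hk
  obtain ⟨h, hh, hgh⟩ := hD.factor c (mem_Kz.1 (by rw [hc]; simp))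
  obtain ⟨s, rfl⟩ : ∃ s', s = s' + 1 := ⟨s - 1, by omega⟩
  rw [Nat.add_sub_cancel] at hh
  have hgn : ∀ a y, a ≠ c → (g (a, y) ≠ 0 ↔ h (a, y) ≠ 0) := by
    intro a y ha
    rw [hgh]
    simp [sub_ne_zero.2 ha]
  have hmw : ∀ a, ∃ (ψ : W →ₗ[F] F) (M : Finset F), a ≠ c → (ψ ≠ 0 ∧ M.card = q - s ∧
      ∀ y, h (a, y) ≠ 0 ↔ ψ y ∈ M) := by
    intro a
    by_cases ha : a = c
    · exact ⟨0, ∅, fun h => absurd ha h⟩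
    · have h1 := hsl a (by rw [hc]; simpa using ha)
      rw [NW_congr (fun y => hgn a y ha), show q - (s + 1) + 1 = q - s by omega] at h1
      obtain ⟨ψ, M, hh⟩ := MW0 hq (by omega) (by omega) hr (hh.slice a) h1
      exact ⟨ψ, M, fun _ => hh⟩
  choose ψ M hψ using hmw
  obtain ⟨b, hb⟩ : ∃ b, b ≠ c := ⟨c + 1, by simp⟩
  have hker : ∀ a, a ≠ c → ∀ d, ψ b d = 0 → ψ a d = 0 := by
    intro a ha d hd
    by_contra hcon
    obtain ⟨z, hz⟩ : ∃ z, z ∉ M b := by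
      by_contra hcon
      push Not at hcon
      have := Finset.eq_univ_of_forall hcon
      have h2 := (hψ b hb).2.1
      rw [this, Finset.card_univ] at h2
      omega
    obtain ⟨y0, hy0⟩ : ∃ y0, ψ b y0 = z := LinearMap.surjective (hψ b hb).1 z
    have hbz : ∀ l : F, h (b, l • d + y0) = 0 := by
      intro l
      by_contra h1
      have := ((hψ b hb).2.2 _).1 h1
      rw [map_add, map_smul, hd, smul_zero, zero_add, hy0] at this
      exact hz this
    have hdf := (hh.diff a b).comp (LinearMap.toSpanSingleton F W d) y0
    simp only [LinearMap.toSpanSingleton_apply, hbz, sub_zero, Nat.add_sub_cancel] at hdf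
    have hcard := Zs_pre (f := fun y => h (a, y)) (hψ a ha).2.2 y0 d hcon
    rw [(hψ a ha).2.1, hq, show q - (q - s) = s by omega] at hcard
    obtain ⟨s, rfl⟩ : ∃ s', s = s' + 1 := ⟨s - 1, by omega⟩
    have := Zs_le hdf (by omega) (by
      by_contra h1
      push Not at h1
      have h2 : (Zs fun l : F => h (a, l • d + y0)) = Finset.univ := by ext l; simp [mem_Zs, h1]
      rw [h2, Finset.card_univ] at hcard
      omega)
    omega
  obtain ⟨d, hd⟩ : ∃ d, ψ b d = 1 := LinearMap.surjective (hψ b hb).1 1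
  have hdep : ∀ a y, a ≠ c → (h (a, y) ≠ 0 ↔ h (a, ψ b y • d) ≠ 0) := by
    intro a y ha
    have := hker a ha (y - ψ b y • d) (by simp [hd])
    rw [map_sub, sub_eq_zero] at this
    rw [(hψ a ha).2.2, (hψ a ha).2.2, this]
  have hda : ∀ a, a ≠ c → ψ a d ≠ 0 := by
    intro a ha h0
    apply (hψ a ha).1
    ext y
    have := hker a ha (y - ψ b y • d) (by simp [hd])
    rw [map_sub, map_smul, h0, smul_zero, sub_zero] at this
    simpa using this
  have hG : Dg (s + 1) (fun x : F × F => h (x.1 + c, x.2 • d)) := by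
    have := hh.comp (LinearMap.prodMap (LinearMap.id : F →ₗ[F] F)
      (LinearMap.toSpanSingleton F W d)) (c, 0)
    simpa using this
  have hT := PL (by omega) hG (by omega) (fun a ha => by
    have hac : a + c ≠ c := by simpa using ha
    have := Zs_pre (f := fun y => h (a + c, y)) (hψ _ hac).2.2 0 d (hda _ hac)
    rw [(hψ _ hac).2.1, hq] at this
    simp only [add_zero] at this
    rw [this]; omega)
  rw [hq, show q - s = q - (s + 1) + 1 by omega] at hT
  have hgG : ∀ a y, g (a, y) ≠ 0 ↔ a ≠ c ∧ h (a - c + c, ψ b y • d) ≠ 0 := by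
    intro a y
    by_cases ha : a = c
    · simp only [ha, ne_eq, not_true_eq_false, false_and, iff_false, not_not]
      rw [hgh]; simp
    · rw [hgn a y ha, hdep a y ha]; simp [ha]
  obtain ⟨N, hN, ⟨μ, h1⟩ | ⟨ν, h1⟩⟩ := hT
  · refine ⟨LinearMap.fst F F W, ψ b ∘ₗ LinearMap.snd F F W - μ • LinearMap.fst F F W, c, μ * c, N, hN,
      fun a z => ⟨(a, (z + μ * a) • d), by simp, by simp [hd]⟩, Or.inl ?_⟩
    rintro ⟨a, y⟩
    rw [hgG]
    refine and_congr_right fun ha => ?_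
    have := h1 (a - c) (ψ b y) (sub_ne_zero.2 ha)
    simp only [] at this
    rw [this]
    simp only [LinearMap.sub_apply, LinearMap.comp_apply, LinearMap.snd_apply, LinearMap.smul_apply,
      LinearMap.fst_apply, smul_eq_mul]
    rw [show ψ b y - μ * (a - c) = ψ b y - μ * a + μ * c by ring]
  · refine ⟨LinearMap.fst F F W, ψ b ∘ₗ LinearMap.snd F F W, c, ν, N, hN,
      fun a z => ⟨(a, z • d), by simp, by simp [hd]⟩, Or.inr ?_⟩
    rintro ⟨a, y⟩
    rw [hgG]
    refine and_congr_right fun ha => ?_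
    exact h1 (a - c) (ψ b y) (sub_ne_zero.2 ha)

theorem CL2 {q s n : ℕ} (hq : Fintype.card F = q) (hs : 2 ≤ s) (hs2 : s + 2 ≤ q)
    {W : Type} [AddCommGroup W] [Module F W] [Finite W] {g : F × W → F}
    (hr : Module.finrank F W = n + 1) (hD : Dg (s + 1) g) (hk : (Kz g).card + 1 = s)
    (hsl : ∀ a, a ∉ Kz g → NW (fun y => g (a, y)) = (q - 1) * q ^ n) :
    Conf (q - s + 1) g := by
  classical
  obtain ⟨h, hh, hgh⟩ := hD.factorK (Kz g) (fun c hc => mem_Kz.1 hc)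
  obtain ⟨l, e, hl⟩ := hh.eq_affine_of (by omega)
  have hp : ∀ a, (∏ c ∈ Kz g, (a - c)) ≠ 0 ↔ a ∈ (Kz g)ᶜ := by
    intro a
    rw [Finset.prod_ne_zero_iff, Finset.mem_compl]
    constructor
    · intro h1 h2; exact h1 a h2 (sub_self a)
    · intro h1 c hc h2; exact h1 (by rw [sub_eq_zero.1 h2]; exact hc)
  have hgl : ∀ a y, g (a, y) ≠ 0 ↔ l (a, y) ≠ -e ∧ a ∈ (Kz g)ᶜ := by
    intro a y
    rw [hgh, hl, mul_ne_zero_iff, hp, and_comm, ne_eq, ne_eq, add_eq_zero_iff_eq_neg]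
  obtain ⟨a, ha⟩ : ∃ a, a ∉ Kz g := by
    by_contra hcon
    push Not at hcon
    have := Finset.eq_univ_of_forall hcon
    have h4 := Finset.card_univ (α := F)
    rw [← this] at h4
    omega
  obtain ⟨d, hd⟩ : ∃ d, l (0, d) ≠ 0 := by
    by_contra hcon
    push Not at hcon
    have hla : ∀ y, l (a, y) = l (a, 0) := by
      intro y
      have : ((a, y) : F × W) = (a, 0) + (0, y) := by simp
      rw [this, map_add, hcon, add_zero]
    obtain ⟨y, hy⟩ := Kz_nz ha
    have hne := ((hgl a y).1 hy).1
    rw [hla] at hne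
    have := NW_const hq (f := fun y => g (a, y)) (fun z =>
      (hgl a z).2 ⟨by rw [hla]; exact hne, Finset.mem_compl.2 ha⟩)
    rw [hsl a ha, hr, pow_succ'] at this
    have := Nat.eq_of_mul_eq_mul_right (pow_pos (by omega) n) this
    omega
  refine ⟨l, LinearMap.fst F F W, -e, 0, (Kz g)ᶜ, by rw [Finset.card_compl, hq]; omega,
    fun x z => ?_, Or.inl ?_⟩
  · refine ⟨(z, ((x - l (z, 0)) / l (0, d)) • d), ?_, rfl⟩
    have : ((z, ((x - l (z, 0)) / l (0, d)) • d) : F × W) =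
      (z, 0) + ((x - l (z, 0)) / l (0, d)) • (0, d) := by simp
    rw [this, map_add, map_smul, smul_eq_mul, div_mul_cancel₀ _ hd]; ring
  · rintro ⟨b, y⟩
    rw [hgl]; simp

theorem CL0 {q s n : ℕ} (hq : Fintype.card F = q) (hs : 2 ≤ s) (hs2 : s + 2 ≤ q)
    {V : Type} [AddCommGroup V] [Module F V] [Finite V] {f : V → F}
    (hr : Module.finrank F V = n + 2) (hD : Dg (s + 1) f)
    (hN : NW f = (q - s + 1) * (q - 1) * q ^ n) : Conf (q - s + 1) f := by
  have hD0 : Dg (0 * (q - 1) + s + 1) f := hD.mono (by omega)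
  obtain ⟨φ, e, hφ, he, hk⟩ := PSPL (n := n + 1) hq (by omega) (by omega) (by omega) hD0 (by
    rw [hN, pow_succ']; exact (Nat.mul_left_comm _ _ _).le)
  have hrk := finrank_ker_of φ e
  rw [← NW_e e f] at hN
  have hD' := Dg_e e hD0
  apply Conf_e e
  have hg0 : ∃ y, f (e.symm y) ≠ 0 := by
    by_contra hcon
    push Not at hcon
    rw [NW_zero_of hcon] at hN
    have : 0 < (q - s + 1) * (q - 1) * q ^ n :=
      Nat.mul_pos (Nat.mul_pos (by omega) (by omega)) (pow_pos (by omega) n)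
    omega
  rcases CASES (n := n) hq hs hs2 (by omega) hD' hN hk with h | ⟨h1, h2, h3⟩
  · have := SBt hD' hg0 (by omega)
    omega
  by_cases h4 : (Kz fun w => f (e.symm w)).card + 1 = s
  · rw [show q - s + (Kz fun w => f (e.symm w)).card = q - 1 by omega] at h3
    exact CL2 hq hs hs2 (by omega) (hD'.mono (by omega)) h4 h3
  · have h5 := h2.resolve_right h4
    rw [h5] at h3
    exact CL1 hq (by omega) hs2 (by omega) (hD'.mono (by omega)) h5 h3

end cl

section asm
variable {F : Type} [Field F] [Fintype F]

theorem Dg_mon {m : ℕ} (d : Fin m →₀ ℕ) (u : Finset (Fin m)) :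
    Dg (∑ i ∈ u, d i + 1) (fun x : Fin m → F => ∏ i ∈ u, x i ^ d i) := by
  classical
  induction u using Finset.induction_on with
  | empty => simpa using Dg.const (V := Fin m → F) 0 (1 : F)
  | insert a u ha ih =>
    have h := (Dg.pow (LinearMap.proj a : (Fin m → F) →ₗ[F] F) (d a)).prod ih
    simp only [Finset.sum_insert ha, Finset.prod_insert ha]
    exact h.mono (by omega)

theorem Dg_poly {m r : ℕ} {f : (Fin m → F) → F} (P : MvPolynomial (Fin m) F)
    (hP : P.totalDegree ≤ r) (h : ∀ x, MvPolynomial.eval x P = f x) : Dg (r + 1) f := by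
  have h1 : f = fun x => ∑ d ∈ P.support, P.coeff d * ∏ i ∈ d.support, x i ^ d i := by
    funext x
    rw [← h x, MvPolynomial.eval_eq]
  rw [h1]
  apply Dg.sum (f := fun (d : Fin m →₀ ℕ) (x : Fin m → F) =>
    P.coeff d * ∏ i ∈ d.support, x i ^ d i)
  intro d hd
  apply Dg.smul
  have h2 := MvPolynomial.le_totalDegree hd
  exact (Dg_mon d d.support).mono (by
    have : (d.sum fun _ e => e) = ∑ i ∈ d.support, d i := rfl
    omega)

variable {V : Type} [AddCommGroup V] [Module F V] [Finite V]

theorem AScard (A : AffineSubspace F V) (hA : (A : Set V).Nonempty) :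
    (A : Set V).ncard = Fintype.card F ^ Module.finrank F A.direction := by
  obtain ⟨p, hp⟩ := hA
  have h : (A : Set V) = (fun v => v + p) '' (A.direction : Set V) := by
    ext x
    constructor
    · intro hx
      exact ⟨x - p, AffineSubspace.vsub_mem_direction hx hp, by simp⟩
    · rintro ⟨v, hv, rfl⟩
      exact AffineSubspace.vadd_mem_of_mem_direction hv hp
  rw [h, Set.ncard_image_of_injective _ (add_left_injective p)]
  have h2 := Module.natCard_eq_pow_finrank (K := F) (V := A.direction)
  rw [Nat.card_eq_fintype_card (α := F)] at h2
  rw [← h2]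
  rfl

theorem UC {k : ℕ} (L : Finset (AffineSubspace F V)) (B : Set V)
    (hk : ∀ W ∈ L, ((W : Set V) \ B).ncard = k)
    (hd : ∀ W1 ∈ L, ∀ W2 ∈ L, ∀ x, x ∈ W1 → x ∈ W2 → x ∉ B → W1 = W2) :
    ((⋃ W ∈ L, (W : Set V)) \ B).ncard = L.card * k := by
  classical
  have := Fintype.ofFinite V
  have h : ((⋃ W ∈ L, (W : Set V)) \ B) =
      ((L.biUnion fun W => ((W : Set V) \ B).toFinset : Finset V) : Set V) := by
    ext x
    simp
    grind
  rw [h, Set.ncard_coe_finset, Finset.card_biUnion]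
  · rw [Finset.sum_const_nat]
    intro W hW
    rw [← hk W hW, Set.ncard_eq_toFinset_card']
  · intro W1 h1 W2 h2 hne
    change Disjoint _ _
    rw [Finset.disjoint_left]
    intro x hx hx2
    simp only [Set.mem_toFinset, Set.mem_diff, SetLike.mem_coe] at hx hx2
    exact hne (hd W1 h1 W2 h2 x hx.1 hx2.1 hx.2)

theorem card_sub {n q : ℕ} (W B : AffineSubspace F V) (hq : Fintype.card F = q)
    (hW : (W : Set V).Nonempty) (hw : Module.finrank F W.direction = n + 1)
    (hB : ((W ⊓ B : AffineSubspace F V) : Set V).Nonempty)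
    (hb : Module.finrank F (W ⊓ B : AffineSubspace F V).direction = n) :
    ((W : Set V) \ (B : Set V)).ncard = (q - 1) * q ^ n := by
  have h1 := AScard W hW
  have h2 := AScard _ hB
  have h3 := Set.ncard_sdiff_add_ncard_of_subset
    (s := ((W ⊓ B : AffineSubspace F V) : Set V)) (t := (W : Set V)) (fun x hx => hx.1)
  have h4 : (W : Set V) \ ((W ⊓ B : AffineSubspace F V) : Set V) = (W : Set V) \ (B : Set V) := by
    ext x
    simp [AffineSubspace.mem_inf_iff]
    tauto
  rw [h4, h1, h2, hw, hb, hq] at h3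
  have h5 : (q - 1) * q ^ n + q ^ n = q ^ (n + 1) := by
    have : 1 ≤ q := hq ▸ Fintype.card_pos
    obtain ⟨k, rfl⟩ : ∃ k, q = k + 1 := ⟨q - 1, by omega⟩
    simp only [Nat.add_sub_cancel]
    ring
  omega

theorem backA {n q : ℕ} (hq : Fintype.card F = q) (G : AffineSubspace F V)
    (hG : Module.finrank F G.direction = n + 2)
    (L : Finset (AffineSubspace F V))
    (hL : ∀ W ∈ L, W ≤ G ∧ (W : Set V).Nonempty ∧ Module.finrank F W.direction = n + 1)
    (hp : ∀ W1 ∈ L, ∀ W2 ∈ L, W1.direction = W2.direction)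
    (W' : AffineSubspace F V) (h1 : W' ≤ G) (h2 : (W' : Set V).Nonempty)
    (h3 : Module.finrank F W'.direction = n + 1)
    (h4 : ∀ W ∈ L, W.direction ≠ W'.direction) :
    ((⋃ W ∈ L, (W : Set V)) \ (W' : Set V)).ncard = L.card * ((q - 1) * q ^ n) := by
  apply UC
  · intro W hW
    obtain ⟨a1, a2, a3⟩ := hL W hW
    have d1 := AffineSubspace.direction_le a1
    have d2 := AffineSubspace.direction_le h1
    have hsum := Submodule.finrank_sup_add_finrank_inf_eq W.direction W'.direction
    have hsle : W.direction ⊔ W'.direction ≤ G.direction := sup_le d1 d2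
    have hf1 := Submodule.finrank_mono hsle
    have hne : ¬ (Module.finrank F ↥(W.direction ⊔ W'.direction) ≤ n + 1) := by
      intro hle
      have e1 := Submodule.eq_of_le_of_finrank_le (le_sup_left : W.direction ≤ W.direction ⊔ W'.direction) (by omega)
      have e2 := Submodule.eq_of_le_of_finrank_le (le_sup_right : W'.direction ≤ W.direction ⊔ W'.direction) (by omega)
      exact h4 W hW (e1.trans e2.symm)
    have hGs := Submodule.eq_of_le_of_finrank_le hsle (by omega)
    obtain ⟨p, hp1⟩ := a2
    obtain ⟨p', hp2⟩ := h2
    have hv : p' -ᵥ p ∈ G.direction := AffineSubspace.vsub_mem_direction (h1 hp2) (a1 hp1)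
    rw [← hGs, Submodule.mem_sup] at hv
    obtain ⟨y, hy, z, hz, hyz⟩ := hv
    have m1 : y + p ∈ W := AffineSubspace.vadd_mem_of_mem_direction hy hp1
    have m2 : y + p ∈ W' := by
      have := AffineSubspace.vadd_mem_of_mem_direction (neg_mem hz) hp2
      have e : (-z) +ᵥ p' = y + p := by
        rw [vadd_eq_add]
        rw [vsub_eq_sub] at hyz
        rw [sub_eq_iff_eq_add.mp hyz.symm]
        abel
      rwa [e] at this
    refine card_sub W W' hq ⟨p, hp1⟩ a3 ⟨y + p, m1, m2⟩ ?_
    rw [AffineSubspace.direction_inf_of_mem m1 m2]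
    omega
  · intro W1 k1 W2 k2 x hx1 hx2 _
    exact AffineSubspace.ext_of_direction_eq (hp _ k1 _ k2) ⟨x, hx1, hx2⟩

theorem backB {n q : ℕ} (hq : Fintype.card F = q)
    (L : Finset (AffineSubspace F V))
    (hL : ∀ W ∈ L, (W : Set V).Nonempty ∧ Module.finrank F W.direction = n + 1)
    (A : AffineSubspace F V) (h2 : (A : Set V).Nonempty)
    (h3 : Module.finrank F A.direction = n) (h4 : ∀ W ∈ L, A ≤ W) :
    ((⋃ W ∈ L, (W : Set V)) \ (A : Set V)).ncard = L.card * ((q - 1) * q ^ n) := by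
  apply UC
  · intro W hW
    obtain ⟨a2, a3⟩ := hL W hW
    have e : W ⊓ A = A := inf_eq_right.mpr (h4 W hW)
    exact card_sub W A hq a2 a3 (by rw [e]; exact h2) (by rw [e]; exact h3)
  · intro W1 k1 W2 k2 x hx1 hx2 hx
    obtain ⟨p, hp⟩ := h2
    have b1 := h4 W1 k1 hp
    have b2 := h4 W2 k2 hp
    have hle : A.direction ≤ W1.direction ⊓ W2.direction :=
      le_inf (AffineSubspace.direction_le (h4 W1 k1)) (AffineSubspace.direction_le (h4 W2 k2))
    have hlt : A.direction < W1.direction ⊓ W2.direction := by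
      refine lt_of_le_of_ne hle ?_
      intro he
      apply hx
      have : x -ᵥ p ∈ W1.direction ⊓ W2.direction :=
        ⟨AffineSubspace.vsub_mem_direction hx1 b1, AffineSubspace.vsub_mem_direction hx2 b2⟩
      rw [← he] at this
      exact (AffineSubspace.vsub_right_mem_direction_iff_mem hp x).mp this
    have hr := Submodule.finrank_lt_finrank_of_lt hlt
    have e1 := Submodule.eq_of_le_of_finrank_le
      (inf_le_left : W1.direction ⊓ W2.direction ≤ W1.direction) (by have := (hL W1 k1).2; omega)
    have e2 := Submodule.eq_of_le_of_finrank_le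
      (inf_le_right : W1.direction ⊓ W2.direction ≤ W2.direction) (by have := (hL W2 k2).2; omega)
    exact AffineSubspace.ext_of_direction_eq (e1.symm.trans e2) ⟨x, hx1, hx2⟩

theorem ASex (E : Submodule F V) (p : V) {X : Type} [AddCommGroup X] [Module F X]
    (χ : E →ₗ[F] X) (hχ : Function.Surjective χ) (b : X) :
    ∃ A : AffineSubspace F V, A ≤ AffineSubspace.mk' p E ∧ (A : Set V).Nonempty ∧
      A.direction = (LinearMap.ker χ).map E.subtype ∧
      Module.finrank F A.direction + Module.finrank F X = Module.finrank F E ∧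
      ∀ x, x ∈ A ↔ ∃ w : E, x = w + p ∧ χ w = b := by
  obtain ⟨w0, hw0⟩ := hχ b
  have hmem : ∀ x, x ∈ AffineSubspace.mk' ((w0 : V) + p) ((LinearMap.ker χ).map E.subtype) ↔
      ∃ w : E, x = w + p ∧ χ w = b := by
    intro x
    rw [AffineSubspace.mem_mk', Submodule.mem_map]
    constructor
    · rintro ⟨v, hv, hvx⟩
      refine ⟨v + w0, ?_, ?_⟩
      · simp only [Submodule.subtype_apply, vsub_eq_sub] at hvx
        rw [Submodule.coe_add, hvx]
        abel
      · rw [map_add, LinearMap.mem_ker.mp hv, hw0, zero_add]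
    · rintro ⟨w, rfl, hw⟩
      refine ⟨w - w0, ?_, ?_⟩
      · rw [LinearMap.mem_ker, map_sub, hw, hw0, sub_self]
      · simp
  refine ⟨AffineSubspace.mk' ((w0 : V) + p) ((LinearMap.ker χ).map E.subtype), ?_,
    AffineSubspace.mk'_nonempty _ _, AffineSubspace.direction_mk' _ _, ?_, hmem⟩
  · intro x hx
    obtain ⟨w, rfl, hw⟩ := (hmem x).mp hx
    simp [AffineSubspace.mem_mk']
  · rw [AffineSubspace.direction_mk', Submodule.finrank_map_subtype_eq]
    have := LinearMap.finrank_range_add_finrank_ker χ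
    rw [LinearMap.range_eq_top.mpr hχ, finrank_top] at this
    omega

end asm

section fwd
variable {F : Type} [Field F] [Fintype F] [DecidableEq F]
variable {V : Type} [AddCommGroup V] [Module F V] [Finite V]

theorem fwdlem {k n : ℕ} (f : V → F) (E : Submodule F V) (p : V)
    (hE : Module.finrank F E = n + 2) (hsup : ∀ x, f x ≠ 0 → x - p ∈ E)
    (hc : Conf k (fun w : E => f (w + p))) :
    ∃ G : AffineSubspace F V,
      (G : Set V).Nonempty ∧ Module.finrank F G.direction = n + 2 ∧
      {x : V | f x ≠ 0} ⊆ (G : Set V) ∧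
      ((∃ L : Finset (AffineSubspace F V),
          L.card = k ∧
          (∀ W ∈ L, W ≤ G ∧ (W : Set V).Nonempty ∧
            Module.finrank F W.direction = n + 1) ∧
          (∀ W1 ∈ L, ∀ W2 ∈ L,
            AffineSubspace.direction W1 = AffineSubspace.direction W2) ∧
          ∃ W' : AffineSubspace F V,
            W' ≤ G ∧ (W' : Set V).Nonempty ∧
            Module.finrank F W'.direction = n + 1 ∧
            (∀ W ∈ L, AffineSubspace.direction W ≠ AffineSubspace.direction W') ∧
            {x : V | f x ≠ 0} =
              (⋃ W ∈ L, (W : Set V)) \ (W' : Set V)) ∨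
       (∃ L : Finset (AffineSubspace F V),
          L.card = k ∧
          (∀ W ∈ L, W ≤ G ∧ (W : Set V).Nonempty ∧
            Module.finrank F W.direction = n + 1) ∧
          ∃ A : AffineSubspace F V,
            (A : Set V).Nonempty ∧
            Module.finrank F A.direction = n ∧
            (∀ W ∈ L, A ≤ W) ∧
            {x : V | f x ≠ 0} =
              (⋃ W ∈ L, (W : Set V)) \ (A : Set V))) := by
  classical
  obtain ⟨φ, ψ, c, e, M, hM, hs, hc⟩ := hc
  have hinj : ∀ w w' : E, (w : V) + p = w' + p → w = w' := fun w w' h =>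
    Subtype.ext (add_right_cancel h)
  have hx : ∀ x, f x ≠ 0 → ∃ w : E, x = w + p := fun x h => ⟨⟨x - p, hsup x h⟩, by simp⟩
  refine ⟨AffineSubspace.mk' p E, AffineSubspace.mk'_nonempty _ _,
    by rw [AffineSubspace.direction_mk', hE], ?_, ?_⟩
  · intro x h
    exact (AffineSubspace.mem_mk').mpr (hsup x h)
  have hφ : Function.Surjective φ := fun a => by
    obtain ⟨x, h, _⟩ := hs a 0
    exact ⟨x, h⟩
  have hψ : Function.Surjective ψ := fun a => by
    obtain ⟨x, _, h⟩ := hs 0 a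
    exact ⟨x, h⟩
  rcases hc with hc | hc
  · left
    obtain ⟨W', w1, w2, w3, w4, w5⟩ := ASex E p φ hφ c
    choose AS a1 a2 a3 a4 a5 using fun b : F => ASex E p ψ hψ b
    rw [Module.finrank_self] at w4
    refine ⟨M.image fun μ => AS (μ - e), ?_, ?_, ?_, W', w1, w2, by omega, ?_, ?_⟩
    · rw [Finset.card_image_of_injective, hM]
      intro μ μ' h
      obtain ⟨w, hw⟩ := hψ (μ - e)
      have h1 : (w : V) + p ∈ AS (μ - e) := (a5 _ _).mpr ⟨w, rfl, hw⟩
      have h : AS (μ - e) = AS (μ' - e) := h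
      rw [h] at h1
      obtain ⟨w', h2, h3⟩ := (a5 _ _).mp h1
      rw [← hinj _ _ h2, hw] at h3
      exact sub_left_injective h3
    · intro W hW
      obtain ⟨μ, _, rfl⟩ := Finset.mem_image.mp hW
      have := a4 (μ - e)
      rw [Module.finrank_self] at this
      exact ⟨a1 _, a2 _, by omega⟩
    · intro W1 h1 W2 h2
      obtain ⟨μ, _, rfl⟩ := Finset.mem_image.mp h1
      obtain ⟨μ', _, rfl⟩ := Finset.mem_image.mp h2
      rw [a3, a3]
    · intro W hW
      obtain ⟨μ, _, rfl⟩ := Finset.mem_image.mp hW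
      rw [a3, w3]
      intro h
      obtain ⟨x, hx1, hx2⟩ := hs 1 0
      have h1 : (x : V) ∈ (LinearMap.ker ψ).map E.subtype := ⟨x, hx2, rfl⟩
      rw [h] at h1
      obtain ⟨y, hy, hyx⟩ := h1
      have : y = x := Subtype.ext hyx
      rw [this] at hy
      have hy : φ x = 0 := hy
      rw [hx1] at hy
      exact one_ne_zero hy
    · ext x
      simp only [Set.mem_setOf_eq, Set.mem_diff, Set.mem_iUnion, SetLike.mem_coe, w5]
      constructor
      · intro h
        obtain ⟨w, rfl⟩ := hx x h
        obtain ⟨h1, h2⟩ := (hc w).mp h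
        refine ⟨⟨AS (ψ w + e - e), Finset.mem_image.mpr ⟨_, h2, rfl⟩,
          (a5 _ _).mpr ⟨w, rfl, by ring⟩⟩, ?_⟩
        rintro ⟨w', hw, hw'⟩
        rw [← hinj _ _ hw] at hw'
        exact h1 hw'
      · rintro ⟨⟨W, hW, hxW⟩, h2⟩
        obtain ⟨μ, hμ, rfl⟩ := Finset.mem_image.mp hW
        obtain ⟨w, rfl, hw⟩ := (a5 _ _).mp hxW
        refine (hc w).mpr ⟨fun h => h2 ⟨w, rfl, h⟩, ?_⟩
        rw [hw, sub_add_cancel]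
        exact hμ
  · right
    have hP : Function.Surjective (φ.prod ψ) := fun a => by
      obtain ⟨x, h1, h2⟩ := hs a.1 a.2
      exact ⟨x, Prod.ext h1 h2⟩
    have hχ : ∀ μ : F, Function.Surjective (ψ - μ • φ) := fun μ a => by
      obtain ⟨x, h1, h2⟩ := hs 0 a
      exact ⟨x, by simp [h1, h2]⟩
    obtain ⟨A, w1, w2, w3, w4, w5⟩ := ASex E p (φ.prod ψ) hP (c, e)
    choose AS a1 a2 a3 a4 a5 using fun μ : F => ASex E p (ψ - μ • φ) (hχ μ) (e - μ * c)
    rw [Module.finrank_prod, Module.finrank_self] at w4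
    replace w5 : ∀ x, x ∈ A ↔ ∃ w : E, x = w + p ∧ φ w = c ∧ ψ w = e := by
      intro x
      rw [w5]
      constructor
      · rintro ⟨w, h1, h2⟩
        exact ⟨w, h1, congrArg Prod.fst h2, congrArg Prod.snd h2⟩
      · rintro ⟨w, h1, h2, h3⟩
        exact ⟨w, h1, Prod.ext h2 h3⟩
    simp only [LinearMap.sub_apply, LinearMap.smul_apply, smul_eq_mul] at a5
    refine ⟨M.image AS, ?_, ?_, A, w2, by omega, ?_, ?_⟩
    · rw [Finset.card_image_of_injective, hM]
      intro μ μ' h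
      obtain ⟨w, hw1, hw2⟩ := hs (c + 1) (μ + e)
      have h1 : (w : V) + p ∈ AS μ := (a5 _ _).mpr ⟨w, rfl, by rw [hw1, hw2]; ring⟩
      rw [h] at h1
      obtain ⟨w', h2, h3⟩ := (a5 _ _).mp h1
      rw [← hinj _ _ h2, hw1, hw2] at h3
      linear_combination h3
    · intro W hW
      obtain ⟨μ, _, rfl⟩ := Finset.mem_image.mp hW
      have := a4 μ
      rw [Module.finrank_self] at this
      exact ⟨a1 _, a2 _, by omega⟩
    · intro W hW x hxA
      obtain ⟨μ, _, rfl⟩ := Finset.mem_image.mp hW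
      obtain ⟨w, rfl, h1, h2⟩ := (w5 x).mp hxA
      exact (a5 _ _).mpr ⟨w, rfl, by rw [h1, h2]⟩
    · ext x
      simp only [Set.mem_setOf_eq, Set.mem_diff, Set.mem_iUnion, SetLike.mem_coe, w5]
      constructor
      · intro h
        obtain ⟨w, rfl⟩ := hx x h
        obtain ⟨h1, μ, hμ, h2⟩ := (hc w).mp h
        refine ⟨⟨AS μ, Finset.mem_image.mpr ⟨_, hμ, rfl⟩,
          (a5 _ _).mpr ⟨w, rfl, by rw [h2]; ring⟩⟩, ?_⟩
        rintro ⟨w', hw, hw', _⟩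
        rw [← hinj _ _ hw] at hw'
        exact h1 hw'
      · rintro ⟨⟨W, hW, hxW⟩, h2⟩
        obtain ⟨μ, hμ, rfl⟩ := Finset.mem_image.mp hW
        obtain ⟨w, rfl, hw⟩ := (a5 _ _).mp hxW
        refine (hc w).mpr ⟨fun h => h2 ⟨w, rfl, h, ?_⟩, μ, hμ, by linear_combination hw⟩
        rw [h] at hw
        linear_combination hw

end fwd

/-- Characterization of second weight codewords of `R_q(t(q-1)+s, m)`, `0 ≤ t ≤ m-2`,
`2 ≤ s ≤ q-2`: the support lies in an affine subspace `G` of codimension `t` and is either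
(A) the union of `q-s+1` parallel affine subspaces of codimension `t+1` minus their
intersection with a non-parallel subspace of codimension `t+1`, or (B) the union of
`q-s+1` subspaces of codimension `t+1` through a common subspace of codimension `t+2`,
minus that intersection. -/
theorem stmt13 {F : Type} [Field F] [Fintype F] [DecidableEq F] {m t s : ℕ}
    (hq : 4 ≤ Fintype.card F) (hm : 2 ≤ m) (ht : t ≤ m - 2)
    (hs1 : 2 ≤ s) (hs2 : s ≤ Fintype.card F - 2)
    (f : (Fin m → F) → F) (hf : RM F (t * (Fintype.card F - 1) + s) m f) :
    wt f = (Fintype.card F - s + 1) * (Fintype.card F - 1) *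
        Fintype.card F ^ (m - t - 2) ↔
    ∃ G : AffineSubspace F (Fin m → F),
      (G : Set (Fin m → F)).Nonempty ∧ Module.finrank F G.direction = m - t ∧
      {x : Fin m → F | f x ≠ 0} ⊆ (G : Set (Fin m → F)) ∧
      ((∃ L : Finset (AffineSubspace F (Fin m → F)),
          L.card = Fintype.card F - s + 1 ∧
          (∀ W ∈ L, W ≤ G ∧ (W : Set (Fin m → F)).Nonempty ∧
            Module.finrank F W.direction = m - (t + 1)) ∧
          (∀ W1 ∈ L, ∀ W2 ∈ L,
            AffineSubspace.direction W1 = AffineSubspace.direction W2) ∧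
          ∃ W' : AffineSubspace F (Fin m → F),
            W' ≤ G ∧ (W' : Set (Fin m → F)).Nonempty ∧
            Module.finrank F W'.direction = m - (t + 1) ∧
            (∀ W ∈ L, AffineSubspace.direction W ≠ AffineSubspace.direction W') ∧
            {x : Fin m → F | f x ≠ 0} =
              (⋃ W ∈ L, (W : Set (Fin m → F))) \ (W' : Set (Fin m → F))) ∨
       (∃ L : Finset (AffineSubspace F (Fin m → F)),
          L.card = Fintype.card F - s + 1 ∧
          (∀ W ∈ L, W ≤ G ∧ (W : Set (Fin m → F)).Nonempty ∧
            Module.finrank F W.direction = m - (t + 1)) ∧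
          ∃ A : AffineSubspace F (Fin m → F),
            (A : Set (Fin m → F)).Nonempty ∧
            Module.finrank F A.direction = m - (t + 2) ∧
            (∀ W ∈ L, A ≤ W) ∧
            {x : Fin m → F | f x ≠ 0} =
              (⋃ W ∈ L, (W : Set (Fin m → F))) \ (A : Set (Fin m → F)))) := by
  classical
  obtain ⟨n, rfl⟩ : ∃ n, m = t + n + 2 := ⟨m - t - 2, by omega⟩
  have e1 : t + n + 2 - t - 2 = n := by omega
  have e2 : t + n + 2 - t = n + 2 := by omega
  have e3 : t + n + 2 - (t + 1) = n + 1 := by omega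
  have e4 : t + n + 2 - (t + 2) = n := by omega
  rw [e1, e2, e3, e4]
  have hw : wt f = NW f := by
    rw [wt, NW, Set.ncard_eq_toFinset_card', Set.toFinset_ofPred]
  obtain ⟨P, hP1, hP2⟩ := hf
  have hD := Dg_poly P hP1 hP2
  rw [hw]
  constructor
  · intro hN
    obtain ⟨E, p, hE, hsup, hDE⟩ := RED (q := Fintype.card F) (s := s) (n := n) rfl hs1
      (by omega) t (Fin (t + n + 2) → F) f (Module.finrank_fin_fun F) hD hN
    refine fwdlem f E p hE hsup (CL0 rfl hs1 (by omega) hE hDE ?_)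
    rw [← hN]
    unfold NW
    rw [← Set.ncard_image_of_injective (f := fun w : E => (w : Fin (t + n + 2) → F) + p)]
    · congr 1
      ext x
      constructor
      · rintro ⟨w, h, rfl⟩
        exact h
      · intro h
        refine ⟨⟨x - p, hsup x h⟩, ?_, sub_add_cancel x p⟩
        simpa using h
    · intro a b h
      exact Subtype.ext (add_right_cancel h)
  · rintro ⟨G, _, hG, _, h | h⟩
    · obtain ⟨L, hL, h1, h2, W', h3, h4, h5, h6, h7⟩ := h
      rw [NW, h7, backA rfl G hG L h1 h2 W' h3 h4 h5 h6, hL, mul_assoc]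
    · obtain ⟨L, hL, h1, A, h3, h4, h5, h6⟩ := h
      rw [NW, h6, backB rfl L (fun W hW => (h1 W hW).2) A h3 h4 h5, hL, mul_assoc]
end

section
/- Let $q\geq3$, $m\geq2$, and $f\in R_q((m-1)(q-1),m)$ with $|f|=2(q-1)$. Then the support of $f$ is contained in an affine plane (a 2-dimensional affine subspace) of $\mathbb{F}_q^m$. -/
open Finset in
/-- `f` is orthogonal to all products of `e` affine functions. -/
def Orth {F : Type} [Field F] [Fintype F] {m : ℕ} : ℕ → ((Fin m → F) → F) → Prop
  | 0, f => ∑ x, f x = 0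
  | e + 1, f => ∀ (φ : (Fin m → F) →ₗ[F] F) (c : F), Orth e (fun x => f x * (φ x + c))

section aux
variable {F : Type} [Field F] [Fintype F] [DecidableEq F] {m : ℕ}

def spt (f : (Fin m → F) → F) : Finset (Fin m → F) := Finset.univ.filter fun x => f x ≠ 0

lemma orth_of_poly (e : ℕ) : ∀ (P : MvPolynomial (Fin m) F),
    P.totalDegree + e < (Fintype.card F - 1) * m → Orth e (fun x => MvPolynomial.eval x P) := by
  induction e with
  | zero =>
    intro P hP
    exact MvPolynomial.sum_eval_eq_zero P (by simpa using hP)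
  | succ e ih =>
    intro P hP φ c
    let Q : MvPolynomial (Fin m) F :=
      ∑ i, MvPolynomial.C (φ (Pi.single i 1)) * MvPolynomial.X i + MvPolynomial.C c
    have hQ : ∀ x, MvPolynomial.eval x Q = φ x + c := by
      intro x
      have h2 : φ x = ∑ i, x i * φ (Pi.single i 1) := by
        conv_lhs => rw [LinearMap.pi_apply_eq_sum_univ φ x]
        refine Finset.sum_congr rfl fun i _ => ?_
        rw [smul_eq_mul]
        congr 2
        ext j
        simp [Pi.single_apply, eq_comm]
      simp only [Q, map_add, map_sum, map_mul, MvPolynomial.eval_C, MvPolynomial.eval_X]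
      rw [h2]
      simp [mul_comm]
    have hd : Q.totalDegree ≤ 1 := by
      refine (MvPolynomial.totalDegree_add _ _).trans (max_le ?_ (by simp))
      refine (MvPolynomial.totalDegree_finsetSum _ _).trans (Finset.sup_le fun i _ => ?_)
      refine (MvPolynomial.totalDegree_mul _ _).trans ?_
      simp
    have h3 := ih (P * Q) (by
      have := MvPolynomial.totalDegree_mul P Q
      omega)
    simpa [hQ] using h3

lemma sep (W : Submodule F (Fin m → F)) (p y : Fin m → F) (hy : y - p ∉ W) :
    ∃ (φ : (Fin m → F) →ₗ[F] F) (c : F), (∀ x, x - p ∈ W → φ x + c = 0) ∧ φ y + c ≠ 0 := by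
  obtain ⟨φ, h1, h2⟩ := Submodule.exists_le_ker_of_notMem hy
  refine ⟨φ, - φ p, fun x hx => ?_, ?_⟩
  · have := h2 hx
    rw [LinearMap.mem_ker, map_sub] at this
    rw [← sub_eq_add_neg]; exact this
  · rw [map_sub] at h1
    rwa [← sub_eq_add_neg]

lemma spt_mul (f : (Fin m → F) → F) (l : (Fin m → F) → F) :
    spt (fun x => f x * l x) = (spt f).filter fun x => l x ≠ 0 := by
  ext x; simp [spt]

lemma orthA (e : ℕ) : ∀ (f : (Fin m → F) → F) (y), Orth e f → f y ≠ 0 → e + 2 ≤ (spt f).card := by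
  induction e with
  | zero =>
    intro f y h hy
    by_contra hc
    have hy' : y ∈ spt f := by simp [spt, hy]
    have h1 : ∀ x, x ≠ y → f x = 0 := by
      intro x hx
      by_contra hfx
      have : 1 < (spt f).card := Finset.one_lt_card.2 ⟨x, by simp [spt, hfx], y, hy', hx⟩
      omega
    have h2 : ∑ x, f x = f y := Finset.sum_eq_single y (fun x _ hx => h1 x hx) (by simp)
    exact hy (h2.symm.trans h)
  | succ e ih =>
    intro f y h hy
    have h1 : Orth e f := by simpa using h 0 1
    have h2 := ih f y h1 hy
    obtain ⟨z, hz, hzy⟩ := Finset.exists_mem_ne (show 1 < (spt f).card by omega) y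
    obtain ⟨φ, c, h3, h4⟩ := sep (⊥ : Submodule F (Fin m → F)) z y (by
      simp [sub_eq_zero, hzy.symm])
    have h5 := ih _ y (h φ c) (mul_ne_zero hy h4)
    rw [spt_mul f (fun x => φ x + c)] at h5
    have h6 : ((spt f).filter fun x => φ x + c ≠ 0) ⊂ spt f := by
      rw [Finset.filter_ssubset]
      exact ⟨z, hz, by simp [h3 z (by simp)]⟩
    have := Finset.card_lt_card h6
    omega

lemma split_card (f : (Fin m → F) → F) (l : (Fin m → F) → F) :
    ((spt f).filter fun x => l x ≠ 0).card + ((spt f).filter fun x => ¬ (l x ≠ 0)).card =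
      (spt f).card :=
  Finset.card_filter_add_card_filter_not _

lemma orthB (e : ℕ) : ∀ (f : (Fin m → F) → F), Orth e f → (spt f).card ≤ 2 * e + 1 →
    ∃ p v : Fin m → F, ∀ x, f x ≠ 0 → x - p ∈ Submodule.span F {v} := by
  induction e with
  | zero =>
    intro f _ hc
    by_cases h : ∃ y, f y ≠ 0
    · obtain ⟨y, hy⟩ := h
      refine ⟨y, 0, fun x hx => ?_⟩
      have : x = y := Finset.card_le_one.1 (by simpa using hc) x (by simp [spt, hx]) y
        (by simp [spt, hy])
      simp [this]
    · push Not at h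
      exact ⟨0, 0, fun x hx => absurd (h x) hx⟩
  | succ e ih =>
    intro f hf hc
    by_contra hcol
    push Not at hcol
    obtain ⟨a, ha, -⟩ := hcol 0 0
    obtain ⟨b, hb, hab⟩ := hcol a 0
    obtain ⟨y, hy, hy'⟩ := hcol a (b - a)
    obtain ⟨φ, c, h1, h2⟩ := sep _ a y hy'
    have hs := spt_mul f (fun x => φ x + c)
    have hba : b ≠ a := by rintro rfl; simp at hab
    have ha0 : φ a + c = 0 := h1 a (by simp)
    have hb0 : φ b + c = 0 := h1 b (Submodule.mem_span_singleton_self _)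
    have hA := orthA e _ y (hf φ c) (mul_ne_zero hy h2)
    have hsub : ({a, b} : Finset (Fin m → F)) ⊆ (spt f).filter fun x => ¬ (φ x + c ≠ 0) := by
      intro x hx
      simp only [Finset.mem_insert, Finset.mem_singleton] at hx
      rcases hx with rfl | rfl <;> simp [spt, *]
    have h3 := Finset.card_le_card hsub
    rw [Finset.card_pair hba.symm] at h3
    have h4 := split_card f (fun x => φ x + c)
    rw [hs] at hA
    obtain ⟨p, v, hpv⟩ := ih _ (hf φ c) (by rw [hs]; omega)
    obtain ⟨z, hz, hz'⟩ := hcol p v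
    obtain ⟨ψ, d, h5, h6⟩ := sep _ p z hz'
    have hA2 := orthA e _ z (hf ψ d) (mul_ne_zero hz h6)
    rw [spt_mul f (fun x => ψ x + d)] at hA2
    have h7 := split_card f (fun x => ψ x + d)
    have h8 : ((spt f).filter fun x => φ x + c ≠ 0) ⊆
        (spt f).filter fun x => ¬ (ψ x + d ≠ 0) := by
      intro x hx
      rw [Finset.mem_filter] at hx ⊢
      refine ⟨hx.1, ?_⟩
      have hfx : f x ≠ 0 := by simpa [spt] using hx.1
      simpa using h5 x (hpv x (mul_ne_zero hfx hx.2))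
    have h9 := Finset.card_le_card h8
    omega

lemma orthC (e : ℕ) (f : (Fin m → F) → F) (hf : Orth (e + 1) f)
    (hc : (spt f).card ≤ 2 * e + 4) :
    ∃ p v w : Fin m → F, ∀ x, f x ≠ 0 → x - p ∈ Submodule.span F {v, w} := by
  by_contra hcol
  push Not at hcol
  obtain ⟨a, ha, -⟩ := hcol 0 0 0
  obtain ⟨b, hb, hab⟩ := hcol a 0 0
  have hba : b ≠ a := by rintro rfl; simp at hab
  obtain ⟨t, ht, hat⟩ := hcol a (b - a) (b - a)
  have hat' : t - a ∉ Submodule.span F {b - a} := by simpa using hat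
  have hta : t ≠ a := by rintro rfl; simp at hat'
  have htb : t ≠ b := by
    rintro rfl; exact hat' (Submodule.mem_span_singleton_self _)
  obtain ⟨y, hy, hy'⟩ := hcol a (b - a) (t - a)
  obtain ⟨φ, c, h1, h2⟩ := sep _ a y hy'
  have hs := spt_mul f (fun x => φ x + c)
  have ha0 : φ a + c = 0 := h1 a (by simp)
  have hb0 : φ b + c = 0 := h1 b (Submodule.subset_span (by simp))
  have ht0 : φ t + c = 0 := h1 t (Submodule.subset_span (by simp))
  have hA := orthA e _ y (hf φ c) (mul_ne_zero hy h2)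
  have hsub : ({a, b, t} : Finset (Fin m → F)) ⊆ (spt f).filter fun x => ¬ (φ x + c ≠ 0) := by
    intro x hx
    simp only [Finset.mem_insert, Finset.mem_singleton] at hx
    rcases hx with rfl | rfl | rfl <;> simp [spt, *]
  have h3 := Finset.card_le_card hsub
  rw [Finset.card_eq_three.2 ⟨a, b, t, hba.symm, hta.symm, htb.symm, rfl⟩] at h3
  have h4 := split_card f (fun x => φ x + c)
  rw [hs] at hA
  obtain ⟨p, v, hpv⟩ := orthB e _ (hf φ c) (by rw [hs]; omega)
  obtain ⟨z, hz, hz'⟩ := hcol p v v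
  obtain ⟨ψ, d, h5, h6⟩ := sep _ p z hz'
  have hs2 := spt_mul f (fun x => ψ x + d)
  have hA2 := orthA e _ z (hf ψ d) (mul_ne_zero hz h6)
  rw [hs2] at hA2
  have h7 := split_card f (fun x => ψ x + d)
  have h8 : ((spt f).filter fun x => φ x + c ≠ 0) ⊆
      (spt f).filter fun x => ¬ (ψ x + d ≠ 0) := by
    intro x hx
    rw [Finset.mem_filter] at hx ⊢
    refine ⟨hx.1, ?_⟩
    have hfx : f x ≠ 0 := by simpa [spt] using hx.1
    simpa using h5 x (by simpa using hpv x (mul_ne_zero hfx hx.2))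
  have h9 := Finset.card_le_card h8
  have h10 := Finset.eq_of_subset_of_card_le h8 (by omega)
  have key : ∀ x, f x ≠ 0 → φ x + c = 0 → ψ x + d ≠ 0 := by
    intro x hx hx0 hx1
    have : x ∈ (spt f).filter fun x => ¬ (ψ x + d ≠ 0) := by simp [spt, hx, hx1]
    rw [← h10, Finset.mem_filter] at this
    exact this.2 hx0
  obtain ⟨r, u, hru⟩ := orthB e _ (hf ψ d) (by rw [hs2]; omega)
  obtain ⟨α, hα⟩ := Submodule.mem_span_singleton.1 (hru a (mul_ne_zero ha (key a ha ha0)))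
  obtain ⟨β, hβ⟩ := Submodule.mem_span_singleton.1 (hru b (mul_ne_zero hb (key b hb hb0)))
  obtain ⟨γ, hγ⟩ := Submodule.mem_span_singleton.1 (hru t (mul_ne_zero ht (key t ht ht0)))
  have e1 : b - a = (β - α) • u := by rw [sub_smul, hα, hβ]; abel
  have e2 : t - a = (γ - α) • u := by rw [sub_smul, hα, hγ]; abel
  have hne : β - α ≠ 0 := by
    intro h0
    rw [h0, zero_smul, sub_eq_zero] at e1
    exact hba e1
  apply hat'
  rw [e1, e2, Submodule.mem_span_singleton]
  exact ⟨(γ - α) / (β - α), by rw [smul_smul, div_mul_cancel₀ _ hne]⟩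

end aux

/-- A second weight codeword of `R_q((m-1)(q-1), m)` (weight `2(q-1)`) has its support
contained in an affine plane. -/
theorem stmt14 {F : Type} [Field F] [Fintype F] [DecidableEq F] {m : ℕ}
    (hq : 3 ≤ Fintype.card F) (hm : 2 ≤ m)
    (f : (Fin m → F) → F)
    (hf : RM F ((m - 1) * (Fintype.card F - 1)) m f)
    (hw : wt f = 2 * (Fintype.card F - 1)) :
    ∃ p v w : Fin m → F, ∀ x : Fin m → F, f x ≠ 0 → ∃ c d : F, x = p + c • v + d • w := by
  obtain ⟨P, hP, hPf⟩ := hf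
  obtain ⟨e, he⟩ := Nat.exists_eq_add_of_le hq
  obtain ⟨k, rfl⟩ := Nat.exists_eq_add_of_le hm
  have hO : Orth (e + 1) f := by
    have := orth_of_poly (e + 1) P (by
      rw [he] at hP ⊢
      have h1 : 2 + k - 1 = k + 1 := by omega
      have h2 : 3 + e - 1 = e + 2 := by omega
      rw [h1, h2] at hP
      rw [h2]
      nlinarith)
    simpa [hPf] using this
  obtain ⟨p, v, w, h⟩ := orthC e f hO (by
    change wt f ≤ _
    omega)
  refine ⟨p, v, w, fun x hx => ?_⟩
  obtain ⟨c, d, hcd⟩ := Submodule.mem_span_pair.1 (h x hx)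
  exact ⟨c, d, by rw [add_assoc, hcd]; abel⟩
end
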